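/- Let T and U be computable consistent extensions of PA and n ≥ 1. The following are equivalent: (1) (T,U) is a B_n-pair; (2) there is a Σ_n ∧ Π_n sentence which is simultaneously exactly Σ_n↓Π_n-conservative over T and U; (3) there is a sentence which is simultaneously exactly Σ_n↓Π_n-conservative over T and U. -/

import Mathlib

open FirstOrder Language
open scoped FirstOrder

namespace Guaspari

/-- The first-order language of arithmetic: a constant `0`, a unary function `S`,
binary functions `+` (coded `false`) and `·` (coded `true`), and a binary relation `≤`. -/
def LA : FirstOrder.Language :=
  ⟨fun n => match n with | 0 => Unit | 1 => Unit | 2 => Bool | _ => Empty,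
   fun n => match n with | 2 => Unit | _ => Empty⟩

/-- Sentences of the language of arithmetic. -/
abbrev Snt : Type := LA.Sentence

/-- Theories (sets of sentences) in the language of arithmetic. -/
abbrev Thy : Type := LA.Theory

/-- The term `0`. -/
def zeroT {α : Type} {n : ℕ} : LA.Term (α ⊕ Fin n) :=
  Constants.term (show LA.Constants from Unit.unit)

/-- The term `S t`. -/
def succT {α : Type} {n : ℕ} (t : LA.Term (α ⊕ Fin n)) : LA.Term (α ⊕ Fin n) :=
  Functions.apply₁ (show LA.Functions 1 from Unit.unit) t

/-- The term `t + u`. -/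
def addT {α : Type} {n : ℕ} (t u : LA.Term (α ⊕ Fin n)) : LA.Term (α ⊕ Fin n) :=
  Functions.apply₂ (show LA.Functions 2 from false) t u

/-- The term `t * u`. -/
def mulT {α : Type} {n : ℕ} (t u : LA.Term (α ⊕ Fin n)) : LA.Term (α ⊕ Fin n) :=
  Functions.apply₂ (show LA.Functions 2 from true) t u

/-- The atomic formula `t ≤ u`. -/
def leF {α : Type} {n : ℕ} (t u : LA.Term (α ⊕ Fin n)) : LA.BoundedFormula α n :=
  Relations.boundedFormula₂ (show LA.Relations 2 from Unit.unit) t u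

/-- The `i`-th (de Bruijn-indexed) bound variable as a term. -/
def vT {m : ℕ} (i : Fin m) : LA.Term (Empty ⊕ Fin m) := Term.var (Sum.inr i)

/-- The induction axiom for the formula `φ(x₀,…,x_{k-1}, x_k)` with induction on `x_k`,
universally closed over the parameters `x₀,…,x_{k-1}`. -/
def indAxiom {k : ℕ} (φ : LA.BoundedFormula Empty (k + 1)) : Snt :=
  let base := ∀' ((vT (Fin.last k) =' zeroT) ⟹ φ)
  let step := ∀' (φ ⟹
    ∀' ((vT (Fin.last (k + 1)) =' succT (vT (Fin.castSucc (Fin.last k)))) ⟹ φ.liftAt 1 k))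
  ((base ⊓ step) ⟹ ∀' φ).alls

/-- The axioms of Peano arithmetic `PA`: the basic axioms for `0`, `S`, `+`, `·`, `≤`,
together with the full induction scheme. -/
def PAAx : Thy :=
  {∀' ∼(succT (vT 0) =' zeroT),
   ∀' ∀' ((succT (vT 0) =' succT (vT 1)) ⟹ (vT 0 =' vT 1)),
   ∀' (addT (vT 0) zeroT =' vT 0),
   ∀' ∀' (addT (vT 0) (succT (vT 1)) =' succT (addT (vT 0) (vT 1))),
   ∀' (mulT (vT 0) zeroT =' zeroT),
   ∀' ∀' (mulT (vT 0) (succT (vT 1)) =' addT (mulT (vT 0) (vT 1)) (vT 0)),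
   ∀' ∀' (leF (vT 0) (vT 1) ⇔ ∃' (addT (vT 2) (vT 0) =' vT 1))} ∪
  {φ | ∃ (k : ℕ) (ψ : LA.BoundedFormula Empty (k + 1)), φ = indAxiom ψ}

/-- `Prv T φ`: the sentence `φ` is provable from the theory `T` (equivalently, by the
Gödel completeness theorem, `φ` holds in every model of `T`). -/
def Prv (T : Thy) (φ : Snt) : Prop := T ⊨ᵇ φ

/-- `Th T`: the set of sentences provable from `T`. -/
def Th (T : Thy) : Set Snt := {φ | Prv T φ}

/-- `Con T`: the theory `T` is consistent. -/
def Con (T : Thy) : Prop := ¬ Prv T ⊥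

/-- The theory `T + φ`. -/
def add (T : Thy) (φ : Snt) : Thy := insert φ T

/-- `T` is an extension of `PA`. -/
def ExtPA (T : Thy) : Prop := ∀ φ ∈ PAAx, Prv T φ

/-- `V` is a subtheory of `T` (containing `PA`, as assumed throughout the paper). -/
def SubThy (V T : Thy) : Prop := ExtPA V ∧ ∀ φ, Prv V φ → Prv T φ

/-- Δ₀ (bounded) formulas. -/
inductive IsDelta0 : ∀ {m : ℕ}, LA.BoundedFormula Empty m → Prop
  | falsum {m : ℕ} : IsDelta0 (⊥ : LA.BoundedFormula Empty m)
  | equal {m : ℕ} (t u : LA.Term (Empty ⊕ Fin m)) : IsDelta0 (t =' u)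
  | le {m : ℕ} (t u : LA.Term (Empty ⊕ Fin m)) : IsDelta0 (leF t u)
  | imp {m : ℕ} {φ ψ : LA.BoundedFormula Empty m} :
      IsDelta0 φ → IsDelta0 ψ → IsDelta0 (φ ⟹ ψ)
  | ball {m : ℕ} (t : LA.Term (Empty ⊕ Fin m)) {φ : LA.BoundedFormula Empty (m + 1)} :
      IsDelta0 φ →
      IsDelta0 (∀' (leF (vT (Fin.last m)) (t.relabel (Sum.map id Fin.castSucc)) ⟹ φ))
  | bex {m : ℕ} (t : LA.Term (Empty ⊕ Fin m)) {φ : LA.BoundedFormula Empty (m + 1)} :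
      IsDelta0 φ →
      IsDelta0 (∃' (leF (vT (Fin.last m)) (t.relabel (Sum.map id Fin.castSucc)) ⊓ φ))

mutual
  /-- `Σ_k` formulas (cumulatively: every `Π_k` formula is `Σ_{k+1}`). -/
  inductive IsSigmaFml : ℕ → ∀ {m : ℕ}, LA.BoundedFormula Empty m → Prop
    | ofDelta0 {m : ℕ} {φ : LA.BoundedFormula Empty m} : IsDelta0 φ → IsSigmaFml 0 φ
    | ofPi {k : ℕ} {m : ℕ} {φ : LA.BoundedFormula Empty m} :
        IsPiFml k φ → IsSigmaFml (k + 1) φ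
    | ex {k : ℕ} {m : ℕ} {φ : LA.BoundedFormula Empty (m + 1)} :
        IsSigmaFml (k + 1) φ → IsSigmaFml (k + 1) (∃' φ)
  /-- `Π_k` formulas (cumulatively: every `Σ_k` formula is `Π_{k+1}`). -/
  inductive IsPiFml : ℕ → ∀ {m : ℕ}, LA.BoundedFormula Empty m → Prop
    | ofDelta0 {m : ℕ} {φ : LA.BoundedFormula Empty m} : IsDelta0 φ → IsPiFml 0 φ
    | ofSigma {k : ℕ} {m : ℕ} {φ : LA.BoundedFormula Empty m} :
        IsSigmaFml k φ → IsPiFml (k + 1) φ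
    | all {k : ℕ} {m : ℕ} {φ : LA.BoundedFormula Empty (m + 1)} :
        IsPiFml (k + 1) φ → IsPiFml (k + 1) (∀' φ)
end

/-- The set of `Σ_k` sentences. -/
def SigmaS (k : ℕ) : Set Snt := {φ | IsSigmaFml k φ}

/-- The set of `Π_k` sentences. -/
def PiS (k : ℕ) : Set Snt := {φ | IsPiFml k φ}

/-- The set of `Σ_k ∧ Π_k` sentences, i.e. sentences of the form `σ ∧ π` with
`σ` a `Σ_k` sentence and `π` a `Π_k` sentence. -/
def SigAndPiS (k : ℕ) : Set Snt :=
  {φ | ∃ σ ∈ SigmaS k, ∃ π ∈ PiS k, φ = σ ⊓ π}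

/-- `B(Σ_k)` sentences: Boolean combinations of `Σ_k` sentences. -/
inductive IsBoolSigma (k : ℕ) : Snt → Prop
  | base {φ : Snt} : φ ∈ SigmaS k → IsBoolSigma k φ
  | not {φ : Snt} : IsBoolSigma k φ → IsBoolSigma k (∼φ)
  | imp {φ ψ : Snt} : IsBoolSigma k φ → IsBoolSigma k ψ → IsBoolSigma k (φ ⟹ ψ)
  | inf {φ ψ : Snt} : IsBoolSigma k φ → IsBoolSigma k ψ → IsBoolSigma k (φ ⊓ ψ)
  | sup {φ ψ : Snt} : IsBoolSigma k φ → IsBoolSigma k ψ → IsBoolSigma k (φ ⊔ ψ)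

/-- The set of `B(Σ_k)` sentences. -/
def BSigmaS (k : ℕ) : Set Snt := {φ | IsBoolSigma k φ}

/-- The set of `Γ` sentences provable in `T`, `Th_Γ(T)`. -/
def ThIn (Γ : Set Snt) (T : Thy) : Set Snt := Γ ∩ Th T

instance (i : ℕ) : Encodable (LA.Functions i) :=
  match i with
  | 0 => inferInstanceAs (Encodable Unit)
  | 1 => inferInstanceAs (Encodable Unit)
  | 2 => inferInstanceAs (Encodable Bool)
  | (_ + 3) => inferInstanceAs (Encodable Empty)

instance (i : ℕ) : Encodable (LA.Relations i) :=
  match i with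
  | 0 => inferInstanceAs (Encodable Empty)
  | 1 => inferInstanceAs (Encodable Empty)
  | 2 => inferInstanceAs (Encodable Unit)
  | (_ + 3) => inferInstanceAs (Encodable Empty)

/-- A Gödel numbering of sentences, via Mathlib's encoding of bounded formulas. -/
def gnum (φ : Snt) : ℕ :=
  Encodable.encode
    (show List ((Σ k, LA.Term (Empty ⊕ Fin k)) ⊕ ((Σ n, LA.Relations n) ⊕ ℕ)) from
      BoundedFormula.encoding.encode (⟨0, φ⟩ : Σ n, LA.BoundedFormula Empty n))

/-- The (axiom set of the) theory `T` is computable. -/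
def CompThy (T : Thy) : Prop :=
  ComputablePred (fun m : ℕ => ∃ φ ∈ T, gnum φ = m)

/-- `T` is a computable consistent extension of `PA`. -/
def GoodThy (T : Thy) : Prop := CompThy T ∧ Con T ∧ ExtPA T

/-- `φ` is `Γ`-conservative over `T` for a class of sentences `Γ`:
every `Γ` sentence provable in `T + φ` is provable in `T`. -/
def ConsIn (Γ : Set Snt) (T : Thy) (φ : Snt) : Prop :=
  ∀ γ ∈ Γ, Prv (add T φ) γ → Prv T γ

/-- `φ` is hereditarily `Γ`-conservative over `T`: `Γ`-conservative over every
subtheory of `T` (containing `PA`). -/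
def HConsIn (Γ : Set Snt) (T : Thy) (φ : Snt) : Prop :=
  ∀ V : Thy, SubThy V T → ConsIn Γ V φ

/-- `φ` is `Σ_k↓Π_k`-conservative over `V`. -/
def SPCons (k : ℕ) (V : Thy) (φ : Snt) : Prop :=
  ∀ σ ∈ SigmaS k, ∀ π ∈ PiS k, Prv (add V φ) (σ ⊓ π) → Prv V (σ ⊔ π)

/-- `φ` is hereditarily `Σ_k↓Π_k`-conservative over `T`. -/
def HSPCons (k : ℕ) (T : Thy) (φ : Snt) : Prop :=
  ∀ V : Thy, SubThy V T → SPCons k V φ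

/-- The theory `S` is `Σ_k↓Π_k`-conservative over `PA`. -/
def ThySPConsPA (k : ℕ) (S : Thy) : Prop :=
  ∀ σ ∈ SigmaS k, ∀ π ∈ PiS k, Prv S (σ ⊓ π) → Prv PAAx (σ ⊔ π)

/-- `δ` is a `Δ_k(S)` sentence: `S`-provably equivalent to both a `Σ_k` sentence
and a `Π_k` sentence. -/
def IsDeltaIn (k : ℕ) (S : Thy) (δ : Snt) : Prop :=
  (∃ σ ∈ SigmaS k, Prv S (δ ⇔ σ)) ∧ ∃ π ∈ PiS k, Prv S (δ ⇔ π)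

/-- `φ` is `Δ_k(S)`-conservative over `V`. -/
def DeltaConsRel (k : ℕ) (S V : Thy) (φ : Snt) : Prop :=
  ∀ δ : Snt, IsDeltaIn k S δ → Prv (add V φ) δ → Prv V δ

/-- `φ` is `Δ_k`-conservative over `T`, i.e. `Δ_k(Th(T))`-conservative over `T`. -/
def DeltaCons (k : ℕ) (T : Thy) (φ : Snt) : Prop := DeltaConsRel k (Th T) T φ

/-- `φ` is hereditarily `Δ_k`-conservative over `T`. -/
def HDeltaCons (k : ℕ) (T : Thy) (φ : Snt) : Prop :=
  ∀ V : Thy, SubThy V T → DeltaConsRel k (Th V) V φ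

/-- `φ` is doubly `Π_k`-conservative over `T`: `φ` is `Π_k`-conservative and `¬φ` is
`Σ_k`-conservative over `T`. -/
def DCons (k : ℕ) (T : Thy) (φ : Snt) : Prop :=
  ConsIn (PiS k) T φ ∧ ConsIn (SigmaS k) T (∼φ)

/-- `φ` is hereditarily doubly `Π_k`-conservative over `T`. -/
def HDCons (k : ℕ) (T : Thy) (φ : Snt) : Prop :=
  ∀ V : Thy, SubThy V T → DCons k V φ

/-- `(T,U)` is a `B_n`-pair. -/
def Bpair (n : ℕ) (T U : Thy) : Prop :=
  (¬ ThIn (PiS n) T ⊆ Th U ∨ Con (T ∪ ThIn (PiS n) U)) ∧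
  (¬ ThIn (PiS n) U ⊆ Th T ∨ Con (U ∪ ThIn (PiS n) T))

/-- `(T,U)` is a `C_n`-pair. -/
def Cpair (n : ℕ) (T U : Thy) : Prop :=
  Con (T ∪ ThIn (PiS n) U) ∧ Con (U ∪ ThIn (PiS n) T)

/-- `(T,U)` is a `C⁻_n`-pair. -/
def Cmpair (n : ℕ) (T U : Thy) : Prop :=
  Con (T ∪ ThIn (PiS n) U) ∨ Con (U ∪ ThIn (PiS n) T)

/-- `(T,U)` is a `C^∧_n`-pair. -/
def Capair (n : ℕ) (T U : Thy) : Prop :=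
  Con (T ∪ ThIn (SigAndPiS n) U) ∧ Con (U ∪ ThIn (SigAndPiS n) T)

/-- `(T,U)` is a `C^B_n`-pair. -/
def CBpair (n : ℕ) (T U : Thy) : Prop :=
  Con (T ∪ ThIn (BSigmaS n) U)


/-- `φ` is simultaneously exactly `Σ_n↓Π_n`-conservative over `T` and `U`. -/
def SimExSP (n : ℕ) (T U : Thy) (φ : Snt) : Prop :=
  SPCons n T φ ∧ SPCons n U φ ∧
  (∃ ψ ∈ SigmaS n, Prv (add T φ) ψ ∧ Prv (add U φ) ψ ∧ ¬ Prv T ψ ∧ ¬ Prv U ψ) ∧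
  (∃ ψ ∈ PiS n, Prv (add T φ) ψ ∧ Prv (add U φ) ψ ∧ ¬ Prv T ψ ∧ ¬ Prv U ψ)

section

theorem realize_snoc_snoc {M : Type} {k : ℕ} (w : Fin k → M) (a : M) :
    (Fin.snoc w a : Fin (k+1) → M) (Fin.last k) = a := by simp

section raw
variable {M : Type} [inst : LA.Structure M]

/-- raw operations -/
def rz : M := inst.funMap (n := 0) (show LA.Functions 0 from Unit.unit) ![]
def rs (a : M) : M := inst.funMap (n := 1) (show LA.Functions 1 from Unit.unit) ![a]
def ra (a b : M) : M := inst.funMap (n := 2) (show LA.Functions 2 from false) ![a, b]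
def rm (a b : M) : M := inst.funMap (n := 2) (show LA.Functions 2 from true) ![a, b]
def rl (a b : M) : Prop := inst.RelMap (n := 2) (show LA.Relations 2 from Unit.unit) ![a, b]

@[simp] theorem re_zero {α : Type} {n : ℕ} (v : α ⊕ Fin n → M) :
    (zeroT : LA.Term (α ⊕ Fin n)).realize v = rz := by
  simp only [zeroT, Constants.term, Term.realize]
  exact congrArg _ (Subsingleton.elim _ _)
@[simp] theorem re_succ {α : Type} {n : ℕ} (v : α ⊕ Fin n → M) (t : LA.Term (α ⊕ Fin n)) :
    (succT t).realize v = rs (t.realize v) := by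
  exact Term.realize_functions_apply₁
@[simp] theorem re_add {α : Type} {n : ℕ} (v : α ⊕ Fin n → M) (t u : LA.Term (α ⊕ Fin n)) :
    (addT t u).realize v = ra (t.realize v) (u.realize v) := by
  exact Term.realize_functions_apply₂
@[simp] theorem re_mul {α : Type} {n : ℕ} (v : α ⊕ Fin n → M) (t u : LA.Term (α ⊕ Fin n)) :
    (mulT t u).realize v = rm (t.realize v) (u.realize v) := by
  exact Term.realize_functions_apply₂
@[simp] theorem re_le {α : Type} {n : ℕ} (v : α → M) (w : Fin n → M) (t u : LA.Term (α ⊕ Fin n)) :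
    (leF t u).Realize v w ↔ rl (t.realize (Sum.elim v w)) (u.realize (Sum.elim v w)) := by
  exact BoundedFormula.realize_rel₂
@[simp] theorem re_v {n : ℕ} (v : Empty → M) (w : Fin n → M) (i : Fin n) :
    (vT i).realize (Sum.elim v w) = w i := by
  simp [vT]

theorem ind_raw (h : M ⊨ PAAx) {k : ℕ} (φ : LA.BoundedFormula Empty (k + 1)) (w : Fin k → M)
    (R : M → Prop) (hR : ∀ x, φ.Realize default (Fin.snoc w x) ↔ R x)
    (h0 : R rz) (hs : ∀ x, R x → R (rs x)) (x : M) : R x := by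
  have h1 : M ⊨ indAxiom φ := h.realize_of_mem _ (Or.inr ⟨k, φ, rfl⟩)
  unfold indAxiom at h1
  simp only [Sentence.Realize] at h1
  rw [BoundedFormula.realize_alls] at h1
  have h2 := h1 w
  simp only [BoundedFormula.realize_imp, BoundedFormula.realize_inf, BoundedFormula.realize_all,
    BoundedFormula.realize_bdEqual, re_v, re_zero, re_succ, Fin.snoc_last, Fin.snoc_castSucc] at h2
  have h3 := h2 ⟨?_, ?_⟩ x
  · exact (hR x).1 h3
  · intro a ha; subst ha; exact (hR _).2 h0
  · intro a ha b hb
    subst hb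
    rw [BoundedFormula.realize_liftAt_one (by omega)]
    have := (hR (rs a)).2 (hs a ((hR a).1 ha))
    convert this using 1
    funext i
    simp only [Function.comp]
    split_ifs with hi
    · have : i = Fin.castSucc ⟨i, hi⟩ := rfl
      rw [this, Fin.snoc_castSucc, Fin.snoc_castSucc]
      have : Fin.castSucc (Fin.castSucc (⟨i, hi⟩ : Fin k)) = Fin.castSucc (Fin.castSucc ⟨i,hi⟩) := rfl
      rw [Fin.snoc_castSucc]
    · have : i = Fin.last k := by ext; simp; omega
      subst this
      rw [Fin.snoc_last]
      exact Fin.snoc_last (α := fun _ => M) _ _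


theorem q1 (h : M ⊨ PAAx) (a : M) : rs a ≠ rz := by
  have h1 : M ⊨ ∀' ∼(succT (vT 0) =' zeroT) := h.realize_of_mem _ (Or.inl (by simp))
  simpa [Sentence.Realize, Formula.Realize, Fin.snoc] using h1 a
theorem q2 (h : M ⊨ PAAx) (a b : M) : rs a = rs b → a = b := by
  have h1 : M ⊨ ∀' ∀' ((succT (vT 0) =' succT (vT 1)) ⟹ (vT 0 =' vT 1)) := h.realize_of_mem _ (Or.inl (by simp))
  simpa [Sentence.Realize, Formula.Realize, Fin.snoc] using h1 a b
theorem q3 (h : M ⊨ PAAx) (a : M) : ra a rz = a := by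
  have h1 : M ⊨ ∀' (addT (vT 0) zeroT =' vT 0) := h.realize_of_mem _ (Or.inl (by simp))
  simpa [Sentence.Realize, Formula.Realize, Fin.snoc] using h1 a
theorem q4 (h : M ⊨ PAAx) (a b : M) : ra a (rs b) = rs (ra a b) := by
  have h1 : M ⊨ ∀' ∀' (addT (vT 0) (succT (vT 1)) =' succT (addT (vT 0) (vT 1))) := h.realize_of_mem _ (Or.inl (by simp))
  simpa [Sentence.Realize, Formula.Realize, Fin.snoc] using h1 a b
theorem q5 (h : M ⊨ PAAx) (a : M) : rm a rz = rz := by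
  have h1 : M ⊨ ∀' (mulT (vT 0) zeroT =' zeroT) := h.realize_of_mem _ (Or.inl (by simp))
  simpa [Sentence.Realize, Formula.Realize, Fin.snoc] using h1 a
theorem q6 (h : M ⊨ PAAx) (a b : M) : rm a (rs b) = ra (rm a b) a := by
  have h1 : M ⊨ ∀' ∀' (mulT (vT 0) (succT (vT 1)) =' addT (mulT (vT 0) (vT 1)) (vT 0)) := h.realize_of_mem _ (Or.inl (by simp))
  simpa [Sentence.Realize, Formula.Realize, Fin.snoc] using h1 a b
theorem q7 (h : M ⊨ PAAx) (a b : M) : rl a b ↔ ∃ c, ra c a = b := by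
  have h1 : M ⊨ ∀' ∀' (leF (vT 0) (vT 1) ⇔ ∃' (addT (vT 2) (vT 0) =' vT 1)) := h.realize_of_mem _ (Or.inl (by simp))
  simpa [Sentence.Realize, Formula.Realize, Fin.snoc] using h1 a b

theorem r_zero_add (h : M ⊨ PAAx) (a : M) : ra rz a = a := by
  refine ind_raw h (addT zeroT (vT 0) =' vT 0) ![] (fun x => ra rz x = x) (by simp [Fin.snoc]) (q3 h _) ?_ a
  intro x hx; rw [q4 h, hx]
theorem r_succ_add (h : M ⊨ PAAx) (a b : M) : ra (rs a) b = rs (ra a b) := by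
  refine ind_raw h (addT (succT (vT 0)) (vT 1) =' succT (addT (vT 0) (vT 1))) ![a] (fun x => ra (rs a) x = rs (ra a x)) (by simp [Fin.snoc]) (by simp only [q3 h]) ?_ b
  intro x hx; rw [q4 h, hx, q4 h]
theorem r_add_comm (h : M ⊨ PAAx) (a b : M) : ra a b = ra b a := by
  refine ind_raw h (addT (vT 0) (vT 1) =' addT (vT 1) (vT 0)) ![a] (fun x => ra a x = ra x a) (by simp [Fin.snoc]) (by simp only [q3 h, r_zero_add h]) ?_ b
  intro x hx; rw [q4 h, hx, r_succ_add h]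
theorem r_add_assoc (h : M ⊨ PAAx) (a b c : M) : ra (ra a b) c = ra a (ra b c) := by
  refine ind_raw h (addT (addT (vT 0) (vT 1)) (vT 2) =' addT (vT 0) (addT (vT 1) (vT 2))) ![a, b] (fun x => ra (ra a b) x = ra a (ra b x)) (by simp [Fin.snoc]) (by simp only [q3 h]) ?_ c
  intro x hx; rw [q4 h, hx, q4 h, q4 h]
theorem r_zero_mul (h : M ⊨ PAAx) (a : M) : rm rz a = rz := by
  refine ind_raw h (mulT zeroT (vT 0) =' zeroT) ![] (fun x => rm rz x = rz) (by simp [Fin.snoc]) (q5 h _) ?_ a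
  intro x hx; rw [q6 h, hx, q3 h]
theorem r_succ_mul (h : M ⊨ PAAx) (a b : M) : rm (rs a) b = ra (rm a b) b := by
  refine ind_raw h (mulT (succT (vT 0)) (vT 1) =' addT (mulT (vT 0) (vT 1)) (vT 1)) ![a] (fun x => rm (rs a) x = ra (rm a x) x) (by simp [Fin.snoc]) (by simp only [q3 h, q5 h]) ?_ b
  intro x hx
  rw [q6 h, q6 h, hx, q4 h, q4 h, r_add_assoc h, r_add_assoc h, r_add_comm h x a]
theorem r_mul_comm (h : M ⊨ PAAx) (a b : M) : rm a b = rm b a := by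
  refine ind_raw h (mulT (vT 0) (vT 1) =' mulT (vT 1) (vT 0)) ![a] (fun x => rm a x = rm x a) (by simp [Fin.snoc]) (by simp only [q5 h, r_zero_mul h]) ?_ b
  intro x hx; rw [q6 h, hx, r_succ_mul h]
theorem r_left_distrib (h : M ⊨ PAAx) (a b c : M) : rm a (ra b c) = ra (rm a b) (rm a c) := by
  refine ind_raw h (mulT (vT 0) (addT (vT 1) (vT 2)) =' addT (mulT (vT 0) (vT 1)) (mulT (vT 0) (vT 2))) ![a, b] (fun x => rm a (ra b x) = ra (rm a b) (rm a x)) (by simp [Fin.snoc]) (by simp only [q3 h, q5 h]) ?_ c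
  intro x hx; rw [q4 h, q6 h, q6 h, hx, r_add_assoc h]
theorem r_mul_assoc (h : M ⊨ PAAx) (a b c : M) : rm (rm a b) c = rm a (rm b c) := by
  refine ind_raw h (mulT (mulT (vT 0) (vT 1)) (vT 2) =' mulT (vT 0) (mulT (vT 1) (vT 2))) ![a, b] (fun x => rm (rm a b) x = rm a (rm b x)) (by simp [Fin.snoc]) (by simp only [q5 h]) ?_ c
  intro x hx; rw [q6 h, q6 h, hx, r_left_distrib h]
theorem r_cancel (h : M ⊨ PAAx) (a b c : M) : ra a c = ra b c → a = b := by
  refine ind_raw h ((addT (vT 0) (vT 2) =' addT (vT 1) (vT 2)) ⟹ (vT 0 =' vT 1)) ![a, b] (fun x => ra a x = ra b x → a = b) (by simp [Fin.snoc]) (by simp only [q3 h]; exact id) ?_ c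
  intro x hx; rw [q4 h, q4 h]; intro e; exact hx (q2 h _ _ e)
theorem r_cases (h : M ⊨ PAAx) (a : M) : a = rz ∨ ∃ b, a = rs b := by
  refine ind_raw h ((vT 0 =' zeroT) ⊔ (∃' (vT 0 =' succT (vT 1)))) ![] (fun a => a = rz ∨ ∃ b, a = rs b) (by simp [Fin.snoc]) (Or.inl rfl) ?_ a
  intro x hx; exact Or.inr ⟨x, rfl⟩
theorem r_add_eq_zero (h : M ⊨ PAAx) (a b : M) (e : ra a b = rz) : b = rz := by
  rcases r_cases h b with r | ⟨c, rfl⟩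
  · exact r
  · rw [q4 h] at e; exact absurd e (q1 h _)
theorem r_total (h : M ⊨ PAAx) (a b : M) : rl a b ∨ rl b a := by
  refine ind_raw h (leF (vT 0) (vT 1) ⊔ leF (vT 1) (vT 0)) ![a] (fun b => rl a b ∨ rl b a) (by simp [Fin.snoc]) (Or.inr ((q7 h _ _).2 ⟨a, q3 h a⟩)) ?_ b
  rintro x (hx | hx)
  · obtain ⟨c, hc⟩ := (q7 h _ _).1 hx
    exact Or.inl ((q7 h _ _).2 ⟨rs c, by rw [r_succ_add h, hc]⟩)
  · obtain ⟨c, hc⟩ := (q7 h _ _).1 hx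
    rcases r_cases h c with r | ⟨d, rfl⟩
    · left; rw [q7 h]; subst r; rw [r_zero_add h] at hc; subst hc
      exact ⟨rs rz, by rw [r_succ_add h, r_zero_add h]⟩
    · right; rw [q7 h]; exact ⟨d, by rw [q4 h, ← r_succ_add h, hc]⟩
end raw

/-- the arithmetic structure given by ordered semiring operations -/
@[reducible] def strucOf (M : Type) [CommSemiring M] [LE M] : LA.Structure M where
  funMap {n} f v := match n, f, v with
    | 0, _, _ => 0
    | 1, _, v => v 0 + 1
    | 2, false, v => v 0 + v 1
    | 2, true, v => v 0 * v 1
    | (_ + 3), f, _ => nomatch f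
  RelMap {n} r v := match n, r, v with
    | 0, r, _ => nomatch r
    | 1, r, _ => nomatch r
    | 2, _, v => v 0 ≤ v 1
    | (_ + 3), r, _ => nomatch r

/-- models of PA as ordered semirings with induction -/
class PAM (M : Type) extends CommSemiring M, LinearOrder M, IsStrictOrderedRing M,
    CanonicallyOrderedAdd M where
  lt_add_one_iff' : ∀ a b : M, a < b + 1 ↔ a ≤ b
  ind' : ∀ (k : ℕ) (φ : LA.BoundedFormula Empty (k + 1)) (w : Fin k → M),
    @BoundedFormula.Realize LA M (strucOf M) _ _ φ default (Fin.snoc w 0) →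
    (∀ x, @BoundedFormula.Realize LA M (strucOf M) _ _ φ default (Fin.snoc w x) →
      @BoundedFormula.Realize LA M (strucOf M) _ _ φ default (Fin.snoc w (x+1))) →
    ∀ x, @BoundedFormula.Realize LA M (strucOf M) _ _ φ default (Fin.snoc w x)

instance (M : Type) [PAM M] : LA.Structure M := strucOf M

instance : PAM ℕ where
  lt_add_one_iff' := fun a b => Nat.lt_succ_iff
  ind' := fun _ _ _ h0 hs x => Nat.rec h0 (fun n ih => hs n ih) x

theorem exists_pam {M : Type} [inst : LA.Structure M] (h : M ⊨ PAAx) :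
    ∃ P : PAM M, @strucOf M P.toCommSemiring _ = inst := by
  classical
  letI cs : CommSemiring M :=
    { zero := rz, one := rs rz, add := ra, mul := rm, nsmul := @nsmulRec M ⟨rz⟩ ⟨ra⟩, npow := @npowRec M ⟨rs rz⟩ ⟨rm⟩, natCast := @Nat.unaryCast M ⟨rs rz⟩ ⟨rz⟩ ⟨ra⟩
      add_assoc := r_add_assoc h, zero_add := r_zero_add h, add_zero := q3 h
      add_comm := r_add_comm h
      mul_assoc := r_mul_assoc h, mul_comm := r_mul_comm h
      zero_mul := r_zero_mul h, mul_zero := q5 h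
      one_mul := fun a => by
        show rm (rs rz) a = a
        rw [r_succ_mul h, r_zero_mul h, r_zero_add h]
      mul_one := fun a => by
        show rm a (rs rz) = a
        rw [q6 h, q5 h, r_zero_add h]
      left_distrib := r_left_distrib h
      right_distrib := fun a b c => by
        show rm (ra a b) c = ra (rm a c) (rm b c)
        rw [r_mul_comm h, r_left_distrib h, r_mul_comm h a, r_mul_comm h b] }
  have hs : ∀ a : M, rs a = a + 1 := fun a => by
    show rs a = ra a (rs rz)
    rw [q4 h, q3 h]
  have hle : ∀ a b : M, rl a b ↔ ∃ c, c + a = b := q7 h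
  have canc : ∀ a b c : M, a + c = b + c → a = b := r_cancel h
  have az : ∀ a b : M, a + b = 0 → b = 0 := r_add_eq_zero h
  letI lo : LinearOrder M :=
    { le := rl
      le_refl := fun a => (hle _ _).2 ⟨0, zero_add a⟩
      le_trans := fun a b c => by
        simp only [hle]; rintro ⟨x, rfl⟩ ⟨y, rfl⟩; exact ⟨y + x, by ring⟩
      le_antisymm := fun a b => by
        simp only [hle]; rintro ⟨x, rfl⟩ ⟨y, hy⟩
        have : y + x = 0 := canc _ _ a (by rw [zero_add, add_assoc, hy])
        rw [az _ _ this, zero_add]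
      le_total := r_total h
      toDecidableLE := Classical.decRel _ }
  have hle' : ∀ a b : M, a ≤ b ↔ ∃ c, c + a = b := hle
  haveI : CanonicallyOrderedAdd M :=
    { exists_add_of_le := fun {a b} hab => by
        obtain ⟨c, rfl⟩ := (hle' _ _).1 hab; exact ⟨c, add_comm _ _⟩
      le_self_add := fun a b => (hle' _ _).2 ⟨b, add_comm _ _⟩
      le_add_self := fun a b => (hle' _ _).2 ⟨b, rfl⟩ }
  have hlt : ∀ a b : M, a < b + 1 ↔ a ≤ b := by
    intro a b
    constructor
    · intro hab
      obtain ⟨c, hc⟩ := (hle' _ _).1 hab.le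
      rcases r_cases h c with r | ⟨d, rfl⟩
      · change c = 0 at r; subst r; rw [zero_add] at hc; exact absurd hc hab.ne
      · rw [hs] at hc
        refine (hle' _ _).2 ⟨d, canc _ _ 1 ?_⟩
        rw [← hc]; ring
    · intro hab
      obtain ⟨c, rfl⟩ := (hle' _ _).1 hab
      refine lt_of_le_of_ne ((hle' _ _).2 ⟨c + 1, by ring⟩) ?_
      intro e
      have : c + 1 = 0 := canc _ _ a (by rw [zero_add]; conv_rhs => rw [e]
                                         ring)
      rw [← hs] at this
      exact q1 h c this
  haveI : AddRightCancelSemigroup M := { (inferInstance : AddSemigroup M) with add_right_cancel := fun c a b e => canc a b c e }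
  haveI : IsOrderedCancelAddMonoid M :=
    { add_le_add_left := fun a b hab c => by
        obtain ⟨d, rfl⟩ := (hle' _ _).1 hab; exact (hle' _ _).2 ⟨d, by ring⟩
      le_of_add_le_add_left := fun a b c hab => by
        obtain ⟨d, hd⟩ := (hle' _ _).1 hab; exact (hle' _ _).2 ⟨d, canc _ _ a (by rw [add_comm c, ← hd]; ring)⟩ }
  have hmp : ∀ a b c : M, 0 < c → a < b → c * a < c * b := by
    intro a b c hc hab
    obtain ⟨d, rfl⟩ := (hle' _ _).1 hab.le
    rcases r_cases h d with r | ⟨d, rfl⟩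
    · change d = 0 at r; subst r; simp at hab
    · rcases r_cases h c with r | ⟨e, rfl⟩
      · exact absurd r hc.ne'
      · simp only [hs]
        have : (e+1) * (d + 1 + a) = (e * d + e + d + (e+1) * a) + 1 := by ring
        rw [this, hlt]
        exact (hle' _ _).2 ⟨_, rfl⟩
  haveI : IsStrictOrderedRing M :=
    { zero_le_one := (hle' _ _).2 ⟨1, add_zero _⟩
      exists_pair_ne := ⟨0, 1, fun e => q1 h rz e.symm⟩
      mul_lt_mul_of_pos_left := fun a ha b c hbc => hmp _ _ _ ha hbc
      mul_lt_mul_of_pos_right := fun a ha b c hbc => by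
        show b * a < c * a
        rw [mul_comm b, mul_comm c]; exact hmp _ _ _ ha hbc }
  have key : @strucOf M cs _ = inst := by
    have hv1 : ∀ v : Fin 1 → M, v = ![v 0] := fun v => by funext i; fin_cases i; rfl
    have hv2 : ∀ v : Fin 2 → M, v = ![v 0, v 1] := fun v => by funext i; fin_cases i <;> rfl
    refine FirstOrder.Language.Structure.ext ?_ ?_
    · funext n f v
      match n, f, v with
      | 0, _, v => show rz = _; exact congrArg (inst.funMap _) (Subsingleton.elim (α := Fin 0 → M) _ _)
      | 1, _, v => show v 0 + 1 = _; rw [← hs]; conv_rhs => rw [hv1 v]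
                   rfl
      | 2, false, v => show ra (v 0) (v 1) = _; conv_rhs => rw [hv2 v]
                       rfl
      | 2, true, v => show rm (v 0) (v 1) = _; conv_rhs => rw [hv2 v]
                      rfl
      | (_ + 3), f, _ => exact nomatch f
    · funext n f v
      match n, f, v with
      | 0, r, v => exact nomatch r
      | 1, r, _ => exact nomatch r
      | 2, _, v => show rl (v 0) (v 1) = _; conv_rhs => rw [hv2 v]
                   rfl
      | (_ + 3), r, _ => exact nomatch r
  refine ⟨{ cs, lo, (inferInstance : CanonicallyOrderedAdd M), (inferInstance : IsStrictOrderedRing M) with lt_add_one_iff' := hlt, ind' := ?_ }, key⟩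
  intro k φ w h0 hst x
  have key' := key
  revert h0 hst
  generalize hS : strucOf M = S
  have : S = inst := hS.symm.trans key
  subst this
  intro h0 hst
  refine ind_raw h φ w (fun x => φ.Realize default (Fin.snoc w x)) (fun _ => Iff.rfl) h0 ?_ x
  intro y hy; rw [hs]; exact hst y hy
end

section

section pamops
variable {M : Type} [PAM M]
@[simp] theorem rz_eq : (rz : M) = 0 := rfl
@[simp] theorem rs_eq (a : M) : rs a = a + 1 := rfl
@[simp] theorem ra_eq (a b : M) : ra a b = a + b := rfl
@[simp] theorem rm_eq (a b : M) : rm a b = a * b := rfl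
@[simp] theorem rl_eq (a b : M) : rl a b ↔ a ≤ b := Iff.rfl

theorem lt_succ_iff {a b : M} : a < b + 1 ↔ a ≤ b := PAM.lt_add_one_iff' a b
theorem add_one_le {a b : M} : a + 1 ≤ b ↔ a < b := by
  rw [← not_lt, lt_succ_iff, not_le]
theorem zero_or_succ (a : M) : a = 0 ∨ ∃ b, a = b + 1 := by
  rcases eq_or_ne a 0 with h | h
  · exact Or.inl h
  · right
    have : (0 : M) < a := lt_of_le_of_ne zero_le (Ne.symm h)
    obtain ⟨c, hc⟩ := exists_add_of_le (add_one_le.2 this)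
    exact ⟨c, by rw [hc]; ring⟩
end pamops

/-- term substitution -/
def tsb {k m : ℕ} (t : LA.Term (Empty ⊕ Fin k)) (s : Fin k → LA.Term (Empty ⊕ Fin m)) :
    LA.Term (Empty ⊕ Fin m) :=
  t.subst (Sum.elim Empty.elim s)

theorem tsb_realize {M : Type} [LA.Structure M] {k m : ℕ} (t : LA.Term (Empty ⊕ Fin k))
    (s : Fin k → LA.Term (Empty ⊕ Fin m)) (v : Fin m → M) :
    (tsb t s).realize (Sum.elim default v) =
      t.realize (Sum.elim default (fun j => (s j).realize (Sum.elim default v))) := by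
  unfold tsb
  rw [Term.realize_subst]
  congr 1
  funext x
  rcases x with x | x
  · exact x.elim
  · rfl

/-- lifting a term under a binder -/
def tl {m : ℕ} (t : LA.Term (Empty ⊕ Fin m)) : LA.Term (Empty ⊕ Fin (m+1)) :=
  t.relabel (Sum.map id Fin.castSucc)

theorem tl_realize {M : Type} [LA.Structure M] {m : ℕ} (t : LA.Term (Empty ⊕ Fin m))
    (v : Fin (m+1) → M) :
    (tl t).realize (Sum.elim default v) = t.realize (Sum.elim default (fun j => v j.castSucc)) := by
  unfold tl
  rw [Term.realize_relabel]
  congr 1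
  funext x
  rcases x with x | x
  · exact x.elim
  · rfl

def slift {k m : ℕ} (s : Fin k → LA.Term (Empty ⊕ Fin m)) : Fin (k+1) → LA.Term (Empty ⊕ Fin (m+1)) :=
  Fin.snoc (α := fun _ => LA.Term (Empty ⊕ Fin (m+1))) (fun j => tl (s j)) (vT (Fin.last m))

/-- substitution in bounded formulas -/
def sb : {k : ℕ} → LA.BoundedFormula Empty k → {m : ℕ} → (Fin k → LA.Term (Empty ⊕ Fin m)) →
    LA.BoundedFormula Empty m
  | _, .falsum, _, _ => .falsum
  | _, .equal t u, _, s => .equal (tsb t s) (tsb u s)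
  | _, .rel R ts, _, s => .rel R (fun i => tsb (ts i) s)
  | _, .imp a b, _, s => .imp (sb a s) (sb b s)
  | _, .all a, _, s => .all (sb a (slift s))

theorem slift_realize {M : Type} [LA.Structure M] {k m : ℕ} (s : Fin k → LA.Term (Empty ⊕ Fin m))
    (v : Fin m → M) (x : M) :
    (fun j => (slift s j).realize (Sum.elim default (Fin.snoc v x : Fin (m+1) → M))) =
      (Fin.snoc (fun j => (s j).realize (Sum.elim default v)) x : Fin (k+1) → M) := by
  funext j
  refine Fin.lastCases ?_ (fun j => ?_) j
  · simp [slift, vT]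
  · simp only [slift, Fin.snoc_castSucc, tl_realize]

theorem sb_realize {M : Type} [LA.Structure M] : ∀ {k : ℕ} (φ : LA.BoundedFormula Empty k) {m : ℕ}
    (s : Fin k → LA.Term (Empty ⊕ Fin m)) (v : Fin m → M),
    (sb φ s).Realize default v ↔ φ.Realize default (fun j => (s j).realize (Sum.elim default v))
  | _, .falsum, _, _, _ => Iff.rfl
  | _, .equal t u, _, s, v => by
      simp only [sb, BoundedFormula.Realize, tsb_realize]
  | _, .rel R ts, _, s, v => by
      simp only [sb, BoundedFormula.Realize, tsb_realize]
  | _, .imp a b, _, s, v => by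
      simp only [sb, BoundedFormula.Realize, sb_realize a, sb_realize b]
  | _, .all a, _, s, v => by
      simp only [sb, BoundedFormula.Realize, sb_realize a, slift_realize]

theorem tsb_tl {k m : ℕ} (t : LA.Term (Empty ⊕ Fin k)) (s : Fin k → LA.Term (Empty ⊕ Fin m)) :
    tsb (tl t) (slift s) = tl (tsb t s) := by
  induction t with
  | var x =>
    rcases x with x | x
    · exact x.elim
    · simp [tsb, tl, slift, Term.subst, Term.relabel]
  | func f ts ih =>
    simp only [tsb, tl, Term.subst, Term.relabel] at ih ⊢
    congr 1
    funext i; exact ih i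

theorem apply2_tsb {k m : ℕ} (t u : LA.Term (Empty ⊕ Fin k)) (s : Fin k → LA.Term (Empty ⊕ Fin m)) :
    sb (leF t u) s = leF (tsb t s) (tsb u s) := by
  show BoundedFormula.rel _ _ = BoundedFormula.rel _ _
  congr 1
  funext i
  fin_cases i <;> rfl

theorem tsb_last {k m : ℕ} (s : Fin k → LA.Term (Empty ⊕ Fin m)) :
    tsb (vT (Fin.last k)) (slift s) = vT (Fin.last m) := by
  simp [tsb, vT, slift, Term.subst]

theorem IsDelta0.sb {k : ℕ} {φ : LA.BoundedFormula Empty k} (h : IsDelta0 φ) : ∀ {m : ℕ}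
    (s : Fin k → LA.Term (Empty ⊕ Fin m)), IsDelta0 (sb φ s) := by
  induction h with
  | falsum => intro m s; exact .falsum
  | equal t u => intro m s; exact .equal _ _
  | le t u => intro m s; rw [apply2_tsb]; exact .le _ _
  | imp _ _ h1 h2 => intro m s; exact .imp (h1 s) (h2 s)
  | ball t _ h1 =>
    intro m s
    show IsDelta0 (∀' (Guaspari.sb (leF _ (tl t)) (slift s) ⟹ Guaspari.sb _ (slift s)))
    rw [apply2_tsb, tsb_last, tsb_tl]
    exact .ball _ (h1 _)
  | bex t _ h1 =>
    intro m s
    show IsDelta0 (∃' (Guaspari.sb (leF _ (tl t)) (slift s) ⊓ Guaspari.sb _ (slift s)))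
    rw [apply2_tsb, tsb_last, tsb_tl]
    exact .bex _ (h1 _)

section toolkit
variable {ι : Type*} {S : ι → Type} [∀ i, PAM (S i)]

/-- term-definable function families -/
def Tm {k : ℕ} (f : ∀ i : ι, (Fin k → S i) → S i) : Prop :=
  ∃ t : LA.Term (Empty ⊕ Fin k), ∀ i v, t.realize (Sum.elim default v) = f i v
/-- definable relation families -/
def Df {k : ℕ} (R : ∀ i : ι, (Fin k → S i) → Prop) : Prop :=
  ∃ φ : LA.BoundedFormula Empty k, ∀ i v, φ.Realize default v ↔ R i v
/-- Δ₀ relation families -/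
def D0 {k : ℕ} (R : ∀ i : ι, (Fin k → S i) → Prop) : Prop :=
  ∃ φ : LA.BoundedFormula Empty k, IsDelta0 φ ∧ ∀ i v, φ.Realize default v ↔ R i v

namespace Tm
variable {k : ℕ} {f g : ∀ i : ι, (Fin k → S i) → S i}
theorem var (j : Fin k) : Tm (S := S) (fun _ v => v j) := ⟨vT j, by intros; simp⟩
theorem zero : Tm (S := S) (k := k) (fun _ _ => 0) := ⟨zeroT, by intros; simp⟩
theorem add (hf : Tm f) (hg : Tm g) : Tm (fun i v => f i v + g i v) := by
  obtain ⟨t, ht⟩ := hf; obtain ⟨u, hu⟩ := hg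
  exact ⟨addT t u, by intros; simp [ht, hu]⟩
theorem mul (hf : Tm f) (hg : Tm g) : Tm (fun i v => f i v * g i v) := by
  obtain ⟨t, ht⟩ := hf; obtain ⟨u, hu⟩ := hg
  exact ⟨mulT t u, by intros; simp [ht, hu]⟩
theorem one : Tm (S := S) (k := k) (fun _ _ => 1) :=
  ⟨succT zeroT, by intros; simp⟩
theorem natCast (n : ℕ) : Tm (S := S) (k := k) (fun _ _ => (n : S _)) := by
  induction n with
  | zero => simpa using Tm.zero
  | succ n ih => simpa using ih.add Tm.one
theorem ofNat (n : ℕ) [n.AtLeastTwo] : Tm (S := S) (k := k) (fun _ _ => (OfNat.ofNat n : S _)) := by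
  have := Tm.natCast (S := S) (k := k) n
  have e : ∀ i : ι, (OfNat.ofNat n : S i) = (n : S i) := fun i => (Nat.cast_ofNat (R := S i)).symm
  simp only [e]
  exact this
theorem lift (hf : Tm f) : Tm (k := k+1) (fun i v => f i (fun j => v j.castSucc)) := by
  obtain ⟨t, ht⟩ := hf
  exact ⟨tl t, by intros; rw [tl_realize, ht]⟩
theorem comp (hf : Tm f) {m : ℕ} {s : Fin k → ∀ i : ι, (Fin m → S i) → S i} (hs : ∀ j, Tm (s j)) :
    Tm (fun i v => f i (fun j => s j i v)) := by
  obtain ⟨t, ht⟩ := hf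
  choose u hu using hs
  exact ⟨tsb t u, by intros; rw [tsb_realize, ht]; simp only [hu]⟩
end Tm

section
variable {k : ℕ}
theorem snoc_init {M : Type} (v : Fin k → M) (x : M) :
    (fun j : Fin k => (Fin.snoc v x : Fin (k+1) → M) j.castSucc) = v := by
  funext j; simp
end

namespace Df
variable {k : ℕ} {P Q : ∀ i : ι, (Fin k → S i) → Prop} {f g : ∀ i : ι, (Fin k → S i) → S i}
theorem of_iff (h : Df P) (e : ∀ i v, Q i v ↔ P i v) : Df Q := by
  obtain ⟨φ, h⟩ := h; exact ⟨φ, fun i v => (h i v).trans (e i v).symm⟩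
theorem eq (hf : Tm f) (hg : Tm g) : Df (fun i v => f i v = g i v) := by
  obtain ⟨t, ht⟩ := hf; obtain ⟨u, hu⟩ := hg
  exact ⟨t =' u, by intros; simp [ht, hu]⟩
theorem le (hf : Tm f) (hg : Tm g) : Df (fun i v => f i v ≤ g i v) := by
  obtain ⟨t, ht⟩ := hf; obtain ⟨u, hu⟩ := hg
  exact ⟨leF t u, by intros; simp [ht, hu]⟩
theorem false : Df (S := S) (k := k) (fun _ _ => False) := ⟨⊥, by intros; simp⟩
theorem imp (hP : Df P) (hQ : Df Q) : Df (fun i v => P i v → Q i v) := by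
  obtain ⟨t, ht⟩ := hP; obtain ⟨u, hu⟩ := hQ
  exact ⟨t ⟹ u, by intros; simp [ht, hu]⟩
theorem not (hP : Df P) : Df (fun i v => ¬ P i v) := hP.imp .false
theorem and (hP : Df P) (hQ : Df Q) : Df (fun i v => P i v ∧ Q i v) :=
  (hP.imp hQ.not).not.of_iff (by intros; tauto)
theorem or (hP : Df P) (hQ : Df Q) : Df (fun i v => P i v ∨ Q i v) :=
  (hP.not.imp hQ).of_iff (by intros; tauto)
theorem iff (hP : Df P) (hQ : Df Q) : Df (fun i v => P i v ↔ Q i v) :=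
  ((hP.imp hQ).and (hQ.imp hP)).of_iff (by intros; tauto)
theorem all {R : ∀ i : ι, (Fin k → S i) → S i → Prop}
    (h : Df (k := k+1) (fun i v => R i (fun j => v j.castSucc) (v (Fin.last k)))) :
    Df (fun i v => ∀ x, R i v x) := by
  obtain ⟨φ, h⟩ := h
  refine ⟨∀' φ, fun i v => ?_⟩
  simp only [BoundedFormula.realize_all, h, snoc_init, Fin.snoc_last]
theorem ex {R : ∀ i : ι, (Fin k → S i) → S i → Prop}
    (h : Df (k := k+1) (fun i v => R i (fun j => v j.castSucc) (v (Fin.last k)))) :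
    Df (fun i v => ∃ x, R i v x) :=
  (Df.all (R := fun i v x => ¬ R i v x) h.not).not.of_iff (by intros; simp)
theorem comp (h : Df P) {m : ℕ} {s : Fin k → ∀ i : ι, (Fin m → S i) → S i} (hs : ∀ j, Tm (s j)) :
    Df (fun i v => P i (fun j => s j i v)) := by
  obtain ⟨t, ht⟩ := h
  choose u hu using hs
  exact ⟨sb t u, by intros; rw [sb_realize, ht]; simp only [hu]⟩
end Df

theorem Df.ind {M : Type} [PAM M] {k : ℕ} {P : (Fin (k+1) → M) → Prop}
    (h : Df (ι := Unit) (S := fun _ => M) (fun _ => P)) (w : Fin k → M) (h0 : P (Fin.snoc w 0))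
    (hs : ∀ x, P (Fin.snoc w x) → P (Fin.snoc w (x+1))) (x : M) : P (Fin.snoc w x) := by
  obtain ⟨φ, h⟩ := h
  refine (h () _).1 (PAM.ind' k φ w ?_ ?_ x)
  · exact (h () _).2 h0
  · intro x hx; exact (h () _).2 (hs x ((h () _).1 hx))

/-- induction for definable predicates with parameters `w` -/
theorem ind_pred {M : Type} [PAM M] {k : ℕ} (w : Fin k → M) (P : (Fin k → M) → M → Prop)
    (h : Df (ι := Unit) (S := fun _ => M) (k := k+1)
      (fun _ v => P (fun j => v j.castSucc) (v (Fin.last k)))) (h0 : P w 0)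
    (hs : ∀ x, P w x → P w (x+1)) (x : M) : P w x := by
  have := Df.ind h w (by simpa [snoc_init] using h0) (by simpa [snoc_init] using hs) x
  simpa [snoc_init] using this

theorem Df.spec {k : ℕ} {P : ∀ i : ι, (Fin k → S i) → Prop} (h : Df P) (i : ι) :
    Df (ι := Unit) (S := fun _ => S i) (fun _ => P i) := by
  obtain ⟨φ, h⟩ := h; exact ⟨φ, fun _ v => h i v⟩

namespace D0
variable {k : ℕ} {P Q : ∀ i : ι, (Fin k → S i) → Prop} {f g : ∀ i : ι, (Fin k → S i) → S i}
theorem df (h : D0 P) : Df P := by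
  obtain ⟨φ, _, h⟩ := h; exact ⟨φ, h⟩
theorem of_iff (h : D0 P) (e : ∀ i v, Q i v ↔ P i v) : D0 Q := by
  obtain ⟨φ, h0, h⟩ := h; exact ⟨φ, h0, fun i v => (h i v).trans (e i v).symm⟩
theorem eq (hf : Tm f) (hg : Tm g) : D0 (fun i v => f i v = g i v) := by
  obtain ⟨t, ht⟩ := hf; obtain ⟨u, hu⟩ := hg
  exact ⟨t =' u, .equal _ _, by intros; simp [ht, hu]⟩
theorem le (hf : Tm f) (hg : Tm g) : D0 (fun i v => f i v ≤ g i v) := by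
  obtain ⟨t, ht⟩ := hf; obtain ⟨u, hu⟩ := hg
  exact ⟨leF t u, .le _ _, by intros; simp [ht, hu]⟩
theorem false : D0 (S := S) (k := k) (fun _ _ => False) := ⟨⊥, .falsum, by intros; simp⟩
theorem imp (hP : D0 P) (hQ : D0 Q) : D0 (fun i v => P i v → Q i v) := by
  obtain ⟨t, h1, ht⟩ := hP; obtain ⟨u, h2, hu⟩ := hQ
  exact ⟨t ⟹ u, .imp h1 h2, by intros; simp [ht, hu]⟩
theorem not (hP : D0 P) : D0 (fun i v => ¬ P i v) := hP.imp .false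
theorem true : D0 (S := S) (k := k) (fun _ _ => True) := D0.false.not.of_iff (by simp)
theorem and (hP : D0 P) (hQ : D0 Q) : D0 (fun i v => P i v ∧ Q i v) :=
  (hP.imp hQ.not).not.of_iff (by intros; tauto)
theorem or (hP : D0 P) (hQ : D0 Q) : D0 (fun i v => P i v ∨ Q i v) :=
  (hP.not.imp hQ).of_iff (by intros; tauto)
theorem iff (hP : D0 P) (hQ : D0 Q) : D0 (fun i v => P i v ↔ Q i v) :=
  ((hP.imp hQ).and (hQ.imp hP)).of_iff (by intros; tauto)
theorem lt (hf : Tm f) (hg : Tm g) : D0 (fun i v => f i v < g i v) :=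
  (D0.le hg hf).not.of_iff (by intros; simp)
theorem ball {R : ∀ i : ι, (Fin k → S i) → S i → Prop} (hf : Tm f)
    (h : D0 (k := k+1) (fun i v => R i (fun j => v j.castSucc) (v (Fin.last k)))) :
    D0 (fun i v => ∀ x, x ≤ f i v → R i v x) := by
  obtain ⟨φ, h0, h⟩ := h
  obtain ⟨t, ht⟩ := hf
  refine ⟨∀' (leF (vT (Fin.last k)) (tl t) ⟹ φ), .ball t h0, fun i v => ?_⟩
  simp only [BoundedFormula.realize_all, h, snoc_init, Fin.snoc_last, BoundedFormula.realize_imp,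
    re_le, re_v, tl_realize, rl_eq, ht]
theorem bex {R : ∀ i : ι, (Fin k → S i) → S i → Prop} (hf : Tm f)
    (h : D0 (k := k+1) (fun i v => R i (fun j => v j.castSucc) (v (Fin.last k)))) :
    D0 (fun i v => ∃ x, x ≤ f i v ∧ R i v x) :=
  (D0.ball (R := fun i v x => ¬ R i v x) hf h.not).not.of_iff (by intros; simp)
theorem comp (h : D0 P) {m : ℕ} {s : Fin k → ∀ i : ι, (Fin m → S i) → S i} (hs : ∀ j, Tm (s j)) :
    D0 (fun i v => P i (fun j => s j i v)) := by
  obtain ⟨t, h0, ht⟩ := h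
  choose u hu using hs
  exact ⟨sb t u, h0.sb _, by intros; rw [sb_realize, ht]; simp only [hu]⟩
theorem spec (h : D0 P) (i : ι) :
    D0 (ι := Unit) (S := fun _ => S i) (fun _ => P i) := by
  obtain ⟨φ, h0, h⟩ := h; exact ⟨φ, h0, fun _ v => h i v⟩
end D0

/-- Σ_n relation families -/
def Sg : ℕ → ∀ {k : ℕ}, (∀ i : ι, (Fin k → S i) → Prop) → Prop
  | 0, _, R => D0 R
  | n+1, k, R => ∃ Q : ∀ i : ι, (Fin (k+1) → S i) → Prop, Sg n Q ∧
      ∀ i v, R i v ↔ ∃ x, ¬ Q i (Fin.snoc v x)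
def Pg (n : ℕ) {k : ℕ} (R : ∀ i : ι, (Fin k → S i) → Prop) : Prop := Sg n (fun i v => ¬ R i v)


/-- collection -/
theorem collection {M : Type} [PAM M] {k : ℕ} (w : Fin k → M) (P : (Fin k → M) → M → M → Prop)
    (h : Df (ι := Unit) (S := fun _ => M) (k := k+2)
      (fun _ v => P (fun j => v j.castSucc.castSucc) (v (Fin.last k).castSucc) (v (Fin.last (k+1)))))
    (t : M) (ht : ∀ y, y ≤ t → ∃ x, P w y x) : ∃ z, ∀ y, y ≤ t → ∃ x, x ≤ z ∧ P w y x := by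
  have key : ∀ s : M, s ≤ t → ∃ z, ∀ y, y ≤ s → ∃ x, x ≤ z ∧ P w y x := by
    intro s
    have := ind_pred (Fin.snoc w t : Fin (k+1) → M) (fun u s => s ≤ u (Fin.last k) →
        ∃ z, ∀ y, y ≤ s → ∃ x, x ≤ z ∧ P (fun j => u j.castSucc) y x) ?_ ?_ ?_ s
    · simpa only [snoc_init, Fin.snoc_last] using this
    · refine Df.imp (Df.le (Tm.var _) (Tm.var _)) (Df.ex (Df.all (Df.imp (Df.le (Tm.var _) (Tm.var _))
        (Df.ex (Df.and (Df.le (Tm.var _) (Tm.var _)) ?_)))))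
      have := h.comp (s := fun j => Fin.snoc (α := fun _ => ∀ i : Unit, (Fin (k+1+1+1+1+1) → M) → M) (Fin.snoc (α := fun _ => ∀ i : Unit, (Fin (k+1+1+1+1+1) → M) → M)
        (fun j : Fin k => fun _ v => v j.castSucc.castSucc.castSucc.castSucc.castSucc)
        (fun _ v => v (Fin.last (k+3)).castSucc)) (fun _ v => v (Fin.last (k+4))) j) ?_
      · simpa using this
      · intro j
        refine Fin.lastCases ?_ (fun j => ?_) j
        · simpa using Tm.var _
        · refine Fin.lastCases ?_ (fun j => ?_) j
          · simpa using Tm.var _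
          · simpa using Tm.var _
    · simp only [snoc_init, Fin.snoc_last]
      intro _
      obtain ⟨x, hx⟩ := ht 0 zero_le
      refine ⟨x, fun y hy => ⟨x, le_rfl, ?_⟩⟩
      have : y = 0 := le_antisymm hy zero_le
      rwa [this]
    · simp only [snoc_init, Fin.snoc_last]
      intro s ih hs
      obtain ⟨z, hz⟩ := ih (le_trans (by simp) hs)
      obtain ⟨x, hx⟩ := ht _ hs
      refine ⟨z + x, fun y hy => ?_⟩
      rcases hy.lt_or_eq with h1 | rfl
      · obtain ⟨x', hx', h2⟩ := hz y (lt_succ_iff.1 h1)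
        exact ⟨x', hx'.trans le_self_add, h2⟩
      · exact ⟨x, le_add_self, hx⟩
  exact key t le_rfl

theorem Sg.of_iff {n k : ℕ} {P Q : ∀ i : ι, (Fin k → S i) → Prop} (h : Sg n P)
    (e : ∀ i v, Q i v ↔ P i v) : Sg n Q := by
  have : Q = P := by funext i v; exact propext (e i v)
  rwa [this]
theorem Pg.of_iff {n k : ℕ} {P Q : ∀ i : ι, (Fin k → S i) → Prop} (h : Pg n P)
    (e : ∀ i v, Q i v ↔ P i v) : Pg n Q := by
  have : Q = P := by funext i v; exact propext (e i v)
  rwa [this]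
theorem snoc_castSucc_last {M : Type} {k : ℕ} (v : Fin (k+1) → M) :
    (Fin.snoc (fun j : Fin k => v j.castSucc) (v (Fin.last k)) : Fin (k+1) → M) = v := by
  funext j
  refine Fin.lastCases ?_ (fun j => ?_) j <;> simp

theorem Sg.comp {n : ℕ} : ∀ {k : ℕ} {P : ∀ i : ι, (Fin k → S i) → Prop} (_ : Sg n P) {m : ℕ}
    {s : Fin k → ∀ i : ι, (Fin m → S i) → S i} (_ : ∀ j, Tm (s j)),
    Sg n (fun i v => P i (fun j => s j i v)) := by
  induction n with
  | zero => intro k P h m s hs; exact D0.comp h hs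
  | succ n ih =>
    intro k P h m s hs
    obtain ⟨Q, hQ, e⟩ := h
    refine ⟨fun i v => Q i (fun j => Fin.snoc (α := fun _ => S i) (fun j => s j i (fun j => v j.castSucc)) (v (Fin.last m)) j), ?_, ?_⟩
    · have := ih hQ (m := m+1) (s := Fin.snoc (α := fun _ => ∀ i : ι, (Fin (m+1) → S i) → S i) (fun j i v => s j i (fun j => v j.castSucc)) (fun i v => v (Fin.last m))) ?_
      · refine this.of_iff fun i v => ?_
        apply iff_of_eq; congr 1; funext j
        refine Fin.lastCases ?_ (fun j => ?_) j <;> simp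
      · intro j
        refine Fin.lastCases ?_ (fun j => ?_) j
        · simpa using Tm.var _
        · simpa using (hs j).lift
    · intro i v
      simp only [e, snoc_init, Fin.snoc_last]

theorem Sg.df {n : ℕ} : ∀ {k : ℕ} {P : ∀ i : ι, (Fin k → S i) → Prop} (_ : Sg n P), Df P := by
  induction n with
  | zero => intro k P h; exact D0.df h
  | succ n ih =>
    rintro k P ⟨Q, hQ, e⟩
    refine (Df.ex (R := fun i v x => ¬ Q i (Fin.snoc v x)) ?_).of_iff e
    simp only [snoc_castSucc_last]
    exact (ih hQ).not

theorem Sg.of_D0 {n : ℕ} : ∀ {k : ℕ} {P : ∀ i : ι, (Fin k → S i) → Prop} (_ : D0 P), Sg n P := by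
  induction n with
  | zero => intro k P h; exact h
  | succ n ih =>
    intro k P h
    refine ⟨_, ih ((h.comp (m := k+1) (s := fun j _ v => v j.castSucc) (fun j => Tm.var _)).not), ?_⟩
    intro i v; simp

theorem Pg.of_D0 {n : ℕ} {k : ℕ} {P : ∀ i : ι, (Fin k → S i) → Prop} (h : D0 P) : Pg n P :=
  Sg.of_D0 h.not
theorem Pg.comp {n k : ℕ} {P : ∀ i : ι, (Fin k → S i) → Prop} (h : Pg n P) {m : ℕ}
    {s : Fin k → ∀ i : ι, (Fin m → S i) → S i} (hs : ∀ j, Tm (s j)) :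
    Pg n (fun i v => P i (fun j => s j i v)) := Sg.comp h hs
theorem Pg.df {n k : ℕ} {P : ∀ i : ι, (Fin k → S i) → Prop} (h : Pg n P) : Df P :=
  (Sg.df h).not.of_iff (by intros; simp)
theorem Sg.not {n k : ℕ} {P : ∀ i : ι, (Fin k → S i) → Prop} (h : Sg n P) :
    Pg n (fun i v => ¬ P i v) := Sg.of_iff h (by intros; simp)
theorem Pg.not {n k : ℕ} {P : ∀ i : ι, (Fin k → S i) → Prop} (h : Pg n P) :
    Sg n (fun i v => ¬ P i v) := h

/-- closure package at level n -/
structure Clo (n : ℕ) : Prop where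
  and : ∀ {k : ℕ} {P Q : ∀ i : ι, (Fin k → S i) → Prop}, Sg n P → Sg n Q → Sg n (fun i v => P i v ∧ Q i v)
  or : ∀ {k : ℕ} {P Q : ∀ i : ι, (Fin k → S i) → Prop}, Sg n P → Sg n Q → Sg n (fun i v => P i v ∨ Q i v)
  ball : ∀ {k : ℕ} {f : ∀ i : ι, (Fin k → S i) → S i} {R : ∀ i : ι, (Fin k → S i) → S i → Prop}, Tm f →
    Sg n (k := k+1) (fun i v => R i (fun j => v j.castSucc) (v (Fin.last k))) →
    Sg n (fun i v => ∀ x, x ≤ f i v → R i v x)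
  bex : ∀ {k : ℕ} {f : ∀ i : ι, (Fin k → S i) → S i} {R : ∀ i : ι, (Fin k → S i) → S i → Prop}, Tm f →
    Sg n (k := k+1) (fun i v => R i (fun j => v j.castSucc) (v (Fin.last k))) →
    Sg n (fun i v => ∃ x, x ≤ f i v ∧ R i v x)

theorem Sg.ex_of_clo {n : ℕ} (c : Clo (S := S) n) {k : ℕ} {R : ∀ i : ι, (Fin k → S i) → S i → Prop}
    (h : Sg (n+1) (k := k+1) (fun i v => R i (fun j => v j.castSucc) (v (Fin.last k)))) :
    Sg (n+1) (fun i v => ∃ x, R i v x) := by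
  obtain ⟨Q, hQ, e⟩ := h
  refine ⟨fun i v => ∀ y, y ≤ v (Fin.last k) → ∀ x, x ≤ v (Fin.last k) → Q i (Fin.snoc (Fin.snoc (fun j => v j.castSucc) y : Fin (k+1) → S i) x), ?_, ?_⟩
  · refine c.ball (Tm.var _) (c.ball (Tm.var _) ?_)
    have := hQ.comp (m := k + 3) (s := Fin.snoc (α := fun _ => ∀ i : ι, (Fin (k+3) → S i) → S i) (Fin.snoc (α := fun _ => ∀ i : ι, (Fin (k+3) → S i) → S i) (fun j i v => v j.castSucc.castSucc.castSucc) (fun i v => v (Fin.last (k+1)).castSucc)) (fun i v => v (Fin.last (k+2)))) ?_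
    · refine this.of_iff fun i v => ?_
      apply iff_of_eq; congr 1; funext j
      refine Fin.lastCases ?_ (fun j => ?_) j
      · simp
      · refine Fin.lastCases ?_ (fun j => ?_) j <;> simp
    · intro j
      refine Fin.lastCases ?_ (fun j => ?_) j
      · simpa using Tm.var _
      · refine Fin.lastCases ?_ (fun j => ?_) j
        · simpa using Tm.var _
        · simpa using Tm.var _
  · intro i v
    have e' : ∀ y, R i v y ↔ ∃ x, ¬ Q i (Fin.snoc (Fin.snoc v y : Fin (k+1) → S i) x) := by
      intro y
      have := e i (Fin.snoc v y)
      simpa only [snoc_init, Fin.snoc_last] using this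
    simp only [e', snoc_init, Fin.snoc_last]
    push Not
    constructor
    · rintro ⟨y, x, h⟩
      exact ⟨y + x, y, le_self_add, x, le_add_self, h⟩
    · rintro ⟨z, y, _, x, _, h⟩
      exact ⟨y, x, h⟩

theorem Sg.lift {n k : ℕ} {P : ∀ i : ι, (Fin k → S i) → Prop} (h : Sg n P) :
    Sg n (k := k+1) (fun i v => P i (fun j => v j.castSucc)) :=
  h.comp (m := k+1) (s := fun j _ v => v j.castSucc) (fun j => Tm.var _)

theorem clo : ∀ n : ℕ, Clo (S := S) n := by
  intro n
  induction n with
  | zero =>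
    exact ⟨fun h1 h2 => D0.and h1 h2, fun h1 h2 => D0.or h1 h2, fun h1 h2 => D0.ball h1 h2,
      fun h1 h2 => D0.bex h1 h2⟩
  | succ n c =>
    have ex := @Sg.ex_of_clo ι S _ n c
    have hand : ∀ {k : ℕ} {P Q : ∀ i : ι, (Fin k → S i) → Prop}, Sg (n+1) P → Sg (n+1) Q → Sg (n+1) (fun i v => P i v ∧ Q i v) := by
      intro k P Q hP hQ
      obtain ⟨P', hP', eP⟩ := hP
      have h2 : Sg (n+1) (k := k + 1) (fun i v => Q i (fun j => v j.castSucc) ∧ ¬ P' i v) := by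
        have := hQ.lift
        obtain ⟨Q', hQ', eQ⟩ := this
        refine ⟨fun i v => Q' i v ∨ P' i (fun j => v j.castSucc), c.or hQ' hP'.lift, ?_⟩
        intro i v
        simp only [eQ, snoc_init]
        push Not
        constructor
        · rintro ⟨⟨x, hx⟩, h⟩; exact ⟨x, hx, h⟩
        · rintro ⟨x, hx, h⟩; exact ⟨⟨x, hx⟩, h⟩
      have := ex (R := fun i v x => Q i v ∧ ¬ P' i (Fin.snoc v x)) (by simpa only [snoc_castSucc_last] using h2)
      refine this.of_iff fun i v => ?_
      simp only [eP]
      constructor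
      · rintro ⟨⟨x, hx⟩, h⟩; exact ⟨x, h, hx⟩
      · rintro ⟨x, hx, h⟩; exact ⟨⟨x, h⟩, hx⟩
    refine ⟨hand, ?_, ?_, ?_⟩
    · rintro k P Q ⟨P', hP', eP⟩ ⟨Q', hQ', eQ⟩
      refine ⟨_, c.and hP' hQ', ?_⟩
      intro i v
      simp only [eP, eQ, not_and_or, exists_or]
    · rintro k f R hf ⟨Q, hQ, e⟩
      have e' : ∀ i v y, R i v y ↔ ∃ x, ¬ Q i (Fin.snoc (Fin.snoc v y : Fin (k+1) → S i) x) := by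
        intro i v y
        have := e i (Fin.snoc v y)
        simpa only [snoc_init, Fin.snoc_last] using this
      refine ⟨fun i v => ∃ y, y ≤ f i (fun j => v j.castSucc) ∧ ∀ x, x ≤ v (Fin.last k) → Q i (Fin.snoc (Fin.snoc (fun j => v j.castSucc) y : Fin (k+1) → S i) x), ?_, ?_⟩
      · refine c.bex hf.lift (c.ball (Tm.var _) ?_)
        have := hQ.comp (m := k + 3) (s := Fin.snoc (α := fun _ => ∀ i : ι, (Fin (k+3) → S i) → S i) (Fin.snoc (α := fun _ => ∀ i : ι, (Fin (k+3) → S i) → S i) (fun j i v => v j.castSucc.castSucc.castSucc) (fun i v => v (Fin.last (k+1)).castSucc)) (fun i v => v (Fin.last (k+2)))) ?_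
        · refine this.of_iff fun i v => ?_
          apply iff_of_eq; congr 1; funext j
          refine Fin.lastCases ?_ (fun j => ?_) j
          · simp
          · refine Fin.lastCases ?_ (fun j => ?_) j <;> simp
        · intro j
          refine Fin.lastCases ?_ (fun j => ?_) j
          · simpa using Tm.var _
          · refine Fin.lastCases ?_ (fun j => ?_) j
            · simpa using Tm.var _
            · simpa using Tm.var _
      · intro i v
        simp only [e', snoc_init, Fin.snoc_last]
        push Not
        constructor
        · intro h
          refine collection v (fun v y x => ¬ Q i (Fin.snoc (Fin.snoc v y : Fin (k+1) → S i) x)) ?_ _ h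
          have := hQ.df.not.spec i
          refine this.of_iff fun _ v => ?_
          have e2 : (Fin.snoc (Fin.snoc (fun j => v j.castSucc.castSucc) (v (Fin.last k).castSucc) : Fin (k+1) → S i) (v (Fin.last (k+1))) : Fin (k+2) → S i) = v := by
            funext j
            refine Fin.lastCases ?_ (fun j => ?_) j
            · simp
            · refine Fin.lastCases ?_ (fun j => ?_) j <;> simp
          rw [e2]
        · rintro ⟨z, hz⟩ y hy
          obtain ⟨x, _, hx⟩ := hz y hy
          exact ⟨x, hx⟩
    · intro k f R hf h
      exact ex (R := fun i v x => x ≤ f i v ∧ R i v x) (hand (Sg.of_D0 (D0.le (Tm.var _) hf.lift)) h)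

namespace Sg
variable {n k : ℕ} {P Q : ∀ i : ι, (Fin k → S i) → Prop} {f : ∀ i : ι, (Fin k → S i) → S i}
  {R : ∀ i : ι, (Fin k → S i) → S i → Prop}
theorem and (h1 : Sg n P) (h2 : Sg n Q) : Sg n (fun i v => P i v ∧ Q i v) := (clo n).and h1 h2
theorem or (h1 : Sg n P) (h2 : Sg n Q) : Sg n (fun i v => P i v ∨ Q i v) := (clo n).or h1 h2
theorem imp (h1 : Pg n P) (h2 : Sg n Q) : Sg n (fun i v => P i v → Q i v) :=
  ((clo n).or h1 h2).of_iff (by intros; tauto)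
theorem ball (hf : Tm f) (h : Sg n (k := k+1) (fun i v => R i (fun j => v j.castSucc) (v (Fin.last k)))) :
    Sg n (fun i v => ∀ x, x ≤ f i v → R i v x) := (clo n).ball hf h
theorem bex (hf : Tm f) (h : Sg n (k := k+1) (fun i v => R i (fun j => v j.castSucc) (v (Fin.last k)))) :
    Sg n (fun i v => ∃ x, x ≤ f i v ∧ R i v x) := (clo n).bex hf h
theorem ex (h : Sg (n+1) (k := k+1) (fun i v => R i (fun j => v j.castSucc) (v (Fin.last k)))) :
    Sg (n+1) (fun i v => ∃ x, R i v x) := Sg.ex_of_clo (clo n) h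
end Sg
namespace Pg
variable {n k : ℕ} {P Q : ∀ i : ι, (Fin k → S i) → Prop} {f : ∀ i : ι, (Fin k → S i) → S i}
  {R : ∀ i : ι, (Fin k → S i) → S i → Prop}
theorem and (h1 : Pg n P) (h2 : Pg n Q) : Pg n (fun i v => P i v ∧ Q i v) :=
  Sg.of_iff (Sg.or h1 h2) (by intros; tauto)
theorem or (h1 : Pg n P) (h2 : Pg n Q) : Pg n (fun i v => P i v ∨ Q i v) :=
  Sg.of_iff (Sg.and h1 h2) (by intros; tauto)
theorem imp (h1 : Sg n P) (h2 : Pg n Q) : Pg n (fun i v => P i v → Q i v) :=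
  Sg.of_iff (Sg.and h1 h2) (by intros; tauto)
theorem ball (hf : Tm f) (h : Pg n (k := k+1) (fun i v => R i (fun j => v j.castSucc) (v (Fin.last k)))) :
    Pg n (fun i v => ∀ x, x ≤ f i v → R i v x) :=
  Sg.of_iff (Sg.bex (R := fun i v x => ¬ R i v x) hf h) (by intros; push Not; rfl)
theorem bex (hf : Tm f) (h : Pg n (k := k+1) (fun i v => R i (fun j => v j.castSucc) (v (Fin.last k)))) :
    Pg n (fun i v => ∃ x, x ≤ f i v ∧ R i v x) :=
  Sg.of_iff (Sg.ball (R := fun i v x => ¬ R i v x) hf h) (by intros; push Not; rfl)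
theorem all (h : Pg (n+1) (k := k+1) (fun i v => R i (fun j => v j.castSucc) (v (Fin.last k)))) :
    Pg (n+1) (fun i v => ∀ x, R i v x) :=
  Sg.of_iff (Sg.ex (R := fun i v x => ¬ R i v x) h) (by intros; push Not; rfl)
theorem lift (h : Pg n P) : Pg n (k := k+1) (fun i v => P i (fun j => v j.castSucc)) := Sg.lift h
theorem sg_succ (h : Pg n P) : Sg (n+1) P :=
  ⟨_, Sg.lift h, by intros; simp⟩
end Pg
theorem Sg.succ {n : ℕ} : ∀ {k : ℕ} {P : ∀ i : ι, (Fin k → S i) → Prop}, Sg n P → Sg (n+1) P := by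
  induction n with
  | zero => intro k P h; exact Sg.of_D0 h
  | succ n ih =>
    rintro k P ⟨Q, hQ, e⟩
    exact ⟨Q, ih hQ, e⟩
theorem Pg.succ {n k : ℕ} {P : ∀ i : ι, (Fin k → S i) → Prop} (h : Pg n P) : Pg (n+1) P :=
  Sg.succ h
theorem Sg.pg_succ {n k : ℕ} {P : ∀ i : ι, (Fin k → S i) → Prop} (h : Sg n P) : Pg (n+1) P :=
  Pg.sg_succ (P := fun i v => ¬ P i v) (Sg.not h)

/-- every Σ_n family is given by a Σ_n formula -/
theorem Sg.fml {n : ℕ} : ∀ {k : ℕ} {P : ∀ i : ι, (Fin k → S i) → Prop}, Sg n P →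
    (∃ φ : LA.BoundedFormula Empty k, IsSigmaFml n φ ∧ ∀ i v, φ.Realize default v ↔ P i v) ∧
    (∃ φ : LA.BoundedFormula Empty k, IsPiFml n φ ∧ ∀ i v, φ.Realize default v ↔ ¬ P i v) := by
  induction n with
  | zero =>
    rintro k P ⟨φ, h0, h⟩
    refine ⟨⟨φ, .ofDelta0 h0, h⟩, ⟨∼φ, .ofDelta0 (.imp h0 .falsum), ?_⟩⟩
    intro i v; simp [h]
  | succ n ih =>
    rintro k P ⟨Q, hQ, e⟩
    obtain ⟨⟨φ, hφ, eφ⟩, ⟨ψ, hψ, eψ⟩⟩ := ih hQ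
    refine ⟨⟨∃' ψ, .ex (.ofPi hψ), ?_⟩, ⟨∀' φ, .all (.ofSigma hφ), ?_⟩⟩
    · intro i v; simp only [BoundedFormula.realize_ex, e, eψ]
    · intro i v; simp only [BoundedFormula.realize_all, e, eφ]; push Not; rfl

theorem D0.of_fml {m : ℕ} {φ : LA.BoundedFormula Empty m} (h : IsDelta0 φ) :
    D0 (S := S) (fun _ v => φ.Realize default v) := ⟨φ, h, fun _ _ => Iff.rfl⟩

theorem Sg.of_fml {n : ℕ} {m : ℕ} {φ : LA.BoundedFormula Empty m} (h : IsSigmaFml n φ) :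
    Sg n (S := S) (fun _ v => φ.Realize default v) := by
  refine IsSigmaFml.rec (motive_1 := fun n m φ _ => Sg n (S := S) (fun _ v => φ.Realize default v))
    (motive_2 := fun n m φ _ => Pg n (S := S) (fun _ v => φ.Realize default v)) ?_ ?_ ?_ ?_ ?_ ?_ h
  · intro m φ h; exact D0.of_fml h
  · intro k m φ _ h; exact h.sg_succ
  · intro k m φ _ h
    simp only [BoundedFormula.realize_ex]
    refine Sg.ex ?_
    simp only [snoc_castSucc_last]
    exact h
  · intro m φ h; exact Pg.of_D0 (D0.of_fml h)
  · intro k m φ _ h; exact h.pg_succ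
  · intro k m φ _ h
    simp only [BoundedFormula.realize_all]
    refine Pg.all ?_
    simp only [snoc_castSucc_last]
    exact h
theorem Pg.of_fml {n : ℕ} {m : ℕ} {φ : LA.BoundedFormula Empty m} (h : IsPiFml n φ) :
    Pg n (S := S) (fun _ v => φ.Realize default v) := by
  refine IsPiFml.rec (motive_1 := fun n m φ _ => Sg n (S := S) (fun _ v => φ.Realize default v))
    (motive_2 := fun n m φ _ => Pg n (S := S) (fun _ v => φ.Realize default v)) ?_ ?_ ?_ ?_ ?_ ?_ h
  · intro m φ h; exact D0.of_fml h
  · intro k m φ _ h; exact h.sg_succ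
  · intro k m φ _ h
    simp only [BoundedFormula.realize_ex]
    refine Sg.ex ?_
    simp only [snoc_castSucc_last]
    exact h
  · intro m φ h; exact Pg.of_D0 (D0.of_fml h)
  · intro k m φ _ h; exact h.pg_succ
  · intro k m φ _ h
    simp only [BoundedFormula.realize_all]
    refine Pg.all ?_
    simp only [snoc_castSucc_last]
    exact h

end toolkit
end

section

/-- bundled models -/
structure Mdl where
  C : Type
  inst : PAM C
instance (i : Mdl) : PAM i.C := i.inst
def natM : Mdl := ⟨ℕ, inferInstance⟩

section cast
variable {M : Type} [PAM M]
theorem le_cast {n : ℕ} : ∀ {x : M}, x ≤ (n : M) → ∃ m : ℕ, m ≤ n ∧ x = (m : M) := by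
  induction n with
  | zero => intro x hx; exact ⟨0, le_rfl, by simpa using hx⟩
  | succ n ih =>
    intro x hx
    rcases hx.lt_or_eq with h | h
    · push_cast at h
      obtain ⟨m, hm, e⟩ := ih (lt_succ_iff.1 h)
      exact ⟨m, by omega, e⟩
    · exact ⟨n+1, le_rfl, h⟩

theorem tm_cast {k : ℕ} (t : LA.Term (Empty ⊕ Fin k)) (v : Fin k → ℕ) :
    t.realize (Sum.elim default (fun j => (v j : M))) =
      ((t.realize (Sum.elim (@default (Empty → ℕ) Unique.instInhabited) v) : ℕ) : M) := by
  induction t with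
  | var x =>
    rcases x with x | x
    · exact x.elim
    · simp
  | @func l f ts ih =>
    match l, f, ts, ih with
    | 0, _, ts, ih =>
      show (0 : M) = ((0 : ℕ) : M)
      simp
    | 1, _, ts, ih =>
      show (ts 0).realize _ + (1 : M) = (((ts 0).realize _ + 1 : ℕ) : M)
      rw [ih]; simp
    | 2, false, ts, ih =>
      show (ts 0).realize _ + (ts 1).realize _ = (((ts 0).realize _ + (ts 1).realize _ : ℕ) : M)
      rw [ih, ih]; simp
    | 2, true, ts, ih =>
      show (ts 0).realize _ * (ts 1).realize _ = (((ts 0).realize _ * (ts 1).realize _ : ℕ) : M)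
      rw [ih, ih]; simp
    | (_ + 3), f, _, _ => exact nomatch f

theorem snoc_cast {k : ℕ} (v : Fin k → ℕ) (x : ℕ) :
    (Fin.snoc (fun j => (v j : M)) (x : M) : Fin (k+1) → M) =
      (fun j => (((Fin.snoc v x : Fin (k+1) → ℕ) j : ℕ) : M)) := by
  funext j
  refine Fin.lastCases ?_ (fun j => ?_) j <;> simp

theorem d0_cast {k : ℕ} {φ : LA.BoundedFormula Empty k} (h : IsDelta0 φ) : ∀ (v : Fin k → ℕ),
    φ.Realize default (fun j => (v j : M)) ↔ φ.Realize (M := ℕ) (@default (Empty → ℕ) Unique.instInhabited) v := by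
  induction h with
  | falsum => intro v; exact Iff.rfl
  | equal t u => intro v; simp [tm_cast]
  | le t u => intro v; simp [tm_cast]
  | imp _ _ h1 h2 => intro v; simp [h1, h2]
  | ball t _ h1 =>
    intro v
    simp only [BoundedFormula.realize_all, BoundedFormula.realize_imp, re_le, re_v, Fin.snoc_last, rl_eq]
    change (∀ a : M, a ≤ (tl t).realize _ → _) ↔ (∀ a : ℕ, a ≤ (tl t).realize _ → _)
    simp only [tl_realize, snoc_init, tm_cast]
    constructor
    · intro h a ha
      rw [← h1, ← snoc_cast]
      exact h a (by exact_mod_cast ha)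
    · intro h a ha
      obtain ⟨m, hm, rfl⟩ := le_cast ha
      rw [snoc_cast, h1]
      exact h m hm
  | bex t _ h1 =>
    intro v
    simp only [BoundedFormula.realize_ex, BoundedFormula.realize_inf, re_le, re_v, Fin.snoc_last, rl_eq]
    change (∃ a : M, a ≤ (tl t).realize _ ∧ _) ↔ (∃ a : ℕ, a ≤ (tl t).realize _ ∧ _)
    simp only [tl_realize, snoc_init, tm_cast]
    constructor
    · rintro ⟨a, ha, h⟩
      obtain ⟨m, hm, rfl⟩ := le_cast ha
      rw [snoc_cast, h1] at h
      exact ⟨m, hm, h⟩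
    · rintro ⟨a, ha, h⟩
      rw [← h1, ← snoc_cast] at h
      exact ⟨a, by exact_mod_cast ha, h⟩
end cast

theorem D0.cast {k : ℕ} {R : ∀ i : Mdl, (Fin k → i.C) → Prop} (h : D0 R) (i : Mdl) (v : Fin k → ℕ) :
    R i (fun j => (v j : i.C)) ↔ R natM v := by
  obtain ⟨φ, h0, h⟩ := h
  exact ((h i _).symm.trans (d0_cast h0 v)).trans (h natM v)

section coding
variable {M : Type} [PAM M]

/-- pairing -/
def pr (x y : M) : M := (x + y) * (x + y) + x

theorem le_mul_self' (a : M) : a ≤ a * a := by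
  rcases zero_or_succ a with rfl | ⟨b, rfl⟩
  · simp
  · calc b + 1 ≤ (b*b + b) + (b + 1) := le_add_self
      _ = _ := by ring
theorem le_pr_left (x y : M) : x ≤ pr x y := le_add_self
theorem le_pr_right (x y : M) : y ≤ pr x y :=
  calc y ≤ x + y := le_add_self
    _ ≤ _ := le_mul_self' _
    _ ≤ _ := le_self_add
theorem pr_inj {x y a b : M} (h : pr x y = pr a b) : x = a ∧ y = b := by
  have aux : ∀ {x y a b : M}, x + y < a + b → pr x y < pr a b := by
    intro x y a b h
    have h1 := add_one_le.2 h
    calc pr x y ≤ (x+y)*(x+y) + (x + y) := by unfold pr; gcongr; exact le_self_add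
      _ < (x+y)*(x+y) + (x + y) + 1 := lt_succ_iff.2 le_rfl
      _ ≤ (x+y)*(x+y) + (x + y) + 1 + (x + y) := le_self_add
      _ = (x+y+1)*(x+y+1) := by ring
      _ ≤ (a+b)*(a+b) := by gcongr
      _ ≤ _ := le_self_add
  have hs : x + y = a + b := by
    rcases lt_trichotomy (x+y) (a+b) with h1 | h1 | h1
    · exact absurd h (aux h1).ne
    · exact h1
    · exact absurd h (aux h1).ne'
  unfold pr at h
  rw [hs] at h
  have : x = a := add_left_cancel h
  subst this
  exact ⟨rfl, add_left_cancel hs⟩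
@[simp] theorem pr_inj' {x y a b : M} : pr x y = pr a b ↔ x = a ∧ y = b :=
  ⟨pr_inj, by rintro ⟨rfl, rfl⟩; rfl⟩
@[simp] theorem pr_cast (x y : ℕ) : ((pr x y : ℕ) : M) = pr (x : M) (y : M) := by
  unfold pr; push_cast; rfl

theorem dvd_of_dvd_add {a b c : M} (h1 : a ∣ b) (h2 : a ∣ b + c) : a ∣ c := by
  obtain ⟨x, rfl⟩ := h1
  obtain ⟨y, hy⟩ := h2
  rcases le_total x y with h | h
  · obtain ⟨z, rfl⟩ := exists_add_of_le h
    exact ⟨z, by rw [mul_add] at hy; exact add_left_cancel hy⟩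
  · have : a * y ≤ a * x := by gcongr
    have h3 : a * x + c ≤ a * x := hy ▸ this
    have : c = 0 := by simpa using h3
    subst this; exact dvd_zero _

/-- the moduli -/
def md (v t : M) : M := 1 + (t + 1) * v

theorem md_key {v t s d u N : M} (hv : ∀ d, d ≤ N → d + 1 ∣ v) (hd : d ≤ N)
    (e : s = t + (d+1) ∨ t = s + (d+1)) (h : md v t ∣ u * md v s) : md v t ∣ u := by
  have h1 : md v t ∣ u * (d+1) * v := by
    rcases e with rfl | rfl
    · refine dvd_of_dvd_add (b := u * md v t) (dvd_mul_left _ _) ?_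
      have : u * md v t + u * (d+1) * v = u * md v (t + (d+1)) := by unfold md; ring
      rwa [this]
    · refine dvd_of_dvd_add (b := u * md v s) h ?_
      have : u * md v s + u * (d+1) * v = u * md v (s + (d+1)) := by unfold md; ring
      rw [this]; exact dvd_mul_left _ _
  have h2 : md v t ∣ u * (d+1) := by
    refine dvd_of_dvd_add (b := u * (d+1) * v * (t+1)) (h1.mul_right _) ?_
    have : u * (d+1) * v * (t+1) + u * (d+1) = u * (d+1) * md v t := by unfold md; ring
    rw [this]; exact dvd_mul_left _ _
  obtain ⟨e, he⟩ := hv d hd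
  have h3 : md v t ∣ u * v := by
    have := h2.mul_right e
    rwa [mul_assoc, ← he] at this
  refine dvd_of_dvd_add (b := u * v * (t+1)) (h3.mul_right _) ?_
  have : u * v * (t+1) + u = u * md v t := by unfold md; ring
  rw [this]; exact dvd_mul_left _ _

theorem exists_fact (N : M) : ∃ v : M, v ≠ 0 ∧ ∀ d, d ≤ N → d + 1 ∣ v := by
  refine ind_pred (k := 0) ![] (fun _ N => ∃ v : M, v ≠ 0 ∧ ∀ d, d ≤ N → ∃ q, v = (d + 1) * q) ?_ ?_ ?_ N
  · exact Df.ex (Df.and (Df.not (Df.eq (Tm.var _) Tm.zero)) (Df.all (Df.imp (Df.le (Tm.var _) (Tm.var _))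
      (Df.ex (Df.eq (Tm.var _) (((Tm.var _).add Tm.one).mul (Tm.var _)))))))
  · refine ⟨1, one_ne_zero, fun d hd => ⟨1, ?_⟩⟩
    have : d = 0 := by simpa using hd
    subst this; simp
  · rintro x ⟨v, hv, h⟩
    refine ⟨v * (x + 1 + 1), mul_ne_zero hv ?_, fun d hd => ?_⟩
    · have : (0:M) < x + 1 + 1 := lt_succ_iff.2 zero_le
      exact this.ne'
    · rcases hd.lt_or_eq with h1 | rfl
      · obtain ⟨q, rfl⟩ := h d (lt_succ_iff.1 h1)
        exact ⟨q * (x+1+1), by ring⟩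
      · exact ⟨v, by ring⟩

/-- membership in the coded finite set -/
def Mem (t D : M) : Prop := ∃ N, N ≤ D ∧ ∃ u, u ≤ D ∧ ∃ v, v ≤ D ∧ D = pr N (pr u v) ∧ t ≤ N ∧
  ∃ q, q ≤ u ∧ u = md v t * q

theorem Mem.le {t D : M} (h : Mem t D) : t ≤ D := by
  obtain ⟨N, hN, _, _, _, _, _, h, _⟩ := h; exact h.trans hN

theorem exists_set {k : ℕ} (w : Fin k → M) (P : (Fin k → M) → M → Prop)
    (h : Df (ι := Unit) (S := fun _ => M) (k := k+1)
      (fun _ v => P (fun j => v j.castSucc) (v (Fin.last k)))) (N : M) :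
    ∃ D : M, ∀ t, Mem t D ↔ t ≤ N ∧ P w t := by
  obtain ⟨v, hv0, hv⟩ := exists_fact N
  have key : ∀ s : M, ∃ u : M, u ≠ 0 ∧ ∀ t, t ≤ N → ((∃ q, u = md v t * q) ↔ (t < s ∧ P w t)) := by
    intro s
    have := ind_pred (Fin.snoc (Fin.snoc w N : Fin (k+1) → M) v : Fin (k+2) → M) (fun f s => ∃ u : M, u ≠ 0 ∧ ∀ t, t ≤ f (Fin.last k).castSucc →
      ((∃ q, u = (1 + (t+1) * f (Fin.last (k+1))) * q) ↔ (¬ s ≤ t ∧ P (fun j => f j.castSucc.castSucc) t))) ?_ ?_ ?_ s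
    · simpa only [Fin.snoc_castSucc, Fin.snoc_last, not_le, md] using this
    · refine Df.ex (Df.and (Df.not (Df.eq (Tm.var _) Tm.zero)) (Df.all (Df.imp (Df.le (Tm.var _) (Tm.var _)) (Df.iff
        (Df.ex (Df.eq (Tm.var _) ((Tm.one.add (((Tm.var _).add Tm.one).mul (Tm.var _))).mul (Tm.var _))))
        (Df.and (Df.not (Df.le (Tm.var _) (Tm.var _))) ?_)))))
      have := h.comp (s := fun j => Fin.snoc (α := fun _ => ∀ i : Unit, (Fin (k+5) → M) → M)
        (fun j : Fin k => fun _ v => v j.castSucc.castSucc.castSucc.castSucc.castSucc)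
        (fun _ v => v (Fin.last (k+4))) j) ?_
      · simpa using this
      · intro j
        refine Fin.lastCases ?_ (fun j => ?_) j
        · simpa using Tm.var _
        · simpa using Tm.var _
    · simp only [Fin.snoc_castSucc, Fin.snoc_last]
      refine ⟨1, one_ne_zero, fun t ht => ?_⟩
      simp only [zero_le, not_true_eq_false, false_and, iff_false]
      rintro ⟨q, hq⟩
      have h1 : (1 : M) < 1 + (t+1) * v := by
        have : (0:M) < (t+1) * v := mul_pos (lt_succ_iff.2 zero_le) (lt_of_le_of_ne zero_le hv0.symm)
        calc (1:M) = 1 + 0 := by simp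
          _ < _ := by gcongr
      rcases zero_or_succ q with rfl | ⟨q, rfl⟩
      · simp at hq
      · have : 1 + (t+1) * v ≤ 1 := by
          conv_rhs => rw [hq]
          calc 1 + (t+1) * v = (1 + (t+1) * v) * 1 := by ring
            _ ≤ _ := by gcongr; exact le_add_self
        exact absurd h1 this.not_gt
    · simp only [Fin.snoc_castSucc, Fin.snoc_last]
      rintro s ⟨u, hu0, hu⟩
      by_cases hs : s ≤ N ∧ P w s
      · refine ⟨u * md v s, mul_ne_zero hu0 (by unfold md; exact (lt_of_lt_of_le one_pos le_self_add).ne'), fun t ht => ?_⟩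
        change md v t ∣ u * md v s ↔ _
        by_cases hts : t = s
        · subst hts
          refine iff_of_true (dvd_mul_left _ _) ⟨?_, hs.2⟩
          rw [not_le]; exact lt_succ_iff.2 le_rfl
        · have h1 : md v t ∣ u * md v s ↔ md v t ∣ u := by
            refine ⟨fun h => ?_, fun h => h.mul_right _⟩
            rcases lt_or_gt_of_ne hts with h2 | h2
            · obtain ⟨d, rfl⟩ := exists_add_of_le (add_one_le.2 h2)
              refine md_key hv (d := d) (le_trans ?_ hs.1) (Or.inl (by ring)) h
              exact le_add_self
            · obtain ⟨d, rfl⟩ := exists_add_of_le (add_one_le.2 h2)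
              refine md_key hv (d := d) (le_trans ?_ ht) (Or.inr (by ring)) h
              exact le_add_self
          rw [h1]
          have := hu t ht
          change md v t ∣ u ↔ _ at this
          rw [this]
          simp only [not_le, lt_succ_iff]
          exact and_congr_left fun _ => ⟨fun h => h.le, fun h => lt_of_le_of_ne h hts⟩
      · refine ⟨u, hu0, fun t ht => ?_⟩
        rw [hu t ht]
        simp only [not_le, lt_succ_iff]
        refine and_congr_left fun hP => ⟨fun h => h.le, fun h => lt_of_le_of_ne h ?_⟩
        rintro rfl
        exact hs ⟨ht, hP⟩
  obtain ⟨u, hu0, hu⟩ := key (N+1)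
  refine ⟨pr N (pr u v), fun t => ⟨?_, ?_⟩⟩
  · rintro ⟨N', _, u', _, v', _, e, ht, q, _, hq⟩
    obtain ⟨e1, e⟩ := pr_inj e
    obtain ⟨e2, e3⟩ := pr_inj e
    subst e1 e2 e3
    exact ⟨ht, ((hu t ht).1 ⟨q, hq⟩).2⟩
  · rintro ⟨ht, hP⟩
    obtain ⟨q, hq⟩ := (hu t ht).2 ⟨lt_succ_iff.2 ht, hP⟩
    refine ⟨N, le_pr_left _ _, u, (le_pr_left _ _).trans (le_pr_right _ _), v,
      (le_pr_right _ _).trans (le_pr_right _ _), rfl, ht, q, ?_, hq⟩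
    rw [hq]
    calc q = 1 * q := by ring
      _ ≤ _ := by unfold md; gcongr; exact le_self_add
end coding

section
variable {ι : Type*} {S : ι → Type} [∀ i, PAM (S i)] {k : ℕ} {f g : ∀ i : ι, (Fin k → S i) → S i}
theorem Tm.pr (hf : Tm f) (hg : Tm g) : Tm (fun i v => pr (f i v) (g i v)) :=
  ((hf.add hg).mul (hf.add hg)).add hf
theorem D0.mem (hf : Tm f) (hg : Tm g) : D0 (fun i v => Mem (f i v) (g i v)) := by
  unfold Mem md
  refine D0.bex hg (D0.bex hg.lift (D0.bex hg.lift.lift (D0.and (D0.eq hg.lift.lift.lift (Tm.pr (Tm.var _) (Tm.pr (Tm.var _) (Tm.var _)))) (D0.and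
    (D0.le hf.lift.lift.lift (Tm.var _)) (D0.bex (Tm.var _) (D0.eq (Tm.var _) (Tm.mul (Tm.add Tm.one (Tm.mul (Tm.add hf.lift.lift.lift.lift Tm.one) (Tm.var _))) (Tm.var _))))))))
end
end

section

/-- codes of relations -/
inductive Cd
  | idc | fst | snd | zero | succ | add | mul | le | lt | any
  | comp (c d : Cd) | pair (c d : Cd) | union (c d : Cd) | ball (c : Cd)

def Cd.num : Cd → ℕ
  | idc => pr 0 0
  | fst => pr 1 0
  | snd => pr 2 0
  | zero => pr 3 0
  | succ => pr 4 0
  | add => pr 5 0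
  | mul => pr 6 0
  | le => pr 7 0
  | lt => pr 8 0
  | any => pr 9 0
  | comp c d => pr 10 (pr c.num d.num)
  | pair c d => pr 11 (pr c.num d.num)
  | union c d => pr 12 (pr c.num d.num)
  | ball c => pr 13 c.num

section
variable {M : Type} [PAM M]
def Cd.den : Cd → M → M → Prop
  | idc, a, b => b = a
  | fst, a, b => ∃ y, a = pr b y
  | snd, a, b => ∃ x, a = pr x b
  | zero, _, b => b = 0
  | succ, a, b => b = a + 1
  | add, a, b => ∃ x y, a = pr x y ∧ b = x + y
  | mul, a, b => ∃ x y, a = pr x y ∧ b = x * y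
  | le, a, b => b = 0 ∧ ∃ x y, a = pr x y ∧ x ≤ y
  | lt, a, b => b = 0 ∧ ∃ x y, a = pr x y ∧ x < y
  | any, _, _ => True
  | comp c d, a, b => ∃ m, d.den a m ∧ c.den m b
  | pair c d, a, b => ∃ x y, b = pr x y ∧ c.den a x ∧ d.den a y
  | union c d, a, b => c.den a b ∨ d.den a b
  | ball c, a, b => b = 0 ∧ ∃ t a', a = pr t a' ∧ ∀ x, x ≤ t → c.den (pr x a') 0

/-- local correctness -/
def Loc (D c a b : M) : Prop :=
  (c = pr 0 0 ∧ b = a) ∨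
  (c = pr 1 0 ∧ ∃ y, y ≤ a ∧ a = pr b y) ∨
  (c = pr 2 0 ∧ ∃ x, x ≤ a ∧ a = pr x b) ∨
  (c = pr 3 0 ∧ b = 0) ∨
  (c = pr 4 0 ∧ b = a + 1) ∨
  (c = pr 5 0 ∧ ∃ x, x ≤ a ∧ ∃ y, y ≤ a ∧ (a = pr x y ∧ b = x + y)) ∨
  (c = pr 6 0 ∧ ∃ x, x ≤ a ∧ ∃ y, y ≤ a ∧ (a = pr x y ∧ b = x * y)) ∨
  (c = pr 7 0 ∧ b = 0 ∧ ∃ x, x ≤ a ∧ ∃ y, y ≤ a ∧ (a = pr x y ∧ x ≤ y)) ∨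
  (c = pr 8 0 ∧ b = 0 ∧ ∃ x, x ≤ a ∧ ∃ y, y ≤ a ∧ (a = pr x y ∧ x < y)) ∨
  (c = pr 9 0) ∨
  (∃ f, f ≤ c ∧ ∃ g, g ≤ c ∧ (c = pr 10 (pr f g) ∧
    ∃ m, m ≤ D ∧ (Mem (pr g (pr a m)) D ∧ Mem (pr f (pr m b)) D))) ∨
  (∃ f, f ≤ c ∧ ∃ g, g ≤ c ∧ (c = pr 11 (pr f g) ∧
    ∃ x, x ≤ b ∧ ∃ y, y ≤ b ∧ (b = pr x y ∧ Mem (pr f (pr a x)) D ∧ Mem (pr g (pr a y)) D))) ∨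
  (∃ f, f ≤ c ∧ ∃ g, g ≤ c ∧ (c = pr 12 (pr f g) ∧
    (Mem (pr f (pr a b)) D ∨ Mem (pr g (pr a b)) D))) ∨
  (∃ f, f ≤ c ∧ (c = pr 13 f ∧ b = 0 ∧ ∃ t, t ≤ a ∧ ∃ a', a' ≤ a ∧ (a = pr t a' ∧
    ∀ x, x ≤ t → Mem (pr f (pr (pr x a') 0)) D)))

def Just (D : M) : Prop := ∀ e, e ≤ D → (Mem e D → ∃ c, c ≤ e ∧ ∃ a, a ≤ e ∧ ∃ b, b ≤ e ∧
  (e = pr c (pr a b) ∧ Loc D c a b))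

def W0 (D c a : M) : Prop := Just D ∧ Mem (pr c (pr a 0)) D
end

section
variable {ι : Type*} {S : ι → Type} [∀ i, PAM (S i)] {k : ℕ}
theorem D0.just {f : ∀ i : ι, (Fin k → S i) → S i} (hf : Tm f) : D0 (fun i v => Just (f i v)) := by
  have key : D0 (S := S) (k := 1) (fun i v => Just (v 0)) := by
    unfold Just Loc
    repeat' (first | exact Tm.var _ | exact Tm.zero | exact Tm.one | exact Tm.ofNat _ | apply D0.and | apply D0.or | apply D0.ball | apply D0.bex | apply D0.imp | apply D0.mem | apply D0.eq | apply D0.le | apply D0.lt | apply Tm.pr | apply Tm.add | apply Tm.mul)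
  exact key.comp (s := fun _ => f) (fun _ => hf)
theorem D0.w0 {f g h : ∀ i : ι, (Fin k → S i) → S i} (hf : Tm f) (hg : Tm g) (hh : Tm h) :
    D0 (fun i v => W0 (f i v) (g i v) (h i v)) :=
  (D0.just hf).and (D0.mem (hg.pr (hh.pr Tm.zero)) hf)
end

section
variable {M : Type} [PAM M]
theorem Just.loc {D c a b : M} (h : Just D) (hm : Mem (pr c (pr a b)) D) : Loc D c a b := by
  obtain ⟨c', _, a', _, b', _, e, hl⟩ := h _ hm.le hm
  obtain ⟨e1, e⟩ := pr_inj e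
  obtain ⟨e2, e3⟩ := pr_inj e
  subst e1 e2 e3
  exact hl

theorem sound (c : Cd) : ∀ {D a b : M}, Just D → Mem (pr (c.num : M) (pr a b)) D → c.den a b := by
  induction c with
  | idc | fst | snd | zero | succ | add | mul | le | lt | any =>
    intro D a b hJ hm
    have := hJ.loc hm
    simp only [Loc, Cd.num, pr_cast, pr_inj', Nat.cast_zero, Nat.cast_one, Nat.cast_ofNat] at this
    norm_num at this
    try simp only [Cd.den]
    try first | done | tauto | grind
  | comp c d ihc ihd =>
    intro D a b hJ hm
    have := hJ.loc hm
    simp only [Loc, Cd.num, pr_cast, pr_inj', Nat.cast_zero, Nat.cast_one, Nat.cast_ofNat] at this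
    norm_num at this
    obtain ⟨f, _, g, _, ⟨rfl, rfl⟩, m, _, h1, h2⟩ := this
    exact ⟨m, ihd hJ h1, ihc hJ h2⟩
  | pair c d ihc ihd =>
    intro D a b hJ hm
    have := hJ.loc hm
    simp only [Loc, Cd.num, pr_cast, pr_inj', Nat.cast_zero, Nat.cast_one, Nat.cast_ofNat] at this
    norm_num at this
    obtain ⟨f, _, g, _, ⟨rfl, rfl⟩, x, _, y, _, h0, h1, h2⟩ := this
    exact ⟨x, y, h0, ihc hJ h1, ihd hJ h2⟩
  | union c d ihc ihd =>
    intro D a b hJ hm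
    have := hJ.loc hm
    simp only [Loc, Cd.num, pr_cast, pr_inj', Nat.cast_zero, Nat.cast_one, Nat.cast_ofNat] at this
    norm_num at this
    obtain ⟨f, _, g, _, ⟨rfl, rfl⟩, h1⟩ := this
    exact h1.imp (ihc hJ) (ihd hJ)
  | ball c ihc =>
    intro D a b hJ hm
    have := hJ.loc hm
    simp only [Loc, Cd.num, pr_cast, pr_inj', Nat.cast_zero, Nat.cast_one, Nat.cast_ofNat] at this
    norm_num at this
    obtain ⟨f, _, rfl, rfl, t, _, a', _, rfl, h⟩ := this
    exact ⟨rfl, t, a', rfl, fun x hx => ihc hJ (h x hx)⟩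

theorem Loc.mono {D D' c a b : M} (hD : ∀ t, Mem t D → Mem t D') (h : Loc D c a b) : Loc D' c a b := by
  unfold Loc at h ⊢
  rcases h with h | h | h | h | h | h | h | h | h | h | h | h | h | h
  · exact Or.inl h
  · exact Or.inr <| Or.inl h
  · exact Or.inr <| Or.inr <| Or.inl h
  · exact Or.inr <| Or.inr <| Or.inr <| Or.inl h
  · exact Or.inr <| Or.inr <| Or.inr <| Or.inr <| Or.inl h
  · exact Or.inr <| Or.inr <| Or.inr <| Or.inr <| Or.inr <| Or.inl h
  · exact Or.inr <| Or.inr <| Or.inr <| Or.inr <| Or.inr <| Or.inr <| Or.inl h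
  · exact Or.inr <| Or.inr <| Or.inr <| Or.inr <| Or.inr <| Or.inr <| Or.inr <| Or.inl h
  · exact Or.inr <| Or.inr <| Or.inr <| Or.inr <| Or.inr <| Or.inr <| Or.inr <| Or.inr <| Or.inl h
  · exact Or.inr <| Or.inr <| Or.inr <| Or.inr <| Or.inr <| Or.inr <| Or.inr <| Or.inr <| Or.inr <| Or.inl h
  · obtain ⟨f, hf, g, hg, e, m, _, h1, h2⟩ := h
    refine Or.inr <| Or.inr <| Or.inr <| Or.inr <| Or.inr <| Or.inr <| Or.inr <| Or.inr <| Or.inr <| Or.inr <| Or.inl ⟨f, hf, g, hg, e, m, ?_, hD _ h1, hD _ h2⟩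
    exact ((le_pr_right _ _).trans (le_pr_right _ _)).trans (hD _ h1).le
  · obtain ⟨f, hf, g, hg, e, x, hx, y, hy, h0, h1, h2⟩ := h
    exact Or.inr <| Or.inr <| Or.inr <| Or.inr <| Or.inr <| Or.inr <| Or.inr <| Or.inr <| Or.inr <| Or.inr <| Or.inr <| Or.inl ⟨f, hf, g, hg, e, x, hx, y, hy, h0, hD _ h1, hD _ h2⟩
  · obtain ⟨f, hf, g, hg, e, h1⟩ := h
    exact Or.inr <| Or.inr <| Or.inr <| Or.inr <| Or.inr <| Or.inr <| Or.inr <| Or.inr <| Or.inr <| Or.inr <| Or.inr <| Or.inr <| Or.inl ⟨f, hf, g, hg, e, h1.imp (hD _) (hD _)⟩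
  · obtain ⟨f, hf, e, hb, t, ht, a', ha', h0, h1⟩ := h
    exact Or.inr <| Or.inr <| Or.inr <| Or.inr <| Or.inr <| Or.inr <| Or.inr <| Or.inr <| Or.inr <| Or.inr <| Or.inr <| Or.inr <| Or.inr ⟨f, hf, e, hb, t, ht, a', ha', h0, fun x hx => hD _ (h1 x hx)⟩

theorem exists_empty : ∃ D : M, Just D := by
  obtain ⟨D, hD⟩ := exists_set (k := 0) ![] (fun _ (_ : M) => False) Df.false 0
  refine ⟨D, fun e _ he => ?_⟩
  exact absurd he (by rw [hD]; simp)

theorem exists_union (D1 D2 : M) (h1 : Just D1) (h2 : Just D2) : ∃ D : M, Just D ∧ ∀ t, Mem t D ↔ Mem t D1 ∨ Mem t D2 := by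
  obtain ⟨D, hD⟩ := exists_set (k := 2) ![D1, D2] (fun w (t : M) => Mem t (w 0) ∨ Mem t (w 1))
    (Df.or (D0.mem (Tm.var _) (Tm.var _)).df (D0.mem (Tm.var _) (Tm.var _)).df) (D1 + D2)
  have hD' : ∀ t, Mem t D ↔ Mem t D1 ∨ Mem t D2 := by
    intro t
    rw [hD]
    show _ ∧ (Mem t D1 ∨ Mem t D2) ↔ _
    refine ⟨fun h => h.2, fun h => ⟨?_, h⟩⟩
    rcases h with h | h
    · exact h.le.trans le_self_add
    · exact h.le.trans le_add_self
  refine ⟨D, fun e _ he => ?_, hD'⟩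
  rcases (hD' e).1 he with h | h
  · obtain ⟨c, hc, a, ha, b, hb, e', hl⟩ := h1 e h.le h
    exact ⟨c, hc, a, ha, b, hb, e', hl.mono (fun t ht => (hD' t).2 (Or.inl ht))⟩
  · obtain ⟨c, hc, a, ha, b, hb, e', hl⟩ := h2 e h.le h
    exact ⟨c, hc, a, ha, b, hb, e', hl.mono (fun t ht => (hD' t).2 (Or.inr ht))⟩

theorem exists_adj (D c a b : M) (h1 : Just D) (hl : Loc D c a b) :
    ∃ D' : M, Just D' ∧ Mem (pr c (pr a b)) D' := by
  obtain ⟨D', hD⟩ := exists_set (k := 2) ![D, pr c (pr a b)] (fun w (t : M) => Mem t (w 0) ∨ t = w 1)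
    (Df.or (D0.mem (Tm.var _) (Tm.var _)).df (Df.eq (Tm.var _) (Tm.var _))) (D + pr c (pr a b))
  have hD' : ∀ t, Mem t D' ↔ Mem t D ∨ t = pr c (pr a b) := by
    intro t
    rw [hD]
    show _ ∧ (Mem t D ∨ t = pr c (pr a b)) ↔ _
    refine ⟨fun h => h.2, fun h => ⟨?_, h⟩⟩
    rcases h with h | h
    · exact h.le.trans le_self_add
    · rw [h]; exact le_add_self
  refine ⟨D', fun e _ he => ?_, (hD' _).2 (Or.inr rfl)⟩
  rcases (hD' e).1 he with h | h
  · obtain ⟨c, hc, a, ha, b, hb, e', hl⟩ := h1 e h.le h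
    exact ⟨c, hc, a, ha, b, hb, e', hl.mono (fun t ht => (hD' t).2 (Or.inl ht))⟩
  · exact ⟨c, h ▸ le_pr_left _ _, a, h ▸ (le_pr_left _ _).trans (le_pr_right _ _), b,
      h ▸ (le_pr_right _ _).trans (le_pr_right _ _), h, hl.mono (fun t ht => (hD' t).2 (Or.inl ht))⟩

theorem ball_coll (f a' t : M) (h : ∀ x, x ≤ t → ∃ D, Just D ∧ Mem (pr f (pr (pr x a') 0)) D) :
    ∃ D, Just D ∧ ∀ x, x ≤ t → Mem (pr f (pr (pr x a') 0)) D := by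
  have : ∀ s : M, s ≤ t → ∃ D, Just D ∧ ∀ x, x ≤ s → Mem (pr f (pr (pr x a') 0)) D := by
    intro s
    refine ind_pred (k := 3) ![f, a', t] (fun w s => s ≤ w 2 → ∃ D, Just D ∧ ∀ x, x ≤ s → Mem (pr (w 0) (pr (pr x (w 1)) 0)) D) ?_ ?_ ?_ s
    · exact Df.imp (Df.le (Tm.var _) (Tm.var _)) (Df.ex (Df.and (D0.just (Tm.var _)).df (Df.all (Df.imp (Df.le (Tm.var _) (Tm.var _)) (D0.mem (Tm.pr (Tm.var _) (Tm.pr (Tm.pr (Tm.var _) (Tm.var _)) Tm.zero)) (Tm.var _)).df))))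
    · intro _
      obtain ⟨D, h1, h2⟩ := h 0 zero_le
      refine ⟨D, h1, fun x hx => ?_⟩
      have : x = 0 := by simpa using hx
      subst this; exact h2
    · intro s ih hs
      change s + 1 ≤ t at hs
      obtain ⟨D, h1, h2⟩ := ih (le_trans (by simp) hs : s ≤ t)
      obtain ⟨D', h1', h2'⟩ := h _ hs
      obtain ⟨E, hE, hE'⟩ := exists_union D D' h1 h1'
      refine ⟨E, hE, fun x hx => (hE' _).2 ?_⟩
      rcases hx.lt_or_eq with h3 | rfl
      · exact Or.inl (h2 x (lt_succ_iff.1 h3))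
      · exact Or.inr h2'
  exact this t le_rfl

theorem complete (c : Cd) : ∀ {a b : M}, c.den a b → ∃ D, Just D ∧ Mem (pr (c.num : M) (pr a b)) D := by
  induction c with
  | idc =>
    rintro a b h
    obtain ⟨D, hD⟩ := exists_empty (M := M)
    exact exists_adj D _ _ _ hD <| Or.inl ⟨by simp [Cd.num, pr_cast], h⟩
  | fst =>
    rintro a b ⟨y, rfl⟩
    obtain ⟨D, hD⟩ := exists_empty (M := M)
    exact exists_adj D _ _ _ hD <| Or.inr <| Or.inl ⟨by simp [Cd.num, pr_cast], ⟨y, le_pr_right _ _, rfl⟩⟩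
  | snd =>
    rintro a b ⟨y, rfl⟩
    obtain ⟨D, hD⟩ := exists_empty (M := M)
    exact exists_adj D _ _ _ hD <| Or.inr <| Or.inr <| Or.inl ⟨by simp [Cd.num, pr_cast], ⟨y, le_pr_left _ _, rfl⟩⟩
  | zero =>
    rintro a b h
    obtain ⟨D, hD⟩ := exists_empty (M := M)
    exact exists_adj D _ _ _ hD <| Or.inr <| Or.inr <| Or.inr <| Or.inl ⟨by simp [Cd.num, pr_cast], h⟩
  | succ =>
    rintro a b h
    obtain ⟨D, hD⟩ := exists_empty (M := M)
    exact exists_adj D _ _ _ hD <| Or.inr <| Or.inr <| Or.inr <| Or.inr <| Or.inl ⟨by simp [Cd.num, pr_cast], h⟩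
  | add =>
    rintro a b ⟨x, y, rfl, h⟩
    obtain ⟨D, hD⟩ := exists_empty (M := M)
    exact exists_adj D _ _ _ hD <| Or.inr <| Or.inr <| Or.inr <| Or.inr <| Or.inr <| Or.inl ⟨by simp [Cd.num, pr_cast], ⟨x, le_pr_left _ _, y, le_pr_right _ _, rfl, h⟩⟩
  | mul =>
    rintro a b ⟨x, y, rfl, h⟩
    obtain ⟨D, hD⟩ := exists_empty (M := M)
    exact exists_adj D _ _ _ hD <| Or.inr <| Or.inr <| Or.inr <| Or.inr <| Or.inr <| Or.inr <| Or.inl ⟨by simp [Cd.num, pr_cast], ⟨x, le_pr_left _ _, y, le_pr_right _ _, rfl, h⟩⟩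
  | le =>
    rintro a b ⟨h0, x, y, rfl, h⟩
    obtain ⟨D, hD⟩ := exists_empty (M := M)
    exact exists_adj D _ _ _ hD <| Or.inr <| Or.inr <| Or.inr <| Or.inr <| Or.inr <| Or.inr <| Or.inr <| Or.inl ⟨by simp [Cd.num, pr_cast], ⟨h0, x, le_pr_left _ _, y, le_pr_right _ _, rfl, h⟩⟩
  | lt =>
    rintro a b ⟨h0, x, y, rfl, h⟩
    obtain ⟨D, hD⟩ := exists_empty (M := M)
    exact exists_adj D _ _ _ hD <| Or.inr <| Or.inr <| Or.inr <| Or.inr <| Or.inr <| Or.inr <| Or.inr <| Or.inr <| Or.inl ⟨by simp [Cd.num, pr_cast], ⟨h0, x, le_pr_left _ _, y, le_pr_right _ _, rfl, h⟩⟩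
  | any =>
    rintro a b h
    obtain ⟨D, hD⟩ := exists_empty (M := M)
    exact exists_adj D _ _ _ hD <| Or.inr <| Or.inr <| Or.inr <| Or.inr <| Or.inr <| Or.inr <| Or.inr <| Or.inr <| Or.inr <| Or.inl (by simp [Cd.num, pr_cast])
  | comp c d ihc ihd =>
    rintro a b ⟨m, h1, h2⟩
    obtain ⟨D1, hD1, h1⟩ := ihd h1
    obtain ⟨D2, hD2, h2⟩ := ihc h2
    obtain ⟨D, hD, hU⟩ := exists_union D1 D2 hD1 hD2
    refine exists_adj D _ _ _ hD ?_
    refine Or.inr <| Or.inr <| Or.inr <| Or.inr <| Or.inr <| Or.inr <| Or.inr <| Or.inr <| Or.inr <| Or.inr <| Or.inl ?_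
    simp only [Cd.num, pr_cast, Nat.cast_ofNat]
    have h3 := (hU _).2 (Or.inl h1)
    exact ⟨_, (le_pr_left _ _).trans (le_pr_right _ _), _, (le_pr_right _ _).trans (le_pr_right _ _), rfl, m,
      ((le_pr_right _ _).trans (le_pr_right _ _)).trans h3.le, h3, (hU _).2 (Or.inr h2)⟩
  | pair c d ihc ihd =>
    rintro a b ⟨x, y, rfl, h1, h2⟩
    obtain ⟨D1, hD1, h1⟩ := ihc h1
    obtain ⟨D2, hD2, h2⟩ := ihd h2
    obtain ⟨D, hD, hU⟩ := exists_union D1 D2 hD1 hD2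
    refine exists_adj D _ _ _ hD ?_
    refine Or.inr <| Or.inr <| Or.inr <| Or.inr <| Or.inr <| Or.inr <| Or.inr <| Or.inr <| Or.inr <| Or.inr <| Or.inr <| Or.inl ?_
    simp only [Cd.num, pr_cast, Nat.cast_ofNat]
    exact ⟨_, (le_pr_left _ _).trans (le_pr_right _ _), _, (le_pr_right _ _).trans (le_pr_right _ _), rfl, x,
      le_pr_left _ _, y, le_pr_right _ _, rfl, (hU _).2 (Or.inl h1), (hU _).2 (Or.inr h2)⟩
  | union c d ihc ihd =>
    intro a b h
    have : ∃ D : M, Just D ∧ (Mem (pr (c.num : M) (pr a b)) D ∨ Mem (pr (d.num : M) (pr a b)) D) := by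
      rcases h with h | h
      · obtain ⟨D1, hD1, h1⟩ := ihc h
        exact ⟨D1, hD1, Or.inl h1⟩
      · obtain ⟨D1, hD1, h1⟩ := ihd h
        exact ⟨D1, hD1, Or.inr h1⟩
    obtain ⟨D, hD, h⟩ := this
    refine exists_adj D _ _ _ hD ?_
    refine Or.inr <| Or.inr <| Or.inr <| Or.inr <| Or.inr <| Or.inr <| Or.inr <| Or.inr <| Or.inr <| Or.inr <| Or.inr <| Or.inr <| Or.inl ?_
    simp only [Cd.num, pr_cast, Nat.cast_ofNat]
    exact ⟨_, (le_pr_left _ _).trans (le_pr_right _ _), _, (le_pr_right _ _).trans (le_pr_right _ _), rfl, h⟩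
  | ball c ihc =>
    rintro a b ⟨rfl, t, a', rfl, h⟩
    obtain ⟨D, hD, h⟩ := ball_coll (c.num : M) a' t (fun x hx => ihc (h x hx))
    refine exists_adj D _ _ _ hD ?_
    refine Or.inr <| Or.inr <| Or.inr <| Or.inr <| Or.inr <| Or.inr <| Or.inr <| Or.inr <| Or.inr <| Or.inr <| Or.inr <| Or.inr <| Or.inr ?_
    rw [show (Cd.ball c).num = pr 13 c.num from rfl, pr_cast]
    exact ⟨c.num, le_pr_right _ _, by simp, rfl, t, le_pr_left _ _, a', le_pr_right _ _, rfl, h⟩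

/-- the universal predicates -/
def W : ℕ → M → M → M → Prop
  | 0, D, c, a => W0 D c a
  | n+1, x, c, a => ¬ ∃ u, W n u c (pr x a)
def Sat (n : ℕ) (c a : M) : Prop := ∃ u, W n u c a

theorem sat_zero (c : Cd) (a : M) : Sat 0 (c.num : M) a ↔ c.den a 0 := by
  constructor
  · rintro ⟨D, hJ, h⟩; exact sound c hJ h
  · exact complete c

def tup : {k : ℕ} → (Fin k → M) → M
  | 0, _ => 0
  | k+1, v => pr (v (Fin.last k)) (tup (fun j => v j.castSucc))

theorem tup_snoc {k : ℕ} (v : Fin k → M) (x : M) : tup (Fin.snoc v x : Fin (k+1) → M) = pr x (tup v) := by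
  simp [tup]
end

section
variable {ι : Type*} {S : ι → Type} [∀ i, PAM (S i)]
theorem Pg.w (n : ℕ) : ∀ {k : ℕ} {f g h : ∀ i : ι, (Fin k → S i) → S i}, Tm f → Tm g → Tm h →
    Pg n (fun i v => W n (f i v) (g i v) (h i v)) := by
  induction n with
  | zero => intro k f g h hf hg hh; exact Pg.of_D0 (D0.w0 hf hg hh)
  | succ n ih =>
    intro k f g h hf hg hh
    refine Sg.not (P := fun i v => ∃ u, W n u (g i v) (pr (f i v) (h i v))) ?_
    exact Sg.ex (Pg.sg_succ (ih (Tm.var _) hg.lift (hf.lift.pr hh.lift)))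
theorem Sg.sat (n : ℕ) {k : ℕ} {g h : ∀ i : ι, (Fin k → S i) → S i} (hg : Tm g) (hh : Tm h) :
    Sg (n+1) (fun i v => Sat n (g i v) (h i v)) :=
  Sg.ex (Pg.sg_succ (Pg.w n (Tm.var _) hg.lift hh.lift))

def Cd.var : {k : ℕ} → Fin k → Cd
  | 0, j => j.elim0
  | k+1, j => Fin.lastCases (motive := fun _ => Cd) Cd.fst (fun j => Cd.comp (Cd.var j) Cd.snd) j

theorem var_den {M : Type} [PAM M] {k : ℕ} (j : Fin k) (v : Fin k → M) (b : M) :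
    (Cd.var j).den (tup v) b ↔ b = v j := by
  induction k with
  | zero => exact j.elim0
  | succ k ih =>
    refine Fin.lastCases ?_ (fun j => ?_) j
    · simp [Cd.var, Cd.den, tup]
      exact eq_comm
    · simp only [Cd.var, Fin.lastCases_castSucc, Cd.den, tup]
      constructor
      · rintro ⟨m, ⟨x, e⟩, h⟩
        obtain ⟨e1, e2⟩ := pr_inj e
        subst e2
        exact (ih j _).1 h
      · intro h
        exact ⟨_, ⟨_, rfl⟩, (ih j _).2 h⟩

theorem term_code {k : ℕ} (t : LA.Term (Empty ⊕ Fin k)) : ∃ c : Cd, ∀ (M : Type) [PAM M] (v : Fin k → M) (b : M),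
    c.den (tup v) b ↔ b = t.realize (Sum.elim default v) := by
  induction t with
  | var x =>
    rcases x with x | x
    · exact x.elim
    · exact ⟨Cd.var x, fun M _ v b => var_den x v b⟩
  | @func l f ts ih =>
    choose c hc using ih
    match l, f, ts, c, hc with
    | 0, _, ts, c, hc =>
      refine ⟨Cd.zero, fun M _ v b => ?_⟩
      show _ ↔ b = 0
      rfl
    | 1, _, ts, c, hc =>
      refine ⟨Cd.comp Cd.succ (c 0), fun M _ v b => ?_⟩
      show _ ↔ b = (ts 0).realize _ + 1
      simp only [Cd.den, hc]; simp
    | 2, false, ts, c, hc =>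
      refine ⟨Cd.comp Cd.add (Cd.pair (c 0) (c 1)), fun M _ v b => ?_⟩
      show _ ↔ b = (ts 0).realize _ + (ts 1).realize _
      simp only [Cd.den, hc]
      constructor
      · rintro ⟨m, ⟨x, y, rfl, rfl, rfl⟩, x', y', e, rfl⟩
        obtain ⟨rfl, rfl⟩ := pr_inj e; rfl
      · rintro rfl; exact ⟨_, ⟨_, _, rfl, rfl, rfl⟩, _, _, rfl, rfl⟩
    | 2, true, ts, c, hc =>
      refine ⟨Cd.comp Cd.mul (Cd.pair (c 0) (c 1)), fun M _ v b => ?_⟩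
      show _ ↔ b = (ts 0).realize _ * (ts 1).realize _
      simp only [Cd.den, hc]
      constructor
      · rintro ⟨m, ⟨x, y, rfl, rfl, rfl⟩, x', y', e, rfl⟩
        obtain ⟨rfl, rfl⟩ := pr_inj e; rfl
      · rintro rfl; exact ⟨_, ⟨_, _, rfl, rfl, rfl⟩, _, _, rfl, rfl⟩
    | (_ + 3), f, _, _, _ => exact nomatch f

/-- conjunction of codes -/
def Cd.con (c d : Cd) : Cd := .comp .zero (.pair c d)

/-- `c` decides positively the relation `P` -/
def Tst (c : Cd) {k : ℕ} (P : ∀ (M : Type) [PAM M], (Fin k → M) → Prop) : Prop :=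
  ∀ (M : Type) [PAM M] (v : Fin k → M) (b : M), c.den (tup v) b ↔ b = 0 ∧ P M v

theorem Tst.con {k : ℕ} {c d : Cd} {P Q : ∀ (M : Type) [PAM M], (Fin k → M) → Prop} (hc : Tst c P) (hd : Tst d Q) :
    Tst (c.con d) (fun M _ v => P M v ∧ Q M v) := by
  intro M _ v b
  simp only [Cd.con, Cd.den, hc M v, hd M v]
  constructor
  · rintro ⟨m, ⟨x, y, rfl, ⟨_, h1⟩, ⟨_, h2⟩⟩, rfl⟩; exact ⟨rfl, h1, h2⟩
  · rintro ⟨rfl, h1, h2⟩; exact ⟨_, ⟨_, _, rfl, ⟨rfl, h1⟩, ⟨rfl, h2⟩⟩, rfl⟩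

theorem Tst.dis {k : ℕ} {c d : Cd} {P Q : ∀ (M : Type) [PAM M], (Fin k → M) → Prop} (hc : Tst c P) (hd : Tst d Q) :
    Tst (c.union d) (fun M _ v => P M v ∨ Q M v) := by
  intro M _ v b
  simp only [Cd.den, hc M v, hd M v]
  tauto

theorem Tst.ex {k : ℕ} {c : Cd} {P : ∀ (M : Type) [PAM M], (Fin (k+1) → M) → Prop} (hc : Tst c P) :
    Tst (c.comp (.pair .any .idc)) (fun M _ v => ∃ x, P M (Fin.snoc v x)) := by
  intro M _ v b
  simp only [Cd.den]
  constructor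
  · rintro ⟨m, ⟨x, y, rfl, _, rfl⟩, h⟩
    rw [← tup_snoc, hc] at h
    exact ⟨h.1, x, h.2⟩
  · rintro ⟨rfl, x, h⟩
    refine ⟨_, ⟨x, _, rfl, trivial, rfl⟩, ?_⟩
    rw [← tup_snoc, hc]; exact ⟨rfl, h⟩

theorem Tst.ball {k : ℕ} {c t : Cd} {P : ∀ (M : Type) [PAM M], (Fin (k+1) → M) → Prop} (hc : Tst c P)
    {f : ∀ (M : Type) [PAM M], (Fin k → M) → M} (ht : ∀ (M : Type) [PAM M] (v : Fin k → M) (b : M), t.den (tup v) b ↔ b = f M v) :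
    Tst (Cd.comp (.ball c) (.pair t .idc)) (fun M _ v => ∀ x, x ≤ f M v → P M (Fin.snoc v x)) := by
  intro M _ v b
  simp only [Cd.den, ht]
  constructor
  · rintro ⟨m, ⟨x, y, rfl, rfl, rfl⟩, rfl, t, a, e, h⟩
    obtain ⟨e1, e2⟩ := pr_inj e
    subst e1 e2
    refine ⟨rfl, fun x hx => ?_⟩
    have := h x hx
    rw [← tup_snoc, hc] at this
    exact this.2
  · rintro ⟨rfl, h⟩
    refine ⟨_, ⟨_, _, rfl, rfl, rfl⟩, rfl, _, _, rfl, fun x hx => ?_⟩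
    rw [← tup_snoc, hc]; exact ⟨rfl, h x hx⟩

theorem Tst.cmp {k : ℕ} {c d : Cd} {f g : ∀ (M : Type) [PAM M], (Fin k → M) → M}
    (hc : ∀ (M : Type) [PAM M] (v : Fin k → M) (b : M), c.den (tup v) b ↔ b = f M v)
    (hd : ∀ (M : Type) [PAM M] (v : Fin k → M) (b : M), d.den (tup v) b ↔ b = g M v) :
    Tst (.comp .le (.pair c d)) (fun M _ v => f M v ≤ g M v) ∧
    Tst (.comp .lt (.pair c d)) (fun M _ v => f M v < g M v) := by
  constructor
  all_goals
    intro M _ v b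
    simp only [Cd.den, hc, hd]
    constructor
    · rintro ⟨m, ⟨x, y, rfl, rfl, rfl⟩, rfl, t, a, e, h⟩
      obtain ⟨e1, e2⟩ := pr_inj e
      subst e1 e2
      exact ⟨rfl, h⟩
    · rintro ⟨rfl, h⟩
      exact ⟨_, ⟨_, _, rfl, rfl, rfl⟩, rfl, _, _, rfl, h⟩

theorem Tst.of_iff {k : ℕ} {c : Cd} {P Q : ∀ (M : Type) [PAM M], (Fin k → M) → Prop} (hc : Tst c P)
    (h : ∀ (M : Type) [PAM M] (v : Fin k → M), Q M v ↔ P M v) : Tst c Q := by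
  intro M _ v b; rw [hc M v b, h M v]

theorem rel_castSucc {M : Type} [PAM M] {k : ℕ} (t : LA.Term (Empty ⊕ Fin k)) (v : Fin k → M) (x : M) :
    (t.relabel (Sum.map id Fin.castSucc)).realize (Sum.elim default (Fin.snoc v x : Fin (k+1) → M)) =
      t.realize (Sum.elim default v) := by
  rw [Term.realize_relabel]
  congr 1
  funext y
  rcases y with y | y
  · exact y.elim
  · simp

theorem rl_iff {M : Type} [PAM M] (x y : M) : rl x y ↔ x ≤ y := Iff.rfl

theorem delta_code {k : ℕ} {φ : LA.BoundedFormula Empty k} (h : IsDelta0 φ) :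
    (∃ c, Tst c (fun M _ v => φ.Realize default v)) ∧ (∃ c, Tst c (fun M _ v => ¬ φ.Realize default v)) := by
  induction h with
  | falsum =>
    refine ⟨⟨.comp .lt (.pair .zero .zero), ?_⟩, ⟨.zero, ?_⟩⟩
    · refine (Tst.cmp (f := fun M _ v => 0) (g := fun M _ v => 0) (fun M _ v b => Iff.rfl) (fun M _ v b => Iff.rfl)).2.of_iff ?_
      intro M _ v; simp
    · intro M _ v b; simp [Cd.den]
  | equal t u =>
    obtain ⟨c, hc⟩ := term_code t
    obtain ⟨d, hd⟩ := term_code u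
    have h1 := Tst.cmp hc hd
    have h2 := Tst.cmp hd hc
    refine ⟨⟨_, (h1.1.con h2.1).of_iff ?_⟩, ⟨_, (h1.2.dis h2.2).of_iff ?_⟩⟩
    · intro M _ v
      rw [BoundedFormula.realize_bdEqual]; exact ⟨fun e => ⟨e.le, e.ge⟩, fun e => le_antisymm e.1 e.2⟩
    · intro M _ v
      rw [BoundedFormula.realize_bdEqual]; exact ne_iff_lt_or_gt
  | le t u =>
    obtain ⟨c, hc⟩ := term_code t
    obtain ⟨d, hd⟩ := term_code u
    have h1 := Tst.cmp hc hd
    have h2 := Tst.cmp hd hc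
    refine ⟨⟨_, h1.1.of_iff ?_⟩, ⟨_, h2.2.of_iff ?_⟩⟩
    · intro M _ v; exact re_le _ _ _ _
    · intro M _ v; rw [re_le]; exact not_le
  | imp _ _ ih1 ih2 =>
    obtain ⟨⟨c1, hc1⟩, ⟨d1, hd1⟩⟩ := ih1
    obtain ⟨⟨c2, hc2⟩, ⟨d2, hd2⟩⟩ := ih2
    refine ⟨⟨_, (hd1.dis hc2).of_iff ?_⟩, ⟨_, (hc1.con hd2).of_iff ?_⟩⟩
    · intro M _ v; rw [BoundedFormula.realize_imp]; tauto
    · intro M _ v; rw [BoundedFormula.realize_imp]; tauto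
  | @ball m t φ _ ih =>
    obtain ⟨⟨c1, hc1⟩, ⟨d1, hd1⟩⟩ := ih
    obtain ⟨c, hc⟩ := term_code t
    obtain ⟨t', ht'⟩ := term_code (t.relabel (Sum.map id (Fin.castSucc (n := m))))
    have hx : ∀ (M : Type) [PAM M] (v : Fin (m+1) → M) (b : M), (Cd.var (Fin.last m)).den (tup v) b ↔ b = v (Fin.last m) :=
      fun M _ v b => var_den _ v b
    refine ⟨⟨_, (Tst.ball hc1 hc).of_iff ?_⟩, ⟨_, (Tst.ex ((Tst.cmp hx ht').1.con hd1)).of_iff ?_⟩⟩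
    · intro M _ v
      simp only [BoundedFormula.realize_all, BoundedFormula.realize_imp, re_le, re_v, Fin.snoc_last, rel_castSucc, rl_iff]
    · intro M _ v
      simp only [BoundedFormula.realize_all, BoundedFormula.realize_imp, re_le, re_v, Fin.snoc_last, rel_castSucc, rl_iff]
      push Not; rfl
  | @bex m t φ _ ih =>
    obtain ⟨⟨c1, hc1⟩, ⟨d1, hd1⟩⟩ := ih
    obtain ⟨c, hc⟩ := term_code t
    obtain ⟨t', ht'⟩ := term_code (t.relabel (Sum.map id (Fin.castSucc (n := m))))
    have hx : ∀ (M : Type) [PAM M] (v : Fin (m+1) → M) (b : M), (Cd.var (Fin.last m)).den (tup v) b ↔ b = v (Fin.last m) :=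
      fun M _ v b => var_den _ v b
    refine ⟨⟨_, (Tst.ex ((Tst.cmp hx ht').1.con hc1)).of_iff ?_⟩, ⟨_, (Tst.ball hd1 hc).of_iff ?_⟩⟩
    · intro M _ v
      simp only [BoundedFormula.realize_ex, BoundedFormula.realize_inf, re_le, re_v, Fin.snoc_last, rel_castSucc, rl_iff]
    · intro M _ v
      simp only [BoundedFormula.realize_ex, BoundedFormula.realize_inf, re_le, re_v, Fin.snoc_last, rel_castSucc, rl_iff]
      push Not; rfl

theorem univ (m : ℕ) : ∀ {k : ℕ} {R : ∀ i : Mdl, (Fin k → i.C) → Prop}, Sg (m+1) R →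
    ∃ c : ℕ, ∀ (i : Mdl) v, R i v ↔ Sat m (c : i.C) (tup v) := by
  induction m with
  | zero =>
    rintro k R ⟨Q, ⟨φ, hφ, hQ⟩, hR⟩
    obtain ⟨-, c, hc⟩ := delta_code hφ
    refine ⟨(c.comp (.pair .any .idc)).num, fun i v => ?_⟩
    rw [hR, sat_zero, hc.ex]
    simp only [true_and]
    exact exists_congr fun x => not_congr (hQ i _).symm
  | succ m ih =>
    rintro k R ⟨Q, hQ, hR⟩
    obtain ⟨c, hc⟩ := ih hQ
    refine ⟨c, fun i v => ?_⟩
    rw [hR]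
    refine exists_congr fun x => ?_
    rw [hc, tup_snoc]; rfl
end
end

section

/-- r.e. relations on the naturals -/
abbrev NT {k : ℕ} (f : (Fin k → ℕ) → ℕ) : Prop := Tm (ι := Unit) (S := fun _ => ℕ) (fun _ v => f v)
abbrev NS {k : ℕ} (P : (Fin k → ℕ) → Prop) : Prop := Sg (ι := Unit) (S := fun _ => ℕ) 1 (fun _ v => P v)
abbrev N0 {k : ℕ} (P : (Fin k → ℕ) → Prop) : Prop := D0 (ι := Unit) (S := fun _ => ℕ) (fun _ v => P v)

theorem n0_pair {k : ℕ} {f g h : (Fin k → ℕ) → ℕ} (hf : NT f) (hg : NT g) (hh : NT h) :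
    N0 (fun v => Nat.pair (f v) (g v) = h v) := by
  have : D0 (ι := Unit) (S := fun _ => ℕ) (fun _ v => (f v < g v ∧ h v = g v * g v + f v) ∨
      (g v ≤ f v ∧ h v = f v * f v + f v + g v)) :=
    ((D0.lt hf hg).and (D0.eq hh ((hg.mul hg).add hf))).or
      ((D0.le hg hf).and (D0.eq hh (((hf.mul hf).add hf).add hg)))
  refine this.of_iff ?_
  intro _ v
  show Nat.pair (f v) (g v) = h v ↔ _
  unfold Nat.pair
  split <;> rename_i h' <;> constructor <;> intro h1
  · exact Or.inl ⟨h', h1.symm⟩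
  · rcases h1 with h1 | h1
    · exact h1.2.symm
    · exact absurd h' (not_lt.2 h1.1)
  · exact Or.inr ⟨not_lt.1 h', h1.symm⟩
  · rcases h1 with h1 | h1
    · exact absurd h1.1 h'
    · exact h1.2.symm

def Gr (f : ℕ →. ℕ) : Prop := NS (k := 2) (fun v => v 1 ∈ f (v 0))

theorem Gr.comp {f : ℕ →. ℕ} (h : Gr f) {k : ℕ} {s t : (Fin k → ℕ) → ℕ} (hs : NT s) (ht : NT t) :
    NS (fun v => t v ∈ f (s v)) := by
  have := Sg.comp (ι := Unit) (S := fun _ => ℕ) h (s := fun j _ v => ![s v, t v] j) (fun j => by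
    fin_cases j
    · exact hs
    · exact ht)
  exact this

def precf (f g : ℕ →. ℕ) (a n : ℕ) : Part ℕ :=
  (Nat.rec (f a) (fun y IH => IH >>= fun i => g (Nat.pair a (Nat.pair y i))) n : Part ℕ)

theorem prec_mem {f g : ℕ →. ℕ} (hf : Gr f) (hg : Gr g) (a n x : ℕ) :
    (x ∈ precf f g a n) ↔
    ∃ D, Mem (pr n x) D ∧ ∀ t, t ≤ D → Mem t D → ∃ j, j ≤ t ∧ ∃ z, z ≤ t ∧ (t = pr j z ∧
      ((j = 0 ∧ z ∈ f a) ∨ ∃ i, i ≤ j ∧ (j = i + 1 ∧ ∃ y, y ≤ D ∧ (Mem (pr i y) D ∧ ∃ q r, Nat.pair i y = q ∧ Nat.pair a q = r ∧ z ∈ g r)))) := by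
  constructor
  · induction n generalizing x with
    | zero =>
      intro h
      obtain ⟨D, hD⟩ := exists_set (M := ℕ) (k := 1) ![pr 0 x] (fun w t => t = w 0) (Df.eq (Tm.var _) (Tm.var _)) (pr 0 x)
      refine ⟨D, (hD _).2 ⟨le_rfl, rfl⟩, fun t _ ht => ?_⟩
      have : t = pr 0 x := ((hD t).1 ht).2
      exact ⟨0, Nat.zero_le _, x, this ▸ le_pr_right _ _, this, Or.inl ⟨rfl, h⟩⟩
    | succ n ih =>
      intro h
      obtain ⟨y, hy, hx⟩ := Part.mem_bind_iff.1 h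
      obtain ⟨D, h1, h2⟩ := ih y hy
      obtain ⟨D', hD⟩ := exists_set (M := ℕ) (k := 2) ![D, pr (n+1) x] (fun w t => Mem t (w 0) ∨ t = w 1)
        (Df.or (D0.mem (Tm.var _) (Tm.var _)).df (Df.eq (Tm.var _) (Tm.var _))) (D + pr (n+1) x)
      have hD : ∀ t, Mem t D' ↔ Mem t D ∨ t = pr (n+1) x := by
        intro t
        rw [hD]
        refine ⟨fun h => h.2, fun h => ⟨?_, h⟩⟩
        rcases h with h | h
        · exact h.le.trans le_self_add
        · rw [h]; exact le_add_self
      refine ⟨D', (hD _).2 (Or.inr rfl), fun t _ ht => ?_⟩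
      rcases (hD t).1 ht with ht | ht
      · obtain ⟨j, hj, z, hz, e, h3⟩ := h2 t ht.le ht
        refine ⟨j, hj, z, hz, e, h3.imp id ?_⟩
        rintro ⟨i, hi, e, y, _, hm, h4⟩
        have := (hD _).2 (Or.inl hm)
        exact ⟨i, hi, e, y, (le_pr_right _ _).trans this.le, this, h4⟩
      · have := (hD _).2 (Or.inl h1)
        exact ⟨n+1, ht ▸ le_pr_left _ _, x, ht ▸ le_pr_right _ _, ht, Or.inr ⟨n, Nat.le_succ _, rfl, y, (le_pr_right _ _).trans this.le, this, _, _, rfl, rfl, hx⟩⟩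
  · rintro ⟨D, h1, h2⟩
    induction n generalizing x with
    | zero =>
      obtain ⟨j, hj, z, hz, e, h3⟩ := h2 _ h1.le h1
      obtain ⟨e1, e2⟩ := pr_inj e
      subst e1 e2
      rcases h3 with h3 | ⟨i, _, e, _⟩
      · exact h3.2
      · exact absurd e (Nat.succ_ne_zero i).symm
    | succ n ih =>
      obtain ⟨j, hj, z, hz, e, h3⟩ := h2 _ h1.le h1
      obtain ⟨e1, e2⟩ := pr_inj e
      subst e1 e2
      rcases h3 with h3 | ⟨i, _, e, y, _, hm, q, r, rfl, rfl, h4⟩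
      · exact absurd h3.1 (Nat.succ_ne_zero n)
      · have : i = n := (Nat.succ.inj e).symm
        subst this
        exact Part.mem_bind (ih y hm) h4

theorem gr_of_partrec {f : ℕ →. ℕ} (hf : Nat.Partrec f) : Gr f := by
  induction hf with
  | zero =>
    refine (Sg.of_D0 (ι := Unit) (S := fun _ => ℕ) (D0.eq (Tm.var (1 : Fin 2)) Tm.zero)).of_iff ?_
    intro _ v
    exact Part.mem_some_iff
  | succ =>
    refine (Sg.of_D0 (ι := Unit) (S := fun _ => ℕ) (D0.eq (Tm.var (1 : Fin 2)) ((Tm.var 0).add Tm.one))).of_iff ?_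
    intro _ v
    exact Part.mem_some_iff
  | left =>
    refine (Sg.ex (ι := Unit) (S := fun _ => ℕ) (n := 0) (k := 2) (R := fun _ v x => Nat.pair (v 1) x = v 0)
      (Sg.of_D0 (n0_pair (Tm.var _) (Tm.var _) (Tm.var _)))).of_iff ?_
    intro _ v
    refine Part.mem_some_iff.trans ?_
    constructor
    · intro h; exact ⟨(v 0).unpair.2, by rw [h]; exact Nat.pair_unpair _⟩
    · rintro ⟨x, h⟩; rw [← h]; simp
  | right =>
    refine (Sg.ex (ι := Unit) (S := fun _ => ℕ) (n := 0) (k := 2) (R := fun _ v x => Nat.pair x (v 1) = v 0)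
      (Sg.of_D0 (n0_pair (Tm.var _) (Tm.var _) (Tm.var _)))).of_iff ?_
    intro _ v
    refine Part.mem_some_iff.trans ?_
    constructor
    · intro h; exact ⟨(v 0).unpair.1, by rw [h]; exact Nat.pair_unpair _⟩
    · rintro ⟨x, h⟩; rw [← h]; simp
  | @pair f g _ _ ihf ihg =>
    refine (Sg.ex (ι := Unit) (S := fun _ => ℕ) (n := 0) (k := 2) (R := fun _ v x => ∃ y, x ∈ f (v 0) ∧ y ∈ g (v 0) ∧ Nat.pair x y = v 1)
      (Sg.ex (ι := Unit) (S := fun _ => ℕ) (n := 0) (k := 3) (R := fun _ v y => v 2 ∈ f (v 0) ∧ y ∈ g (v 0) ∧ Nat.pair (v 2) y = v 1)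
      ((ihf.comp (Tm.var _) (Tm.var _)).and ((ihg.comp (Tm.var _) (Tm.var _)).and (Sg.of_D0 (n0_pair (Tm.var _) (Tm.var _) (Tm.var _))))))).of_iff ?_
    intro _ v
    simp [Seq.seq]
  | @comp f g _ _ ihf ihg =>
    refine (Sg.ex (ι := Unit) (S := fun _ => ℕ) (n := 0) (k := 2) (R := fun _ v x => x ∈ g (v 0) ∧ v 1 ∈ f x)
      ((ihg.comp (Tm.var _) (Tm.var _)).and (ihf.comp (Tm.var _) (Tm.var _)))).of_iff ?_
    intro _ v
    exact Part.mem_bind_iff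
  | @prec f g _ _ ihf ihg =>
    have key : NS (k := 3) (fun v => ∃ D, Mem (pr (v 1) (v 2)) D ∧ ∀ t, t ≤ D → Mem t D → ∃ j, j ≤ t ∧ ∃ z, z ≤ t ∧ (t = pr j z ∧
      ((j = 0 ∧ z ∈ f (v 0)) ∨ ∃ i, i ≤ j ∧ (j = i + 1 ∧ ∃ y, y ≤ D ∧ (Mem (pr i y) D ∧ ∃ q r, Nat.pair i y = q ∧ Nat.pair (v 0) q = r ∧ z ∈ g r))))) := by
      refine Sg.ex (Sg.and (Sg.of_D0 (D0.mem (Tm.pr (Tm.var _) (Tm.var _)) (Tm.var _))) ?_)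
      refine Sg.ball (Tm.var _) (Sg.imp (Pg.of_D0 (D0.mem (Tm.var _) (Tm.var _))) ?_)
      refine Sg.bex (Tm.var _) (Sg.bex (Tm.var _) (Sg.and (Sg.of_D0 (D0.eq (Tm.var _) (Tm.pr (Tm.var _) (Tm.var _)))) (Sg.or ?_ ?_)))
      · exact Sg.and (Sg.of_D0 (D0.eq (Tm.var _) Tm.zero)) (ihf.comp (Tm.var _) (Tm.var _))
      · refine Sg.bex (Tm.var _) (Sg.and (Sg.of_D0 (D0.eq (Tm.var _) (Tm.add (Tm.var _) Tm.one))) ?_)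
        refine Sg.bex (Tm.var _) (Sg.and (Sg.of_D0 (D0.mem (Tm.pr (Tm.var _) (Tm.var _)) (Tm.var _))) ?_)
        refine Sg.ex (Sg.ex ?_)
        exact (Sg.of_D0 (n0_pair (Tm.var _) (Tm.var _) (Tm.var _))).and ((Sg.of_D0 (n0_pair (Tm.var _) (Tm.var _) (Tm.var _))).and (ihg.comp (Tm.var _) (Tm.var _)))
    have key2 : NS (k := 3) (fun v => (v 2 ∈ precf f g (v 0) (v 1))) :=
      key.of_iff (fun _ v => prec_mem ihf ihg _ _ _)
    refine (Sg.ex (ι := Unit) (S := fun _ => ℕ) (n := 0) (k := 2) (R := fun _ v a => ∃ n, Nat.pair a n = v 0 ∧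
        (v 1 ∈ precf f g a n))
      (Sg.ex (ι := Unit) (S := fun _ => ℕ) (n := 0) (k := 3) (R := fun _ v n => Nat.pair (v 2) n = v 0 ∧
        (v 1 ∈ precf f g (v 2) n))
      ((Sg.of_D0 (n0_pair (Tm.var _) (Tm.var _) (Tm.var _))).and ?_))).of_iff ?_
    · have := Sg.comp (ι := Unit) (S := fun _ => ℕ) key2 (m := 4) (s := fun j _ v => ![v 2, v 3, v 1] j) (fun j => by
        fin_cases j
        · exact Tm.var _
        · exact Tm.var _
        · exact Tm.var _)
      exact this
    · intro _ v
      show v 1 ∈ precf f g (v 0).unpair.1 (v 0).unpair.2 ↔ _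
      constructor
      · intro h; exact ⟨_, _, Nat.pair_unpair _, h⟩
      · rintro ⟨a, n, e, h⟩
        rw [← e, Nat.unpair_pair]; exact h
  | @rfind f _ ihf =>
    have key : NS (k := 2) (fun v => (∃ q, Nat.pair (v 0) (v 1) = q ∧ 0 ∈ f q) ∧ ∀ m, m ≤ v 1 → m < v 1 →
        ∃ q, ∃ z, Nat.pair (v 0) m = q ∧ z + 1 ∈ f q) := by
      refine Sg.and (Sg.ex ((Sg.of_D0 (n0_pair (Tm.var _) (Tm.var _) (Tm.var _))).and (ihf.comp (Tm.var _) Tm.zero))) ?_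
      refine Sg.ball (Tm.var _) (Sg.imp (Pg.of_D0 (D0.lt (Tm.var _) (Tm.var _))) ?_)
      exact Sg.ex (Sg.ex ((Sg.of_D0 (n0_pair (Tm.var _) (Tm.var _) (Tm.var _))).and (ihf.comp (Tm.var _) ((Tm.var _).add Tm.one))))
    refine key.of_iff ?_
    intro _ v
    refine Nat.mem_rfind.trans ?_
    constructor
    · rintro ⟨h1, h2⟩
      refine ⟨⟨_, rfl, ?_⟩, fun m _ hm => ⟨Nat.pair (v 0) m, ?_⟩⟩
      · simpa using h1
      · have := h2 hm
        simp at this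
        obtain ⟨z, hz, h⟩ := this
        obtain ⟨z, rfl⟩ := Nat.exists_eq_succ_of_ne_zero h
        exact ⟨z, rfl, hz⟩
    · rintro ⟨⟨q, rfl, h1⟩, h2⟩
      refine ⟨by simpa using h1, fun {m} hm => ?_⟩
      obtain ⟨q, z, rfl, h⟩ := h2 m hm.le hm
      simp
      exact ⟨_, h, by simp⟩

/-- graphs of computable functions on naturals -/
theorem ns_comp1 {f : ℕ → ℕ} (hf : Computable f) {k : ℕ} {s t : (Fin k → ℕ) → ℕ} (hs : NT s) (ht : NT t) :
    NS (fun v => f (s v) = t v) := by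
  have h1 : Gr (f : ℕ →. ℕ) := gr_of_partrec (Partrec.nat_iff.1 hf)
  refine (h1.comp hs ht).of_iff ?_
  intro _ v
  exact eq_comm.trans (Part.mem_some_iff (a := f (s v)) (b := t v)).symm

theorem ns_comp2 {f : ℕ → ℕ → ℕ} (hf : Computable₂ f) {k : ℕ} {r s t : (Fin k → ℕ) → ℕ} (hr : NT r) (hs : NT s) (ht : NT t) :
    NS (fun v => f (r v) (s v) = t v) := by
  have h1 : Computable (fun n : ℕ => f n.unpair.1 n.unpair.2) :=
    hf.comp (Computable.fst.comp Computable.unpair) (Computable.snd.comp Computable.unpair)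
  have : NS (fun v => ∃ q, Nat.pair (r v) (s v) = q ∧ f q.unpair.1 q.unpair.2 = t v) :=
    Sg.ex ((Sg.of_D0 (n0_pair hr.lift hs.lift (Tm.var _))).and (ns_comp1 h1 (Tm.var _) ht.lift))
  refine this.of_iff ?_
  intro _ v
  simp
end

section

/-! ### Token lists of terms and formulas -/

def tokT {n : ℕ} (t : LA.Term (Empty ⊕ Fin n)) : List ℕ := t.listEncode.map Encodable.encode

def tok {n : ℕ} (φ : LA.BoundedFormula Empty n) : List ℕ := φ.listEncode.map Encodable.encode

theorem encode_map {α : Type*} [Encodable α] (l : List α) :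
    Encodable.encode (l.map Encodable.encode) = Encodable.encode l := by
  induction l with
  | nil => rfl
  | cons a l ih => simp [ih]

theorem encode_term {n : ℕ} (t : LA.Term (Empty ⊕ Fin n)) :
    Encodable.encode t = Encodable.encode (tokT t) := (encode_map t.listEncode).symm

theorem gnum_tok (φ : Snt) : gnum φ = Encodable.encode (tok φ) := by
  unfold gnum tok
  rw [encode_map]
  rfl

theorem tokT_inj {n : ℕ} {s t : LA.Term (Empty ⊕ Fin n)} (h : tokT s = tokT t) : s = t :=
  Term.listEncode_injective (List.map_injective_iff.2 Encodable.encode_injective h)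

theorem tok_inj {n m : ℕ} {φ : LA.BoundedFormula Empty n} {ψ : LA.BoundedFormula Empty m} (h : tok φ = tok ψ) :
    (⟨n, φ⟩ : Σ n, LA.BoundedFormula Empty n) = ⟨m, ψ⟩ := by
  refine BoundedFormula.encoding.encode_injective ?_
  exact List.map_injective_iff.2 Encodable.encode_injective h

def xFal (n : ℕ) : List ℕ := [4 * n + 11]
def xEq (n : ℕ) (c d : List ℕ) : List ℕ := [2 * Nat.pair n (Encodable.encode c), 2 * Nat.pair n (Encodable.encode d)]
def xLe (n : ℕ) (c d : List ℕ) : List ℕ := 25 :: (4 * n + 3) :: xEq n c d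

theorem tok_falsum (n : ℕ) : tok (⊥ : LA.BoundedFormula Empty n) = xFal n := by
  show [2 * (2 * (n+2) + 1) + 1] = _
  unfold xFal
  congr 1; ring
theorem tok_eq {n : ℕ} (s t : LA.Term (Empty ⊕ Fin n)) : tok (BoundedFormula.equal s t) = xEq n (tokT s) (tokT t) := by
  show [2 * Nat.pair n (Encodable.encode s), 2 * Nat.pair n (Encodable.encode t)] = _
  rw [encode_term, encode_term]; rfl
theorem tok_le {n : ℕ} (s t : LA.Term (Empty ⊕ Fin n)) : tok (leF s t) = xLe n (tokT s) (tokT t) := by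
  show [25, 2 * (2 * n + 1) + 1, 2 * Nat.pair n (Encodable.encode s), 2 * Nat.pair n (Encodable.encode t)] = _
  rw [encode_term, encode_term]
  unfold xLe xEq
  congr 1
  congr 1; ring
theorem tok_imp {n : ℕ} (φ ψ : LA.BoundedFormula Empty n) : tok (φ.imp ψ) = 3 :: (tok φ ++ tok ψ) := by
  simp [tok, BoundedFormula.listEncode]
theorem tok_all {n : ℕ} (φ : LA.BoundedFormula Empty (n+1)) : tok (φ.all) = 7 :: tok φ := by
  simp [tok, BoundedFormula.listEncode]

theorem tokT_var {n : ℕ} (j : Fin n) : tokT (Term.var (Sum.inr j) : LA.Term (Empty ⊕ Fin n)) = [2 * (2 * (j : ℕ) + 1)] := rfl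
theorem tokT_zero {n : ℕ} : tokT (zeroT : LA.Term (Empty ⊕ Fin n)) = [1] := rfl
theorem tokT_succ {n : ℕ} (t : LA.Term (Empty ⊕ Fin n)) : tokT (succT t) = 5 :: tokT t := by
  show 5 :: (t.listEncode ++ []).map Encodable.encode = _
  rw [List.append_nil]; rfl
theorem tokT_add {n : ℕ} (s t : LA.Term (Empty ⊕ Fin n)) : tokT (addT s t) = 13 :: (tokT s ++ tokT t) := by
  show 13 :: (s.listEncode ++ (t.listEncode ++ [])).map Encodable.encode = _
  rw [List.append_nil, List.map_append]; rfl
theorem tokT_mul {n : ℕ} (s t : LA.Term (Empty ⊕ Fin n)) : tokT (mulT s t) = 15 :: (tokT s ++ tokT t) := by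
  show 15 :: (s.listEncode ++ (t.listEncode ++ [])).map Encodable.encode = _
  rw [List.append_nil, List.map_append]; rfl

theorem term_cases {n : ℕ} {P : LA.Term (Empty ⊕ Fin n) → Prop}
    (hv : ∀ j, P (Term.var (Sum.inr j))) (hz : P zeroT) (hs : ∀ t, P t → P (succT t))
    (ha : ∀ s t, P s → P t → P (addT s t)) (hm : ∀ s t, P s → P t → P (mulT s t)) (t) : P t := by
  induction t with
  | var i => rcases i with i | i
             · exact i.elim
             · exact hv i
  | @func l f ts ih =>
    match l, f, ts, ih with
    | 0, f, ts, ih =>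
      have : Term.func f ts = (zeroT : LA.Term (Empty ⊕ Fin n)) := by
        unfold zeroT Constants.term
        congr 1; exact Subsingleton.elim _ _
      exact this ▸ hz
    | 1, f, ts, ih =>
      have : Term.func f ts = succT (ts 0) := by
        unfold succT Functions.apply₁
        congr 1; funext i; rw [Subsingleton.elim i 0]; rfl
      exact this ▸ hs _ (ih 0)
    | 2, false, ts, ih =>
      have : Term.func (show LA.Functions 2 from false) ts = addT (ts 0) (ts 1) := by
        unfold addT Functions.apply₂
        congr 1; funext i; fin_cases i <;> rfl
      exact this ▸ ha _ _ (ih 0) (ih 1)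
    | 2, true, ts, ih =>
      have : Term.func (show LA.Functions 2 from true) ts = mulT (ts 0) (ts 1) := by
        unfold mulT Functions.apply₂
        congr 1; funext i; fin_cases i <;> rfl
      exact this ▸ hm _ _ (ih 0) (ih 1)

theorem fml_cases {P : ∀ {n : ℕ}, LA.BoundedFormula Empty n → Prop}
    (hf : ∀ n, P (⊥ : LA.BoundedFormula Empty n))
    (he : ∀ n (s t : LA.Term (Empty ⊕ Fin n)), P (BoundedFormula.equal s t))
    (hl : ∀ n (s t : LA.Term (Empty ⊕ Fin n)), P (leF s t))
    (hi : ∀ n (φ ψ : LA.BoundedFormula Empty n), P φ → P ψ → P (φ.imp ψ))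
    (ha : ∀ n (φ : LA.BoundedFormula Empty (n+1)), P φ → P φ.all) {n : ℕ} (φ : LA.BoundedFormula Empty n) : P φ := by
  induction φ with
  | falsum => exact hf _
  | equal s t => exact he _ s t
  | @rel n l R ts =>
    match l, R, ts with
    | 2, R, ts =>
      have : BoundedFormula.rel R ts = leF (ts 0) (ts 1) := by
        unfold leF Relations.boundedFormula₂
        show _ = BoundedFormula.rel _ _
        congr 1; funext i; fin_cases i <;> rfl
      exact this ▸ hl _ _ _
  | imp φ ψ h1 h2 => exact hi _ _ _ h1 h2
  | all φ h => exact ha _ _ h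
end

section

/-! ### Propositional clauses -/

abbrev Vt := ℕ × ℕ × List ℕ × List ℕ × ℕ × ℕ
abbrev Cls := List Vt × List Vt
abbrev Prm := ℕ × List ℕ × List ℕ × List ℕ × ℕ × ℕ × ℕ × ℕ

def ClSat (v : Vt → Prop) (cl : Cls) : Prop := (∀ a ∈ cl.1, v a) → ∃ b ∈ cl.2, v b

def tb (s a : ℕ) : Prop := s / 2 ^ a % 2 = 1

theorem tb_iff (s a : ℕ) : tb s a ↔ s.testBit a = true := by
  unfold tb; rw [Nat.testBit_eq_decide_div_mod_eq]; simp

def Fz (q : ℕ × ℕ) (cl : Cls) : Prop :=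
  (∀ a ∈ cl.1, Encodable.encode a < q.2 ∧ tb q.1 (Encodable.encode a)) ∧
  (∀ b ∈ cl.2, Encodable.encode b < q.2 ∧ ¬ tb q.1 (Encodable.encode b))

theorem prop_compact (C : Cls → Prop) :
    (¬ ∃ v : Vt → Prop, ∀ cl, C cl → ClSat v cl) ↔ ∃ N, ∀ s, s ≤ 2 ^ N → ∃ cl, C cl ∧ Fz (s, N) cl := by
  classical
  constructor
  · intro h
    by_contra hN
    push Not at hN
    choose s _ hs using hN
    let F := Filter.hyperfilter ℕ
    refine h ⟨fun a => ∀ᶠ N in F, tb (s N) (Encodable.encode a), fun cl hC => ?_⟩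
    intro hp
    by_contra hq
    push Not at hq
    have hlt : ∀ a : Vt, ∀ᶠ N in (F : Filter ℕ), Encodable.encode a < N := by
      intro a
      have := Filter.eventually_gt_atTop (Encodable.encode a)
      exact Filter.hyperfilter_le_cofinite (Nat.cofinite_eq_atTop ▸ this)
    have h1 : ∀ᶠ N in (F : Filter ℕ), ∀ a ∈ cl.1, Encodable.encode a < N ∧ tb (s N) (Encodable.encode a) := by
      have := (Filter.eventually_all_finset (l := (F : Filter ℕ)) cl.1.toFinset
        (p := fun a N => Encodable.encode a < N ∧ tb (s N) (Encodable.encode a))).2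
        (fun a ha => (hlt a).and (hp a (List.mem_toFinset.1 ha)))
      filter_upwards [this] with N h a ha
      exact h a (List.mem_toFinset.2 ha)
    have h2 : ∀ᶠ N in (F : Filter ℕ), ∀ a ∈ cl.2, Encodable.encode a < N ∧ ¬ tb (s N) (Encodable.encode a) := by
      have := (Filter.eventually_all_finset (l := (F : Filter ℕ)) cl.2.toFinset
        (p := fun a N => Encodable.encode a < N ∧ ¬ tb (s N) (Encodable.encode a))).2
        (fun a ha => (hlt a).and (hq a (List.mem_toFinset.1 ha)))
      filter_upwards [this] with N h a ha
      exact h a (List.mem_toFinset.2 ha)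
    obtain ⟨N, hN1, hN2⟩ := (h1.and h2).exists
    exact hs N cl hC ⟨hN1, hN2⟩
  · rintro ⟨N, h⟩ ⟨v, hv⟩
    let f : Fin N → Bool := fun i => decide (∃ a : Vt, Encodable.encode a = (i : ℕ) ∧ v a)
    obtain ⟨cl, hC, h1, h2⟩ := h (Nat.ofBits f) (Nat.ofBits_lt_two_pow f).le
    have key : ∀ a : Vt, Encodable.encode a < N → (tb (Nat.ofBits f) (Encodable.encode a) ↔ v a) := by
      intro a ha
      rw [tb_iff, Nat.testBit_ofBits_lt f _ ha]
      simp only [f, decide_eq_true_eq]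
      constructor
      · rintro ⟨b, hb, hv⟩
        exact Encodable.encode_injective hb ▸ hv
      · intro h; exact ⟨a, rfl, h⟩
    obtain ⟨b, hb, hvb⟩ := hv cl hC (fun a ha => (key a (h1 a ha).1).1 (h1 a ha).2)
    exact (h2 b hb).2 ((key b (h2 b hb).1).2 hvb)

theorem prim_pow : Primrec (fun n : ℕ => 2 ^ n) := by
  have : Primrec (fun n : ℕ => (fun x => 2 * x)^[n] 1) :=
    Primrec.nat_iterate Primrec.id (Primrec.const 1) (Primrec.nat_mul.comp (Primrec.const 2) Primrec.snd).to₂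
  refine this.of_eq fun n => ?_
  induction n with
  | zero => rfl
  | succ n ih => rw [Function.iterate_succ_apply', ih]; ring

theorem prim_tb : PrimrecRel tb := by
  refine Primrec.eq.comp (Primrec.nat_mod.comp (Primrec.nat_div.comp Primrec.fst (prim_pow.comp Primrec.snd)) (Primrec.const 2)) (Primrec.const 1)

theorem prim_Fz : PrimrecRel Fz := by
  have e1 : PrimrecRel (fun (a : Vt) (q : ℕ × ℕ) => Encodable.encode a < q.2 ∧ tb q.1 (Encodable.encode a)) :=
    (Primrec.nat_lt.comp (Primrec.encode.comp Primrec.fst) (Primrec.snd.comp Primrec.snd)).and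
     (prim_tb.comp (Primrec.fst.comp Primrec.snd) (Primrec.encode.comp Primrec.fst))
  have e2 : PrimrecRel (fun (a : Vt) (q : ℕ × ℕ) => Encodable.encode a < q.2 ∧ ¬ tb q.1 (Encodable.encode a)) :=
    (Primrec.nat_lt.comp (Primrec.encode.comp Primrec.fst) (Primrec.snd.comp Primrec.snd)).and
     (prim_tb.comp (Primrec.fst.comp Primrec.snd) (Primrec.encode.comp Primrec.fst)).not
  exact (e1.forall_mem_list.comp (Primrec.fst.comp Primrec.snd) Primrec.fst).and
    (e2.forall_mem_list.comp (Primrec.snd.comp Primrec.snd) Primrec.fst)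

theorem ns_pred {p : ℕ → Prop} (hp : ComputablePred p) {k : ℕ} {s : (Fin k → ℕ) → ℕ} (hs : NT s) :
    NS (fun v => p (s v)) := by
  obtain ⟨_, h⟩ := hp
  refine (ns_comp1 (f := fun a => Encodable.encode (decide (p a))) (Computable.encode.comp h) hs (Tm.one)).of_iff ?_
  intro _ v
  show _ ↔ Encodable.encode (decide (p (s v))) = 1
  by_cases h : p (s v) <;> simp [h]

theorem ns_prel {p : ℕ → ℕ → Prop} (hp : PrimrecRel p) {k : ℕ} {s t : (Fin k → ℕ) → ℕ} (hs : NT s) (ht : NT t) :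
    NS (fun v => p (s v) (t v)) := by
  classical
  have h := hp.decide
  refine (ns_comp2 (f := fun a b => Encodable.encode (decide (p a b))) (Primrec.encode.comp h).to_comp hs ht (Tm.one)).of_iff ?_
  intro _ v
  show _ ↔ Encodable.encode (decide (p (s v) (t v))) = 1
  by_cases h : p (s v) (t v) <;> simp [h]

/-! ### The clauses -/

def vTr (c e : List ℕ) : Vt := (0, 0, c, e, 0, 0)
def vF (n : ℕ) (c : List ℕ) : Vt := (1, n, c, [], 0, 0)
def vE (n : ℕ) (c e : List ℕ) (x : ℕ) : Vt := (2, n, c, e, x, 0)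
def vQ (x y : ℕ) : Vt := (3, 0, [], [], x, y)
def vL (x y : ℕ) : Vt := (4, 0, [], [], x, y)
def fn (i x y : ℕ) : ℕ := Nat.pair i (Nat.pair x y) + 1
def wit (c e : List ℕ) : ℕ := fn 3 (Encodable.encode c) (Encodable.encode e)
def num (k : ℕ) : ℕ := (fun x => fn 0 x 0)^[k] 0

def sch1 (n : ℕ) (c d e : List ℕ) (x y : ℕ) : List Cls :=
  [([], [vF n (xFal n)]),
   ([vF n c, vF n d], [vF n (3 :: (c ++ d))]),
   ([vF (n + 1) c], [vF n (7 :: c)]),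
   ([vE n c e x, vE n d e y], [vF n (xEq n c d)]),
   ([vE n c e x, vE n d e y], [vF n (xLe n c d)]),
   ([vTr (xFal n) e], []),
   ([vF n c, vF n d, vTr (3 :: (c ++ d)) e, vTr c e], [vTr d e]),
   ([vF n c, vF n d], [vTr c e, vTr (3 :: (c ++ d)) e]),
   ([vF n c, vF n d, vTr d e], [vTr (3 :: (c ++ d)) e]),
   ([vF (n + 1) c, vTr (7 :: c) e], [vTr c (x :: e)]),
   ([vF (n + 1) c, vTr c (wit c e :: e)], [vTr (7 :: c) e])]

def sch2 (n : ℕ) (c d e : List ℕ) (x y : ℕ) : List Cls :=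
  [([], [vE (x + y + 1) [2 * (2 * x + 1)] e (e.getD y 0)]),
   ([], [vE n [1] e 0]),
   ([vE n c e x], [vE n (5 :: c) e (fn 0 x 0)]),
   ([vE n c e x, vE n d e y], [vE n (13 :: (c ++ d)) e (fn 1 x y)]),
   ([vE n c e x, vE n d e y], [vE n (15 :: (c ++ d)) e (fn 2 x y)]),
   ([vE n c e x, vE n d e y, vTr (xEq n c d) e], [vQ x y]),
   ([vE n c e x, vE n d e y, vQ x y], [vTr (xEq n c d) e]),
   ([vE n c e x, vE n d e y, vTr (xLe n c d) e], [vL x y]),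
   ([vE n c e x, vE n d e y, vL x y], [vTr (xLe n c d) e])]

def sch3 (x y z w : ℕ) : List Cls :=
  [([], [vQ x x]), ([vQ x y], [vQ y x]), ([vQ x y, vQ y z], [vQ x z]),
   ([vQ x y], [vQ (fn 0 x 0) (fn 0 y 0)]),
   ([vQ x y, vQ z w], [vQ (fn 1 x z) (fn 1 y w)]),
   ([vQ x y, vQ z w], [vQ (fn 2 x z) (fn 2 y w)]),
   ([vQ x y, vQ z w, vL x z], [vL y w])]

section prim
variable {α : Type} [Primcodable α] {n x y z w i : α → ℕ} {c d e : α → List ℕ}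

theorem prim_vTr (hc : Primrec c) (he : Primrec e) : Primrec fun a => vTr (c a) (e a) := by
  unfold vTr
  repeat' (first | assumption | exact Primrec.const _ | apply Primrec.pair)
theorem prim_vF (hn : Primrec n) (hc : Primrec c) : Primrec fun a => vF (n a) (c a) := by
  unfold vF
  repeat' (first | assumption | exact Primrec.const _ | apply Primrec.pair)
theorem prim_vE (hn : Primrec n) (hc : Primrec c) (he : Primrec e) (hx : Primrec x) : Primrec fun a => vE (n a) (c a) (e a) (x a) := by
  unfold vE
  repeat' (first | assumption | exact Primrec.const _ | apply Primrec.pair)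
theorem prim_vQ (hx : Primrec x) (hy : Primrec y) : Primrec fun a => vQ (x a) (y a) := by
  unfold vQ
  repeat' (first | assumption | exact Primrec.const _ | apply Primrec.pair)
theorem prim_vL (hx : Primrec x) (hy : Primrec y) : Primrec fun a => vL (x a) (y a) := by
  unfold vL
  repeat' (first | assumption | exact Primrec.const _ | apply Primrec.pair)
theorem prim_fn (hi : Primrec i) (hx : Primrec x) (hy : Primrec y) : Primrec fun a => fn (i a) (x a) (y a) :=
  Primrec.succ.comp (Primrec₂.natPair.comp hi (Primrec₂.natPair.comp hx hy))
theorem prim_wit (hc : Primrec c) (he : Primrec e) : Primrec fun a => wit (c a) (e a) :=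
  prim_fn (Primrec.const _) (Primrec.encode.comp hc) (Primrec.encode.comp he)
theorem prim_num : Primrec num :=
  Primrec.nat_iterate Primrec.id (Primrec.const 0) (prim_fn (Primrec.const 0) Primrec.snd (Primrec.const 0)).to₂
theorem prim_cons {β : Type} [Primcodable β] {x : α → β} {c : α → List β} (hx : Primrec x) (hc : Primrec c) : Primrec fun a => x a :: c a :=
  Primrec.list_cons.comp hx hc
theorem prim_app (hx : Primrec d) (hc : Primrec c) : Primrec fun a => d a ++ c a :=
  Primrec.list_append.comp hx hc
theorem prim_add (hx : Primrec x) (hc : Primrec y) : Primrec fun a => x a + y a :=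
  Primrec.nat_add.comp hx hc
theorem prim_mul (hx : Primrec x) (hc : Primrec y) : Primrec fun a => x a * y a :=
  Primrec.nat_mul.comp hx hc
theorem prim_getD (hc : Primrec c) (hx : Primrec x) : Primrec fun a => (c a).getD (x a) 0 :=
  (Primrec.list_getD 0).comp hc hx
theorem prim_xFal (hn : Primrec n) : Primrec fun a => xFal (n a) := by
  unfold xFal
  repeat' (first | assumption | exact Primrec.const _ | apply prim_add | apply prim_mul | apply prim_cons)
theorem prim_xEq (hn : Primrec n) (hc : Primrec c) (hd : Primrec d) : Primrec fun a => xEq (n a) (c a) (d a) :=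
  prim_cons (prim_mul (Primrec.const _) (Primrec₂.natPair.comp hn (Primrec.encode.comp hc)))
   (prim_cons (prim_mul (Primrec.const _) (Primrec₂.natPair.comp hn (Primrec.encode.comp hd))) (Primrec.const _))
theorem prim_xLe (hn : Primrec n) (hc : Primrec c) (hd : Primrec d) : Primrec fun a => xLe (n a) (c a) (d a) :=
  prim_cons (Primrec.const _) (prim_cons (prim_add (prim_mul (Primrec.const _) hn) (Primrec.const _)) (prim_xEq hn hc hd))

theorem prim_sch1 (hn : Primrec n) (hc : Primrec c) (hd : Primrec d) (he : Primrec e) (hx : Primrec x) (hy : Primrec y) :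
    Primrec fun a => sch1 (n a) (c a) (d a) (e a) (x a) (y a) := by
  unfold sch1
  repeat' (first | assumption | exact Primrec.const _ | apply prim_vTr | apply prim_vF | apply prim_vE | apply prim_xFal | apply prim_xEq | apply prim_xLe | apply prim_wit | apply prim_add | apply prim_app | apply prim_cons | apply Primrec.pair)

theorem prim_sch2 (hn : Primrec n) (hc : Primrec c) (hd : Primrec d) (he : Primrec e) (hx : Primrec x) (hy : Primrec y) :
    Primrec fun a => sch2 (n a) (c a) (d a) (e a) (x a) (y a) := by
  unfold sch2
  repeat' (first | assumption | exact Primrec.const _ | apply prim_vTr | apply prim_vQ | apply prim_vL | apply prim_vE | apply prim_xEq | apply prim_xLe | apply prim_fn | apply prim_getD | apply prim_mul | apply prim_add | apply prim_app | apply prim_cons | apply Primrec.pair)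

theorem prim_sch3 (hx : Primrec x) (hy : Primrec y) (hz : Primrec z) (hw : Primrec w) :
    Primrec fun a => sch3 (x a) (y a) (z a) (w a) := by
  unfold sch3
  repeat' (first | assumption | exact Primrec.const _ | apply prim_vQ | apply prim_vL | apply prim_fn | apply prim_cons | apply Primrec.pair)
end prim

def sch (p : Prm) : List Cls :=
  sch1 p.1 p.2.1 p.2.2.1 p.2.2.2.1 p.2.2.2.2.1 p.2.2.2.2.2.1 ++
  (sch2 p.1 p.2.1 p.2.2.1 p.2.2.2.1 p.2.2.2.2.1 p.2.2.2.2.2.1 ++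
  sch3 p.2.2.2.2.1 p.2.2.2.2.2.1 p.2.2.2.2.2.2.1 p.2.2.2.2.2.2.2)

theorem prim_sch : Primrec sch := by
  have h1 : Primrec (fun p : Prm => p.2) := Primrec.snd
  have h2 : Primrec (fun p : Prm => p.2.2) := Primrec.snd.comp h1
  have h3 : Primrec (fun p : Prm => p.2.2.2) := Primrec.snd.comp h2
  have h4 : Primrec (fun p : Prm => p.2.2.2.2) := Primrec.snd.comp h3
  have h5 : Primrec (fun p : Prm => p.2.2.2.2.2) := Primrec.snd.comp h4
  have h6 : Primrec (fun p : Prm => p.2.2.2.2.2.2) := Primrec.snd.comp h5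
  have a1 : Primrec (fun p : Prm => p.1) := Primrec.fst
  have a2 := Primrec.fst.comp h1
  have a3 := Primrec.fst.comp h2
  have a4 := Primrec.fst.comp h3
  have a5 := Primrec.fst.comp h4
  have a6 := Primrec.fst.comp h5
  have a7 := Primrec.fst.comp h6
  have a8 := Primrec.snd.comp h6
  exact Primrec.list_append.comp (prim_sch1 a1 a2 a3 a4 a5 a6)
    (Primrec.list_append.comp (prim_sch2 a1 a2 a3 a4 a5 a6) (prim_sch3 a5 a6 a7 a8))

/-- the clause set -/
def CL (X : ℕ → Prop) (θ : List ℕ) (k : ℕ) (cl : Cls) : Prop :=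
  ∃ p : Prm, cl ∈ sch p ∨ cl = ([vTr θ [num k] ], []) ∨ (X (Encodable.encode p.2.1) ∧ cl = ([], [vTr p.2.1 [] ]))

theorem ns_unsat {X : ℕ → Prop} (hX : ComputablePred X) (θ : List ℕ) :
    NS (k := 1) (fun v => ¬ ∃ u : Vt → Prop, ∀ cl, CL X θ (v 0) cl → ClSat u cl) := by
  let P (r : ℕ) : Prm := Denumerable.ofNat Prm r.unpair.2
  have hP : Primrec P := (Primrec.ofNat Prm).comp (Primrec.snd.comp Primrec.unpair)
  have hu1 : Primrec (fun r : ℕ => r.unpair.1) := Primrec.fst.comp Primrec.unpair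
  have hu2 : Primrec (fun r : ℕ => r.unpair.2) := Primrec.snd.comp Primrec.unpair
  let Q (q r : ℕ) : ℕ × ℕ := (r.unpair.1, q.unpair.2)
  have hQ : Primrec (fun a : ℕ × ℕ => Q a.1 a.2) := Primrec.pair (hu1.comp Primrec.snd) (hu2.comp Primrec.fst)
  have e0 : PrimrecRel (fun (cl : Cls) q => Fz q cl) := prim_Fz.swap
  have e1 : PrimrecRel (fun q r : ℕ => ∃ cl ∈ sch (P r), Fz (Q q r) cl) :=
    e0.exists_mem_list.comp (prim_sch.comp (hP.comp Primrec.snd)) hQ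
  have e2 : PrimrecRel (fun q r : ℕ => Fz (Q q r) ([vTr θ [num q.unpair.1] ], [])) := by
    refine prim_Fz.comp hQ (Primrec.pair (prim_cons (prim_vTr (Primrec.const _) (prim_cons ?_ (Primrec.const _))) (Primrec.const _)) (Primrec.const _))
    exact prim_num.comp (hu1.comp Primrec.fst)
  have e3 : PrimrecRel (fun q r : ℕ => Fz (Q q r) ([], [vTr (P r).2.1 [] ])) := by
    refine prim_Fz.comp hQ (Primrec.pair (Primrec.const _) (prim_cons (prim_vTr ?_ (Primrec.const _)) (Primrec.const _)))
    exact Primrec.fst.comp (Primrec.snd.comp (hP.comp Primrec.snd))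
  have e4 : Computable (fun r : ℕ => Encodable.encode (P r).2.1) :=
    (Primrec.encode.comp (Primrec.fst.comp (Primrec.snd.comp hP))).to_comp
  have key : NS (k := 1) (fun v => ∃ N, ∃ B, 2 ^ N = B ∧ ∀ s, s ≤ B → ∃ p q r, Nat.pair (v 0) N = q ∧ Nat.pair s p = r ∧
      ((∃ cl ∈ sch (P r), Fz (Q q r) cl) ∨ Fz (Q q r) ([vTr θ [num q.unpair.1] ], []) ∨
       ((∃ t, Encodable.encode (P r).2.1 = t ∧ X t) ∧ Fz (Q q r) ([], [vTr (P r).2.1 [] ])))) := by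
    refine Sg.ex (Sg.ex (Sg.and (ns_comp1 prim_pow.to_comp (Tm.var _) (Tm.var _)) (Sg.ball (Tm.var _) (Sg.ex (Sg.ex (Sg.ex
      (Sg.and (Sg.of_D0 (n0_pair (Tm.var _) (Tm.var _) (Tm.var _))) (Sg.and (Sg.of_D0 (n0_pair (Tm.var _) (Tm.var _) (Tm.var _))) 
      (Sg.or (ns_prel e1 (Tm.var _) (Tm.var _)) (Sg.or (ns_prel e2 (Tm.var _) (Tm.var _)) (Sg.and (Sg.ex (Sg.and
        (ns_comp1 e4 (Tm.var _) (Tm.var _)) (ns_pred hX (Tm.var _)))) (ns_prel e3 (Tm.var _) (Tm.var _)))))))))))))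
  refine key.of_iff ?_
  intro _ v
  refine (prop_compact _).trans ?_
  constructor
  · rintro ⟨N, h⟩
    refine ⟨N, _, rfl, fun s hs => ?_⟩
    obtain ⟨cl, ⟨p, hp⟩, hf⟩ := h s hs
    have hPr : P (Nat.pair s (Encodable.encode p)) = p := by
      show Denumerable.ofNat Prm (Nat.unpair _).2 = p
      rw [Nat.unpair_pair]; exact Denumerable.ofNat_encode p
    have hQr : Q (Nat.pair (v 0) N) (Nat.pair s (Encodable.encode p)) = (s, N) := by simp [Q]
    refine ⟨Encodable.encode p, _, _, rfl, rfl, ?_⟩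
    rw [hPr, hQr]
    rcases hp with hp | hp | ⟨hp, hp'⟩
    · exact Or.inl ⟨cl, hp, hf⟩
    · refine Or.inr (Or.inl ?_)
      rw [Nat.unpair_pair]; exact hp ▸ hf
    · exact Or.inr (Or.inr ⟨⟨_, rfl, hp⟩, hp' ▸ hf⟩)
  · rintro ⟨N, _, rfl, h⟩
    refine ⟨N, fun s hs => ?_⟩
    obtain ⟨p, _, _, rfl, rfl, h⟩ := h s hs
    have hQr : Q (Nat.pair (v 0) N) (Nat.pair s p) = (s, N) := by simp [Q]
    rw [hQr] at h
    rcases h with ⟨cl, h1, h2⟩ | h | ⟨⟨t, rfl, h1⟩, h2⟩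
    · exact ⟨cl, ⟨_, Or.inl h1⟩, h2⟩
    · rw [Nat.unpair_pair] at h
      exact ⟨_, ⟨P 0, Or.inr (Or.inl rfl)⟩, h⟩
    · exact ⟨_, ⟨_, Or.inr (Or.inr ⟨h1, rfl⟩)⟩, h2⟩
end

section

theorem CL.of {X : ℕ → Prop} {θ : List ℕ} {k : ℕ} {u : Vt → Prop} :
    (∀ cl, CL X θ k cl → ClSat u cl) ↔
    (∀ n c d e x y, ∀ cl ∈ sch1 n c d e x y, ClSat u cl) ∧ (∀ n c d e x y, ∀ cl ∈ sch2 n c d e x y, ClSat u cl) ∧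
    (∀ x y z w, ∀ cl ∈ sch3 x y z w, ClSat u cl) ∧ ¬ u (vTr θ [num k]) ∧ ∀ c, X (Encodable.encode c) → u (vTr c []) := by
  constructor
  · intro h
    refine ⟨fun n c d e x y cl hc => h cl ⟨(n,c,d,e,x,y,0,0), Or.inl ?_⟩, fun n c d e x y cl hc => h cl ⟨(n,c,d,e,x,y,0,0), Or.inl ?_⟩,
      fun x y z w cl hc => h cl ⟨(0,[],[],[],x,y,z,w), Or.inl ?_⟩, ?_, ?_⟩
    · exact List.mem_append_left _ hc
    · exact List.mem_append_right _ (List.mem_append_left _ hc)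
    · exact List.mem_append_right _ (List.mem_append_right _ hc)
    · intro hu
      have := h _ ⟨(0,[],[],[],0,0,0,0), Or.inr (Or.inl rfl)⟩ (by simpa using hu)
      simpa using this
    · intro c hc
      have := h _ ⟨(0,c,[],[],0,0,0,0), Or.inr (Or.inr ⟨hc, rfl⟩)⟩ (by simp)
      simpa using this
  · rintro ⟨h1, h2, h3, h4, h5⟩ cl ⟨p, hp | hp | ⟨hp, hp'⟩⟩
    · rcases List.mem_append.1 hp with hp | hp
      · exact h1 _ _ _ _ _ _ _ hp
      rcases List.mem_append.1 hp with hp | hp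
      · exact h2 _ _ _ _ _ _ _ hp
      · exact h3 _ _ _ _ _ hp
    · subst hp
      intro h; exact absurd (h _ (by simp)) h4
    · subst hp'
      intro _; exact ⟨_, by simp, h5 _ hp⟩

/-! environments -/
def env {M : Type} (f : ℕ → M) (n : ℕ) (e : List ℕ) : Fin n → M := fun i => f (e.getD (n - 1 - i) 0)

theorem env_cons {M : Type} (f : ℕ → M) (n : ℕ) (e : List ℕ) (x : ℕ) :
    env f (n+1) (x :: e) = Fin.snoc (env f n e) (f x) := by
  funext i
  refine Fin.lastCases ?_ (fun j => ?_) i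
  · rw [Fin.snoc_last]
    simp [env]
  · rw [Fin.snoc_castSucc]
    unfold env
    have : n + 1 - 1 - (j.castSucc : ℕ) = (n - 1 - j) + 1 := by
      have := j.2; simp only [Fin.val_castSucc]; omega
    rw [this, List.getD_cons_succ]

/-! soundness -/
section sound
variable {M : Type} [inst : LA.Structure M]

theorem getD_le_encode (l : List ℕ) (i : ℕ) : l.getD i 0 ≤ Encodable.encode l := by
  induction l generalizing i with
  | nil => simp
  | cons a l ih =>
    rw [Encodable.encode_list_cons]
    cases i with
    | zero => simp only [List.getD_cons_zero]; exact (Nat.left_le_pair _ _).trans (Nat.le_succ _)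
    | succ i => simp only [List.getD_cons_succ]; exact ((ih i).trans (Nat.right_le_pair _ _)).trans (Nat.le_succ _)

theorem lt_fn1 (i x y : ℕ) : x < fn i x y :=
  Nat.lt_succ_of_le ((Nat.left_le_pair x y).trans (Nat.right_le_pair i _))
theorem lt_fn2 (i x y : ℕ) : y < fn i x y :=
  Nat.lt_succ_of_le ((Nat.right_le_pair x y).trans (Nat.right_le_pair i _))

/-- existence of an interpretation of names -/
theorem exists_nv (G : List ℕ → (ℕ → M) → M) : ∃ f : ℕ → M, f 0 = rz ∧ (∀ x y, f (fn 0 x y) = rs (f x)) ∧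
    (∀ x y, f (fn 1 x y) = ra (f x) (f y)) ∧ (∀ x y, f (fn 2 x y) = rm (f x) (f y)) ∧
    (∀ c e, f (wit c e) = G c (fun i => f (e.getD i 0))) := by
  classical
  let body (a : ℕ) (f : ℕ → M) : M :=
    if a = 0 then rz else if (a-1).unpair.1 = 0 then rs (f (a-1).unpair.2.unpair.1) else
    if (a-1).unpair.1 = 1 then ra (f (a-1).unpair.2.unpair.1) (f (a-1).unpair.2.unpair.2) else
    if (a-1).unpair.1 = 2 then rm (f (a-1).unpair.2.unpair.1) (f (a-1).unpair.2.unpair.2) else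
    G (Denumerable.ofNat (List ℕ) (a-1).unpair.2.unpair.1) (fun i => f ((Denumerable.ofNat (List ℕ) (a-1).unpair.2.unpair.2).getD i 0))
  let f : ℕ → M := (Nat.lt_wfRel.wf).fix (fun a ih => body a (fun b => if h : b < a then ih b h else rz))
  have hf : ∀ a, f a = body a (fun b => if b < a then f b else rz) := by
    intro a
    show (Nat.lt_wfRel.wf).fix _ a = _
    rw [WellFounded.fix_eq]
    congr 1
  have hfn : ∀ i x y, f (fn i x y) = if i = 0 then rs (f x) else if i = 1 then ra (f x) (f y) else if i = 2 then rm (f x) (f y) else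
      G (Denumerable.ofNat (List ℕ) x) (fun j => if (Denumerable.ofNat (List ℕ) y).getD j 0 < fn i x y then f ((Denumerable.ofNat (List ℕ) y).getD j 0) else rz) := by
    intro i x y
    rw [hf]
    have h1 : fn i x y ≠ 0 := Nat.succ_ne_zero _
    have h2 : fn i x y - 1 = Nat.pair i (Nat.pair x y) := rfl
    simp only [body, if_neg h1, h2, Nat.unpair_pair, if_pos (lt_fn1 i x y), if_pos (lt_fn2 i x y)]
  refine ⟨f, ?_, fun x y => ?_, fun x y => ?_, fun x y => ?_, fun c e => ?_⟩
  · rw [hf]; simp [body]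
  · rw [hfn]; rfl
  · rw [hfn]; rfl
  · rw [hfn]; rfl
  · unfold wit
    rw [hfn, if_neg (by norm_num), if_neg (by norm_num), if_neg (by norm_num), Denumerable.ofNat_encode, Denumerable.ofNat_encode]
    congr 1
    funext j
    rw [if_pos]
    exact lt_of_le_of_lt (getD_le_encode e j) (lt_fn2 _ _ _)

theorem nv_num {f : ℕ → M} (h0 : f 0 = rz) (h1 : ∀ x, f (fn 0 x 0) = rs (f x)) (k : ℕ) : f (num k) = rs^[k] rz := by
  unfold num
  induction k with
  | zero => exact h0
  | succ k ih => rw [Function.iterate_succ_apply', h1, ih, Function.iterate_succ_apply']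

/-- truth of a token list in an environment -/
def TrM (f : ℕ → M) (c e : List ℕ) : Prop :=
  ∃ n, ∃ φ : LA.BoundedFormula Empty n, tok φ = c ∧ φ.Realize default (env f n e)

theorem TrM_tok (f : ℕ → M) {n : ℕ} (φ : LA.BoundedFormula Empty n) (e : List ℕ) :
    TrM f (tok φ) e ↔ φ.Realize default (env f n e) := by
  constructor
  · rintro ⟨m, ψ, h1, h2⟩
    have := tok_inj h1
    rw [Sigma.mk.inj_iff] at this
    obtain ⟨rfl, h⟩ := this
    rw [heq_eq_eq] at h
    exact h ▸ h2
  · intro h; exact ⟨n, φ, rfl, h⟩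

def EM (f : ℕ → M) (n : ℕ) (c e : List ℕ) (x : ℕ) : Prop :=
  ∃ t : LA.Term (Empty ⊕ Fin n), tokT t = c ∧ t.realize (Sum.elim default (env f n e)) = f x

def FM (n : ℕ) (c : List ℕ) : Prop := ∃ φ : LA.BoundedFormula Empty n, tok φ = c

def valM (f : ℕ → M) (a : Vt) : Prop :=
  match a with
  | (0, _, c, e, _, _) => TrM f c e
  | (1, n, c, _, _, _) => FM n c
  | (2, n, c, e, x, _) => EM f n c e x
  | (3, _, _, _, x, y) => f x = f y
  | (_, _, _, _, x, y) => rl (f x) (f y)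

theorem valM_Tr (f : ℕ → M) (c e) : valM f (vTr c e) = TrM f c e := rfl
theorem valM_F (f : ℕ → M) (n c) : valM f (vF n c) = FM n c := rfl
theorem valM_E (f : ℕ → M) (n c e x) : valM f (vE n c e x) = EM f n c e x := rfl
theorem valM_Q (f : ℕ → M) (x y) : valM f (vQ x y) = (f x = f y) := rfl
theorem valM_L (f : ℕ → M) (x y) : valM f (vL x y) = rl (f x) (f y) := rfl

theorem cl_sound {X : ℕ → Prop} {k : ℕ} (Θ : LA.BoundedFormula Empty 1) 
    (hV : ∀ φ : Snt, X (gnum φ) → M ⊨ φ) (hX : ∀ m, X m → ∃ φ : Snt, gnum φ = m)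
    (hΘ : ¬ Θ.Realize default (fun _ => (rs^[k] rz : M))) : ∃ u : Vt → Prop, ∀ cl, CL X (tok Θ) k cl → ClSat u cl := by
  classical
  let G (c : List ℕ) (g : ℕ → M) : M :=
    if h : ∃ a : M, ∃ n, ∃ φ : LA.BoundedFormula Empty (n+1), tok φ = c ∧ ¬ φ.Realize default (Fin.snoc (fun i : Fin n => g (n-1-i)) a) then
      Classical.choose h else rz
  obtain ⟨f, hz, hs, ha, hm, hw⟩ := exists_nv G
  refine ⟨valM f, CL.of.2 ⟨fun n c d e x y => ?_, fun n c d e x y => ?_, fun x y z w => ?_, ?_, ?_⟩⟩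
  · simp only [sch1, List.forall_mem_cons, List.not_mem_nil, ClSat, valM_Tr, valM_F, valM_E, List.exists_mem_cons_iff, false_and, exists_false, or_false, and_true,
      IsEmpty.forall_iff, implies_true, true_imp_iff, forall_const]
    refine ⟨⟨⊥, tok_falsum n⟩, ?_, ?_, ?_, ?_, ?_, ?_, ?_, ?_, ?_, ?_⟩
    · rintro ⟨⟨φ, rfl⟩, ψ, rfl⟩
      exact ⟨_, tok_imp φ ψ⟩
    · rintro ⟨φ, rfl⟩
      exact ⟨_, tok_all φ⟩
    · rintro ⟨⟨s, rfl, _⟩, t, rfl, _⟩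
      exact ⟨_, tok_eq s t⟩
    · rintro ⟨⟨s, rfl, _⟩, t, rfl, _⟩
      exact ⟨_, tok_le s t⟩
    · rw [← tok_falsum, TrM_tok]; exact id
    · rintro ⟨⟨φ, rfl⟩, ⟨ψ, rfl⟩, h1, h2⟩
      rw [← tok_imp, TrM_tok] at h1
      rw [TrM_tok] at h2 ⊢
      exact h1 h2
    · rintro ⟨⟨φ, rfl⟩, ⟨ψ, rfl⟩⟩
      rw [← tok_imp, TrM_tok, TrM_tok]
      by_cases h : φ.Realize default (env f n e)
      · exact Or.inl h
      · exact Or.inr (fun h' => absurd h' h)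
    · rintro ⟨⟨φ, rfl⟩, ⟨ψ, rfl⟩, h2⟩
      rw [← tok_imp, TrM_tok]
      rw [TrM_tok] at h2
      exact fun _ => h2
    · rintro ⟨⟨φ, rfl⟩, h2⟩
      rw [← tok_all, TrM_tok] at h2
      rw [TrM_tok, env_cons]
      exact h2 _
    · rintro ⟨⟨φ, rfl⟩, h2⟩
      rw [← tok_all, TrM_tok]
      rw [TrM_tok, env_cons, hw] at h2
      by_contra hne
      rw [BoundedFormula.realize_all] at hne
      push Not at hne
      obtain ⟨a, hna⟩ := hne
      have hex : ∃ a : M, ∃ n', ∃ φ' : LA.BoundedFormula Empty (n'+1), tok φ' = tok φ ∧ ¬ φ'.Realize default (Fin.snoc (fun i : Fin n' => (fun i => f (e.getD i 0)) (n'-1-i)) a) :=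
        ⟨a, n, φ, rfl, hna⟩
      have hG : G (tok φ) (fun i => f (e.getD i 0)) = Classical.choose hex := dif_pos hex
      obtain ⟨m, ψ, h3, h4⟩ := Classical.choose_spec hex
      have := tok_inj h3
      rw [Sigma.mk.inj_iff] at this
      obtain ⟨h5, h⟩ := this
      rw [Nat.add_right_cancel_iff] at h5
      subst h5
      rw [heq_eq_eq] at h
      subst h
      rw [hG] at h2
      exact h4 h2
  · simp only [sch2, List.forall_mem_cons, List.not_mem_nil, ClSat, valM_Tr, valM_F, valM_E, valM_Q, valM_L, List.exists_mem_cons_iff, false_and, exists_false, or_false, and_true,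
      IsEmpty.forall_iff, implies_true, true_imp_iff, forall_const]
    refine ⟨?_, ?_, ?_, ?_, ?_, ?_, ?_, ?_, ?_⟩
    · refine ⟨Term.var (Sum.inr ⟨x, by omega⟩), tokT_var _, ?_⟩
      simp only [Term.realize_var, Sum.elim_inr, env]
      congr 2; omega
    · exact ⟨zeroT, tokT_zero, by rw [re_zero, hz]⟩
    · rintro ⟨t, rfl, h⟩
      exact ⟨succT t, tokT_succ t, by rw [re_succ, hs, h]⟩
    · rintro ⟨⟨s, rfl, h1⟩, t, rfl, h2⟩
      exact ⟨addT s t, tokT_add s t, by rw [re_add, ha, h1, h2]⟩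
    · rintro ⟨⟨s, rfl, h1⟩, t, rfl, h2⟩
      exact ⟨mulT s t, tokT_mul s t, by rw [re_mul, hm, h1, h2]⟩
    · rintro ⟨⟨s, rfl, h1⟩, ⟨t, rfl, h2⟩, h3⟩
      rw [← tok_eq, TrM_tok] at h3
      exact h1.symm.trans (Eq.trans h3 h2)
    · rintro ⟨⟨s, rfl, h1⟩, ⟨t, rfl, h2⟩, h3⟩
      rw [← tok_eq, TrM_tok]
      exact h1.trans (h3.trans h2.symm)
    · rintro ⟨⟨s, rfl, h1⟩, ⟨t, rfl, h2⟩, h3⟩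
      rw [← tok_le, TrM_tok, re_le] at h3
      rwa [h1, h2] at h3
    · rintro ⟨⟨s, rfl, h1⟩, ⟨t, rfl, h2⟩, h3⟩
      rw [← tok_le, TrM_tok, re_le]
      rwa [h1, h2]
  · simp only [sch3, List.forall_mem_cons, List.not_mem_nil, ClSat, valM_Q, valM_L, List.exists_mem_cons_iff, false_and, exists_false, or_false, and_true,
      IsEmpty.forall_iff, implies_true, true_imp_iff, forall_const, hs, ha, hm]
    refine ⟨trivial, Eq.symm, fun h => h.1.trans h.2, fun h => by rw [h], fun h => by rw [h.1, h.2], fun h => by rw [h.1, h.2], fun h => ?_⟩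
    rw [← h.1, ← h.2.1]; exact h.2.2
  · rw [valM_Tr, TrM_tok]
    intro h
    apply hΘ
    convert h using 1
    funext i
    rw [Subsingleton.elim i 0]
    simp [env, nv_num hz (fun x => hs x 0)]
  · intro c hc
    obtain ⟨φ, hφ⟩ := hX _ hc
    have h1 := hV φ (hφ ▸ hc)
    rw [gnum_tok] at hφ
    rw [← Encodable.encode_injective hφ, valM_Tr, TrM_tok]
    have : env f 0 [] = (default : Fin 0 → M) := Subsingleton.elim _ _
    rw [this]
    exact h1
end sound
end

section

theorem cl_complete {X : ℕ → Prop} {k : ℕ} (Θ : LA.BoundedFormula Empty 1) (u : Vt → Prop)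
    (hu : ∀ cl, CL X (tok Θ) k cl → ClSat u cl) :
    ∃ (M : Type) (_ : LA.Structure M), Nonempty M ∧ (∀ φ : Snt, X (gnum φ) → M ⊨ φ) ∧ ¬ Θ.Realize default (fun _ => (rs^[k] rz : M)) := by
  obtain ⟨h1, h2, h3, h4, h5⟩ := CL.of.1 hu
  simp only [sch1, List.forall_mem_cons, List.not_mem_nil, ClSat, List.exists_mem_cons_iff, false_and, exists_false, or_false, and_true,
      IsEmpty.forall_iff, implies_true, true_imp_iff, forall_const] at h1
  simp only [sch2, List.forall_mem_cons, List.not_mem_nil, ClSat, List.exists_mem_cons_iff, false_and, exists_false, or_false, and_true,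
      IsEmpty.forall_iff, implies_true, true_imp_iff, forall_const] at h2
  simp only [sch3, List.forall_mem_cons, List.not_mem_nil, ClSat, List.exists_mem_cons_iff, false_and, exists_false, or_false, and_true,
      IsEmpty.forall_iff, implies_true, true_imp_iff, forall_const] at h3
  have q1 : ∀ x, u (vQ x x) := fun x => (h3 x x x x).1
  have q2 : ∀ {x y}, u (vQ x y) → u (vQ y x) := fun {x y} => (h3 x y x x).2.1
  have q3 : ∀ {x y z}, u (vQ x y) → u (vQ y z) → u (vQ x z) := fun {x y z} a b => (h3 x y z x).2.2.1 ⟨a, b⟩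
  have q4 : ∀ {x y}, u (vQ x y) → u (vQ (fn 0 x 0) (fn 0 y 0)) := fun {x y} => (h3 x y x x).2.2.2.1
  have q5 : ∀ {x y z w}, u (vQ x y) → u (vQ z w) → u (vQ (fn 1 x z) (fn 1 y w)) := fun {x y z w} a b => (h3 x y z w).2.2.2.2.1 ⟨a, b⟩
  have q6 : ∀ {x y z w}, u (vQ x y) → u (vQ z w) → u (vQ (fn 2 x z) (fn 2 y w)) := fun {x y z w} a b => (h3 x y z w).2.2.2.2.2.1 ⟨a, b⟩
  have q7 : ∀ {x y z w}, u (vQ x y) → u (vQ z w) → u (vL x z) → u (vL y w) := fun {x y z w} a b c => (h3 x y z w).2.2.2.2.2.2 ⟨a, b, c⟩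
  let st : Setoid ℕ := ⟨fun x y => u (vQ x y), q1, q2, q3⟩
  let M := Quotient st
  let mk : ℕ → M := Quotient.mk st
  let fS : M → M := Quotient.map (fun x => fn 0 x 0) (fun _ _ h => q4 h)
  let fA : M → M → M := Quotient.map₂ (fun x y => fn 1 x y) (fun _ _ h _ _ h' => q5 h h')
  let fM : M → M → M := Quotient.map₂ (fun x y => fn 2 x y) (fun _ _ h _ _ h' => q6 h h')
  let fL : M → M → Prop := Quotient.lift₂ (fun x y => u (vL x y)) (fun _ _ _ _ h h' => propext ⟨q7 h h', q7 (q2 h) (q2 h')⟩)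
  let inst : LA.Structure M :=
    { funMap := fun {n} f x => match n, f, x with
        | 0, _, _ => mk 0
        | 1, _, x => fS (x 0)
        | 2, f, x => cond (show Bool from f) (fM (x 0) (x 1)) (fA (x 0) (x 1))
      RelMap := fun {n} f x => match n, f, x with
        | 2, _, x => fL (x 0) (x 1) }
  have mz : (rz : M) = mk 0 := rfl
  have ms : ∀ x, rs (mk x) = mk (fn 0 x 0) := fun x => rfl
  have ma : ∀ x y, ra (mk x) (mk y) = mk (fn 1 x y) := fun x y => rfl
  have mm : ∀ x y, rm (mk x) (mk y) = mk (fn 2 x y) := fun x y => rfl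
  have ml : ∀ x y, rl (mk x) (mk y) ↔ u (vL x y) := fun x y => Iff.rfl
  have mq : ∀ x y, mk x = mk y ↔ u (vQ x y) := fun x y => Quotient.eq (r := st)
  have hE : ∀ {n} (t : LA.Term (Empty ⊕ Fin n)) (e : List ℕ), ∃ x, u (vE n (tokT t) e x) ∧ t.realize (Sum.elim default (env mk n e)) = mk x := by
    intro n t e
    induction t using term_cases with
    | hv j =>
      refine ⟨e.getD (n - 1 - j) 0, ?_, rfl⟩
      have := (h2 n [] [] e j (n-1-j)).1
      rw [tokT_var]
      have hj : (j : ℕ) + (n - 1 - j) + 1 = n := by have := j.2; omega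
      rw [hj] at this
      exact this
    | hz => exact ⟨0, by rw [tokT_zero]; exact (h2 n [] [] e 0 0).2.1, by rw [re_zero, mz]⟩
    | hs t ih =>
      obtain ⟨x, hx, hx'⟩ := ih
      exact ⟨_, by rw [tokT_succ]; exact (h2 n _ [] e x 0).2.2.1 hx, by rw [re_succ, hx', ms]⟩
    | ha s t ih1 ih2 =>
      obtain ⟨x, hx, hx'⟩ := ih1
      obtain ⟨y, hy, hy'⟩ := ih2
      exact ⟨_, by rw [tokT_add]; exact (h2 n _ _ e x y).2.2.2.1 ⟨hx, hy⟩, by rw [re_add, hx', hy', ma]⟩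
    | hm s t ih1 ih2 =>
      obtain ⟨x, hx, hx'⟩ := ih1
      obtain ⟨y, hy, hy'⟩ := ih2
      exact ⟨_, by rw [tokT_mul]; exact (h2 n _ _ e x y).2.2.2.2.1 ⟨hx, hy⟩, by rw [re_mul, hx', hy', mm]⟩
  have hF : ∀ {n} (φ : LA.BoundedFormula Empty n), u (vF n (tok φ)) := by
    intro n φ
    induction φ using fml_cases with
    | hf n => rw [tok_falsum]; exact (h1 n [] [] [] 0 0).1
    | he n s t =>
      obtain ⟨x, hx, _⟩ := hE s []
      obtain ⟨y, hy, _⟩ := hE t []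
      rw [tok_eq]
      exact (h1 n _ _ [] x y).2.2.2.1 ⟨hx, hy⟩
    | hl n s t =>
      obtain ⟨x, hx, _⟩ := hE s []
      obtain ⟨y, hy, _⟩ := hE t []
      rw [tok_le]
      exact (h1 n _ _ [] x y).2.2.2.2.1 ⟨hx, hy⟩
    | hi n φ ψ i1 i2 => rw [tok_imp]; exact (h1 n _ _ [] 0 0).2.1 ⟨i1, i2⟩
    | ha n φ i1 => rw [tok_all]; exact (h1 n _ [] [] 0 0).2.2.1 i1
  have hT : ∀ {n} (φ : LA.BoundedFormula Empty n) (e : List ℕ), u (vTr (tok φ) e) ↔ φ.Realize default (env mk n e) := by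
    intro n φ
    induction φ using fml_cases with
    | hf n => 
      intro e
      rw [tok_falsum]; exact ⟨fun h => ((h1 n [] [] e 0 0).2.2.2.2.2.1 h).elim, fun h => False.elim h⟩
    | he n s t =>
      intro e
      obtain ⟨x, hx, hx'⟩ := hE s e
      obtain ⟨y, hy, hy'⟩ := hE t e
      rw [tok_eq]
      have := (mq x y)
      rw [← hx', ← hy'] at this
      refine Iff.trans ?_ this.symm
      exact ⟨fun h => (h2 n _ _ e x y).2.2.2.2.2.1 ⟨hx, hy, h⟩, fun h => (h2 n _ _ e x y).2.2.2.2.2.2.1 ⟨hx, hy, h⟩⟩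
    | hl n s t =>
      intro e
      obtain ⟨x, hx, hx'⟩ := hE s e
      obtain ⟨y, hy, hy'⟩ := hE t e
      rw [tok_le, re_le, hx', hy', ml]
      exact ⟨fun h => (h2 n _ _ e x y).2.2.2.2.2.2.2.1 ⟨hx, hy, h⟩, fun h => (h2 n _ _ e x y).2.2.2.2.2.2.2.2 ⟨hx, hy, h⟩⟩
    | hi n φ ψ i1 i2 =>
      intro e
      rw [tok_imp, BoundedFormula.realize_imp, ← i1, ← i2]
      have k1 := hF φ
      have k2 := hF ψ
      have k := (h1 n (tok φ) (tok ψ) e 0 0).2.2.2.2.2.2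
      constructor
      · intro a b; exact k.1 ⟨k1, k2, a, b⟩
      · intro a
        rcases k.2.1 ⟨k1, k2⟩ with b | b
        · exact k.2.2.1 ⟨k1, k2, a b⟩
        · exact b
    | ha n φ i1 =>
      intro e
      rw [tok_all, BoundedFormula.realize_all]
      constructor
      · intro a b
        obtain ⟨x, rfl⟩ : ∃ x, mk x = b := Quotient.exists_rep b
        rw [← env_cons, ← i1]
        exact (h1 n (tok φ) [] e x 0).2.2.2.2.2.2.2.2.2.1 ⟨hF φ, a⟩
      · intro a
        refine (h1 n (tok φ) [] e 0 0).2.2.2.2.2.2.2.2.2.2 ⟨hF φ, ?_⟩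
        rw [i1, env_cons]
        exact a _
  refine ⟨M, inst, ⟨mk 0⟩, fun φ hφ => ?_, fun h => h4 ?_⟩
  · have := h5 (tok φ) (gnum_tok φ ▸ hφ)
    rw [hT] at this
    have he : env mk 0 [] = (default : Fin 0 → M) := Subsingleton.elim _ _
    rw [he] at this
    show BoundedFormula.Realize φ _ _
    convert this using 1
  · rw [hT]
    convert h using 1
    funext i
    rw [Subsingleton.elim i 0]
    simp [env, nv_num (M := M) (f := mk) mz (fun x => rfl)]

/-- the r.e.-ness of provability -/
theorem re_thm {V : Thy} (hV : CompThy V) (Θ : LA.BoundedFormula Empty 1) :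
    NS (k := 1) (fun v => ∀ (M : Type) [LA.Structure M] [Nonempty M], M ⊨ V → Θ.Realize default (fun _ => (rs^[v 0] rz : M))) := by
  refine (ns_unsat hV (tok Θ)).of_iff ?_
  intro _ v
  constructor
  · rintro h ⟨u, hu⟩
    obtain ⟨M, _, hn, h1, h2⟩ := cl_complete Θ u hu
    refine h2 (h M (Theory.model_iff V |>.2 fun φ hφ => h1 φ ⟨φ, hφ, rfl⟩))
  · intro h M _ _ hM
    by_contra hΘ
    refine h (cl_sound (M := M) Θ ?_ ?_ hΘ)
    · rintro φ ⟨ψ, h1, h2⟩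
      rw [gnum_tok, gnum_tok] at h2
      have := tok_inj (Encodable.encode_injective h2)
      rw [Sigma.mk.inj_iff] at this
      rw [← eq_of_heq this.2]
      exact hM.realize_of_mem _ h1
    · rintro m ⟨ψ, h1, h2⟩; exact ⟨ψ, h2⟩
end

section

/-- the arithmetical model `i` satisfies `V` -/
def Md (V : Thy) (i : Mdl) : Prop := i.C ⊨ V

theorem ExtPA.mono {V V' : Thy} (h : ExtPA V) (hs : V ⊆ V') : ExtPA V' := by
  intro φ hφ
  exact Theory.models_iff_finset_models.2 (by
    obtain ⟨T0, h1, h2⟩ := Theory.models_iff_finset_models.1 (h φ hφ)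
    exact ⟨T0, h1.trans hs, h2⟩)

theorem ExtPA.models {V : Thy} (h : ExtPA V) {M : Type} [LA.Structure M] [Nonempty M] (hM : M ⊨ V) : M ⊨ PAAx :=
  Theory.model_iff _ |>.2 fun φ hφ => (h φ hφ).realize_sentence M

theorem mdl_of {V : Thy} (h : ExtPA V) {M : Type} [inst : LA.Structure M] [Nonempty M] (hM : M ⊨ V) :
    ∃ P : PAM M, @strucOf M P.toCommSemiring _ = inst ∧ Md V ⟨M, P⟩ := by
  obtain ⟨P, hP⟩ := exists_pam (h.models hM)
  refine ⟨P, hP, ?_⟩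
  subst hP
  exact hM

theorem prv_iff {V : Thy} (h : ExtPA V) (φ : Snt) : Prv V φ ↔ ∀ i : Mdl, Md V i → i.C ⊨ φ := by
  constructor
  · intro hp i hi
    haveI : i.C ⊨ V := hi
    exact Theory.ModelsBoundedFormula.realize_sentence hp i.C
  · intro hh
    refine Theory.models_sentence_iff.2 fun M => ?_
    obtain ⟨P, hP, hm⟩ := mdl_of h (M := M) M.is_model
    have := hh _ hm
    have key : ∀ (inst : LA.Structure M), @strucOf M P.toCommSemiring _ = inst → @Sentence.Realize LA M inst φ := by
      intro inst e; subst e; exact this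
    exact key _ hP

theorem num_cast {M : Type} [PAM M] (k : ℕ) : (rs^[k] rz : M) = (k : M) := by
  induction k with
  | zero => simp
  | succ k ih => rw [Function.iterate_succ_apply', ih, Nat.cast_succ]; rfl

theorem re_mdl {V : Thy} (hV : CompThy V) (hE : ExtPA V) {R : ∀ i : Mdl, i.C → Prop}
    (hR : Df (k := 1) (fun i v => R i (v 0))) :
    ∃ α : ∀ i : Mdl, i.C → i.C → Prop, D0 (k := 2) (fun i v => α i (v 0) (v 1)) ∧
      ∀ k : ℕ, (∀ i, Md V i → R i (k : i.C)) ↔ ∃ s : ℕ, α natM k s := by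
  obtain ⟨Θ, hΘ⟩ := hR
  obtain ⟨Q, hQ, hQ2⟩ := re_thm hV Θ
  obtain ⟨φ, hφ, hφ2⟩ := hQ
  refine ⟨fun i x y => ¬ φ.Realize default (![x, y]), ?_, ?_⟩
  · have : D0 (S := Mdl.C) (fun i v => ¬ φ.Realize default v) := D0.not ⟨φ, hφ, fun i v => Iff.rfl⟩
    refine this.of_iff ?_
    intro i v
    have : ![v 0, v 1] = v := by ext j; fin_cases j <;> rfl
    simp only [this]
  · intro k
    have h1 := hQ2 () (fun _ => k)
    have h2 : (∀ i, Md V i → R i (k : i.C)) ↔ ∀ (M : Type) [LA.Structure M] [Nonempty M], M ⊨ V → Θ.Realize default (fun _ => (rs^[k] rz : M)) := by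
      constructor
      · intro h M inst _ hM
        obtain ⟨P, hP, hm⟩ := mdl_of hE (M := M) hM
        have h3 := h _ hm
        subst hP
        have h4 := (hΘ ⟨M, P⟩ (fun _ => (k : M))).2 h3
        rw [num_cast]
        exact h4
      · intro h i hi
        have := h i.C hi
        rw [num_cast] at this
        exact (hΘ i _).1 this
    rw [h2]
    refine h1.trans ?_
    refine exists_congr fun s => not_congr ?_
    rw [← hφ2]
    have : (Fin.snoc (fun _ => k) s : Fin 2 → ℕ) = ![k, s] := by
      ext j; fin_cases j <;> rfl
    rw [this]
    exact iff_of_eq (by congr 1)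

open Classical in
/-- a Δ₀ relation enumerating the theorems `V ⊢ R(k)` -/
noncomputable def al (V : Thy) (R : ∀ i : Mdl, i.C → Prop) : ∀ i : Mdl, i.C → i.C → Prop :=
  if h : ∃ α : ∀ i : Mdl, i.C → i.C → Prop, D0 (k := 2) (fun i v => α i (v 0) (v 1)) ∧
      ∀ k : ℕ, (∀ i, Md V i → R i (k : i.C)) ↔ ∃ s : ℕ, α natM k s then h.choose else fun _ _ _ => False

theorem al_d0' (V : Thy) (R : ∀ i : Mdl, i.C → Prop) : D0 (k := 2) (fun i v => al V R i (v 0) (v 1)) := by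
  unfold al
  split
  · rename_i h; exact h.choose_spec.1
  · exact D0.false

theorem al_d0 (V : Thy) (R : ∀ i : Mdl, i.C → Prop) {k : ℕ} {f g : ∀ i : Mdl, (Fin k → i.C) → i.C} (hf : Tm f) (hg : Tm g) :
    D0 (fun i v => al V R i (f i v) (g i v)) := by
  have := (al_d0' V R).comp (s := fun j i v => ![f i v, g i v] j) (fun j => by
    fin_cases j
    · exact hf
    · exact hg)
  exact this

theorem al_spec {V : Thy} (hV : CompThy V) (hE : ExtPA V) {R : ∀ i : Mdl, i.C → Prop}
    (hR : Df (k := 1) (fun i v => R i (v 0))) (k : ℕ) : (∀ i, Md V i → R i (k : i.C)) ↔ ∃ s : ℕ, al V R natM k s := by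
  have h := re_mdl hV hE hR
  unfold al
  rw [dif_pos h]
  exact h.choose_spec.2 k

theorem al_cast (V : Thy) (R : ∀ i : Mdl, i.C → Prop) (i : Mdl) (x y : ℕ) :
    al V R i (x : i.C) (y : i.C) ↔ al V R natM x y := by
  have := (al_d0' V R).cast i ![x, y]
  exact this

section SatE
variable {M : Type} [PAM M]
/-- `u` witnesses the `Σ_{m+1}` sentence coded by `e` -/
def We (m : ℕ) (u e : M) : Prop := ∃ c, c ≤ e ∧ ∃ a, a ≤ e ∧ (e = pr c a ∧ W m u c a)
def SatE (m : ℕ) (e : M) : Prop := ∃ u, We m u e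
theorem we_pr (m : ℕ) (u c a : M) : We m u (pr c a) ↔ W m u c a := by
  constructor
  · rintro ⟨c', _, a', _, e, h⟩
    obtain ⟨e1, e2⟩ := pr_inj e
    rw [e1, e2]; exact h
  · intro h
    exact ⟨c, le_pr_left _ _, a, le_pr_right _ _, rfl, h⟩
theorem satE_pr (m : ℕ) (c a : M) : SatE m (pr c a) ↔ Sat m c a := exists_congr fun u => we_pr m u c a
end SatE

theorem Pg.we (m : ℕ) {k : ℕ} {f g : ∀ i : Mdl, (Fin k → i.C) → i.C} (hf : Tm f) (hg : Tm g) :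
    Pg m (fun i v => We m (f i v) (g i v)) := by
  unfold We
  refine Pg.bex hg (Pg.bex hg.lift (Pg.and (Pg.of_D0 (D0.eq hg.lift.lift (Tm.pr (Tm.var _) (Tm.var _)))) ?_))
  exact Pg.w m hf.lift.lift (Tm.var _) (Tm.var _)

theorem Sg.satE (m : ℕ) {k : ℕ} {g : ∀ i : Mdl, (Fin k → i.C) → i.C} (hg : Tm g) :
    Sg (m+1) (fun i v => SatE m (g i v)) :=
  Sg.ex (Pg.sg_succ (Pg.we m (Tm.var _) hg.lift))

theorem univE (m : ℕ) {k : ℕ} {R : ∀ i : Mdl, (Fin k → i.C) → Prop} (h : Sg (m+1) R) :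
    ∃ c : ℕ, ∀ (i : Mdl) v, R i v ↔ SatE m (pr (c : i.C) (tup v)) := by
  obtain ⟨c, hc⟩ := univ m h
  exact ⟨c, fun i v => (hc i v).trans (satE_pr _ _ _).symm⟩

abbrev SgS (m : ℕ) (A : Mdl → Prop) : Prop := Sg (ι := Mdl) (S := Mdl.C) (m+1) (k := 0) (fun i _ => A i)

theorem univS (m : ℕ) {A : Mdl → Prop} (h : SgS m A) : ∃ e : ℕ, ∀ i : Mdl, A i ↔ SatE m (e : i.C) := by
  obtain ⟨c, hc⟩ := univE m h
  refine ⟨pr c 0, fun i => ?_⟩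
  rw [hc i Fin.elim0]
  simp [tup]

/-- provably `Δ_{m+1}` (and `Δ₀` if `m = 0`) -/
def Dn (m : ℕ) {k : ℕ} (R : ∀ i : Mdl, (Fin k → i.C) → Prop) : Prop := Sg (m+1) R ∧ Pg (m+1) R ∧ (m = 0 → D0 R)

namespace Dn
variable {m k : ℕ} {P R : ∀ i : Mdl, (Fin k → i.C) → Prop}
theorem sg (h : Dn m R) : Sg (m+1) R := h.1
theorem pg (h : Dn m R) : Pg (m+1) R := h.2.1
theorem of_iff (h : Dn m R) (hh : ∀ i v, P i v ↔ R i v) : Dn m P := ⟨h.1.of_iff hh, h.2.1.of_iff hh, fun e => (h.2.2 e).of_iff hh⟩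
theorem of_D0 (h : D0 R) : Dn m R := ⟨Sg.of_D0 h, Pg.of_D0 h, fun _ => h⟩
theorem of_Pg (h : Pg m R) : Dn m R := ⟨h.sg_succ, h.succ, fun e => by
  subst e
  have h2 : D0 _ := h
  refine h2.not.of_iff ?_
  intro i v; exact not_not.symm⟩
theorem not (h : Dn m R) : Dn m (fun i v => ¬ R i v) := ⟨Pg.not h.2.1, Sg.not h.1, fun e => (h.2.2 e).not⟩
theorem and (h : Dn m R) (h' : Dn m P) : Dn m (fun i v => R i v ∧ P i v) := ⟨h.1.and h'.1, h.2.1.and h'.2.1, fun e => (h.2.2 e).and (h'.2.2 e)⟩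
theorem or (h : Dn m R) (h' : Dn m P) : Dn m (fun i v => R i v ∨ P i v) := ⟨h.1.or h'.1, h.2.1.or h'.2.1, fun e => (h.2.2 e).or (h'.2.2 e)⟩
theorem imp (h : Dn m R) (h' : Dn m P) : Dn m (fun i v => R i v → P i v) := ⟨Sg.imp h.2.1 h'.1, Pg.imp h.1 h'.2.1, fun e => (h.2.2 e).imp (h'.2.2 e)⟩
theorem ball {Q : ∀ i : Mdl, (Fin k → i.C) → i.C → Prop} {f : ∀ i : Mdl, (Fin k → i.C) → i.C} (hf : Tm f)
    (h : Dn m (fun i (v : Fin (k+1) → i.C) => Q i (fun j => v j.castSucc) (v (Fin.last k)))) : Dn m (fun i v => ∀ x, x ≤ f i v → Q i v x) :=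
  ⟨Sg.ball hf h.1, Pg.ball hf h.2.1, fun e => D0.ball hf (h.2.2 e)⟩
theorem bex {Q : ∀ i : Mdl, (Fin k → i.C) → i.C → Prop} {f : ∀ i : Mdl, (Fin k → i.C) → i.C} (hf : Tm f)
    (h : Dn m (fun i (v : Fin (k+1) → i.C) => Q i (fun j => v j.castSucc) (v (Fin.last k)))) : Dn m (fun i v => ∃ x, x ≤ f i v ∧ Q i v x) :=
  ⟨Sg.bex hf h.1, Pg.bex hf h.2.1, fun e => D0.bex hf (h.2.2 e)⟩
theorem we {f g : ∀ i : Mdl, (Fin k → i.C) → i.C} (hf : Tm f) (hg : Tm g) : Dn m (fun i v => We m (f i v) (g i v)) :=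
  of_Pg (Pg.we m hf hg)
theorem comp {j : ℕ} (h : Dn m R) {s : Fin k → ∀ i : Mdl, (Fin j → i.C) → i.C} (hs : ∀ l, Tm (s l)) :
    Dn m (fun i v => R i (fun l => s l i v)) := ⟨h.1.comp hs, h.2.1.comp hs, fun e => (h.2.2 e).comp hs⟩
end Dn
end

section

/-- context: level and theories -/
structure Cx where
  m : ℕ
  V1 : Thy
  V2 : Thy
  V3 : Thy
  c1 : CompThy V1
  c2 : CompThy V2
  c3 : CompThy V3
  e1 : ExtPA V1
  e2 : ExtPA V2
  e3 : ExtPA V3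

def sg (m : ℕ) (i : Mdl) (d : i.C) : Prop := ∃ c, c ≤ d ∧ ∃ c', c' ≤ d ∧ (d = pr c c' ∧ SatE m (pr c (pr d 0)))
def tu (m : ℕ) (i : Mdl) (d : i.C) : Prop := ∃ c, c ≤ d ∧ ∃ c', c' ≤ d ∧ (d = pr c c' ∧ SatE m (pr c' (pr d 0)))
def ph (m : ℕ) (i : Mdl) (d : i.C) : Prop := sg m i d ∧ ¬ tu m i d

section
variable {k : ℕ} {f g h l : ∀ i : Mdl, (Fin k → i.C) → i.C}

theorem Sg.sg (m : ℕ) (hf : Tm f) : Sg (m+1) (fun i v => sg m i (f i v)) := by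
  unfold Guaspari.sg
  refine Sg.bex hf (Sg.bex hf.lift (Sg.and (Sg.of_D0 (D0.eq hf.lift.lift (Tm.pr (Tm.var _) (Tm.var _)))) ?_))
  exact Sg.satE m (Tm.pr (Tm.var _) (Tm.pr hf.lift.lift Tm.zero))
theorem Sg.tu (m : ℕ) (hf : Tm f) : Sg (m+1) (fun i v => tu m i (f i v)) := by
  unfold Guaspari.tu
  refine Sg.bex hf (Sg.bex hf.lift (Sg.and (Sg.of_D0 (D0.eq hf.lift.lift (Tm.pr (Tm.var _) (Tm.var _)))) ?_))
  exact Sg.satE m (Tm.pr (Tm.var _) (Tm.pr hf.lift.lift Tm.zero))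

theorem diag (m : ℕ) {A B : ∀ i : Mdl, i.C → Prop} (hA : Sg (m+1) (k := 1) (fun i v => A i (v 0)))
    (hB : Sg (m+1) (k := 1) (fun i v => B i (v 0))) :
    ∃ d : ℕ, ∀ i : Mdl, (sg m i (d : i.C) ↔ A i d) ∧ (tu m i (d : i.C) ↔ B i d) := by
  obtain ⟨c, hc⟩ := univE m hA
  obtain ⟨c', hc'⟩ := univE m hB
  refine ⟨pr c c', fun i => ⟨?_, ?_⟩⟩
  · have h1 := hc i (fun _ => ((pr c c' : ℕ) : i.C))
    rw [h1]
    constructor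
    · rintro ⟨a, _, b, _, e, h⟩
      rw [pr_cast] at e
      obtain ⟨e1, e2⟩ := pr_inj e
      rw [e1]
      exact h
    · intro h
      refine ⟨c, ?_, c', ?_, ?_, h⟩
      · rw [pr_cast]; exact le_pr_left _ _
      · rw [pr_cast]; exact le_pr_right _ _
      · rw [pr_cast]
  · have h1 := hc' i (fun _ => ((pr c c' : ℕ) : i.C))
    rw [h1]
    constructor
    · rintro ⟨a, _, b, _, e, h⟩
      rw [pr_cast] at e
      obtain ⟨e1, e2⟩ := pr_inj e
      rw [e2]
      exact h
    · intro h
      refine ⟨c, ?_, c', ?_, ?_, h⟩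
      · rw [pr_cast]; exact le_pr_left _ _
      · rw [pr_cast]; exact le_pr_right _ _
      · rw [pr_cast]

def PPR (m : ℕ) (i : Mdl) (p : i.C) : Prop := ∀ e, e ≤ p → ∀ d, d ≤ p → (p = pr e d → (ph m i d → ¬ SatE m e))
def PSR (m : ℕ) (i : Mdl) (p : i.C) : Prop := ∀ e, e ≤ p → ∀ d, d ≤ p → (p = pr e d → (ph m i d → SatE m e))
def ER (m : ℕ) (i : Mdl) (d : i.C) : Prop := ¬ tu m i d
def FR (m : ℕ) (i : Mdl) (d : i.C) : Prop := sg m i d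

theorem df_ball {Q : ∀ i : Mdl, (Fin k → i.C) → i.C → Prop} (hf : Tm f) (h : Df (k := k+1) (fun i v => Q i (fun j => v j.castSucc) (v (Fin.last k)))) :
    Df (fun i v => ∀ x, x ≤ f i v → Q i v x) :=
  Df.all (Df.imp (Df.le (Tm.var _) hf.lift) h)

theorem df_ph (m : ℕ) (hf : Tm f) : Df (fun i v => ph m i (f i v)) := (Sg.sg m hf).df.and (Sg.tu m hf).df.not

theorem df_ppr (m : ℕ) : Df (k := 1) (fun i v => PPR m i (v 0)) := by
  unfold PPR
  refine df_ball (Tm.var _) (df_ball (Tm.var _) (Df.imp (Df.eq (Tm.var _) (Tm.pr (Tm.var _) (Tm.var _))) (Df.imp (df_ph m (Tm.var _)) (Df.not (Sg.satE m (Tm.var _)).df))))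
theorem df_psr (m : ℕ) : Df (k := 1) (fun i v => PSR m i (v 0)) := by
  unfold PSR
  refine df_ball (Tm.var _) (df_ball (Tm.var _) (Df.imp (Df.eq (Tm.var _) (Tm.pr (Tm.var _) (Tm.var _))) (Df.imp (df_ph m (Tm.var _)) ((Sg.satE m (Tm.var _)).df))))

def PP (m : ℕ) (V : Thy) (i : Mdl) (z e d : i.C) : Prop := al V (PPR m) i (pr e d) z
def PS (m : ℕ) (V : Thy) (i : Mdl) (z e d : i.C) : Prop := al V (PSR m) i (pr e d) z

theorem D0.pp (m V) (hf : Tm f) (hg : Tm g) (hh : Tm h) : D0 (fun i v => PP m V i (f i v) (g i v) (h i v)) :=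
  al_d0 _ _ (Tm.pr hg hh) hf
theorem D0.ps (m V) (hf : Tm f) (hg : Tm g) (hh : Tm h) : D0 (fun i v => PS m V i (f i v) (g i v) (h i v)) :=
  al_d0 _ _ (Tm.pr hg hh) hf

theorem pp_spec {V : Thy} (c : CompThy V) (e : ExtPA V) (m a d : ℕ) :
    (∀ i : Mdl, Md V i → (ph m i (d : i.C) → ¬ SatE m (a : i.C))) ↔ ∃ z : ℕ, PP m V natM z a d := by
  have := al_spec c e (df_ppr m) (pr a d)
  refine Iff.trans ?_ this
  refine forall_congr' fun i => imp_congr_right fun _ => ?_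
  constructor
  · intro h b _ d' _ hh
    rw [pr_cast] at hh
    obtain ⟨e1, e2⟩ := pr_inj hh
    subst e1 e2
    exact h
  · intro h
    refine h a ?_ d ?_ ?_
    · rw [pr_cast]; exact le_pr_left _ _
    · rw [pr_cast]; exact le_pr_right _ _
    · rw [pr_cast]
theorem ps_spec {V : Thy} (c : CompThy V) (e : ExtPA V) (m a d : ℕ) :
    (∀ i : Mdl, Md V i → (ph m i (d : i.C) → SatE m (a : i.C))) ↔ ∃ z : ℕ, PS m V natM z a d := by
  have := al_spec c e (df_psr m) (pr a d)
  refine Iff.trans ?_ this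
  refine forall_congr' fun i => imp_congr_right fun _ => ?_
  constructor
  · intro h b _ d' _ hh
    rw [pr_cast] at hh
    obtain ⟨e1, e2⟩ := pr_inj hh
    subst e1 e2
    exact h
  · intro h
    refine h a ?_ d ?_ ?_
    · rw [pr_cast]; exact le_pr_left _ _
    · rw [pr_cast]; exact le_pr_right _ _
    · rw [pr_cast]

theorem pp_cast (m V) (i : Mdl) (z e d : ℕ) : PP m V i (z : i.C) (e : i.C) (d : i.C) ↔ PP m V natM z e d := by
  have := al_cast V (PPR m) i (pr e d) z
  rw [pr_cast] at this
  exact this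
theorem ps_cast (m V) (i : Mdl) (z e d : ℕ) : PS m V i (z : i.C) (e : i.C) (d : i.C) ↔ PS m V natM z e d := by
  have := al_cast V (PSR m) i (pr e d) z
  rw [pr_cast] at this
  exact this

variable (X : Cx)
def Ev (i : Mdl) (y d : i.C) : Prop := ∃ z, z ≤ y ∧ (al X.V1 (ER X.m) i d z ∨ al X.V2 (ER X.m) i d z)
def Fv (i : Mdl) (y d : i.C) : Prop := ∃ z, z ≤ y ∧ (al X.V1 (FR X.m) i d z ∨ al X.V2 (FR X.m) i d z ∨ al X.V3 (FR X.m) i d z)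
def Bad (i : Mdl) (x w d : i.C) : Prop := ∃ e, e ≤ x ∧ ∃ z, z ≤ x ∧ ((PP X.m X.V1 i z e d ∨ PP X.m X.V2 i z e d) ∧ ∃ u, u ≤ w ∧ We X.m u e)
def Sv (i : Mdl) (y d : i.C) : Prop := ∀ z, z ≤ y → ∀ e, e ≤ y → ((PS X.m X.V1 i z e d ∨ PS X.m X.V2 i z e d) → SatE X.m e)

theorem D0.ev (hf : Tm f) (hg : Tm g) : D0 (fun i v => Ev X i (f i v) (g i v)) := by
  unfold Ev
  exact D0.bex hf ((al_d0 _ _ hg.lift (Tm.var _)).or (al_d0 _ _ hg.lift (Tm.var _)))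
theorem D0.fv (hf : Tm f) (hg : Tm g) : D0 (fun i v => Fv X i (f i v) (g i v)) := by
  unfold Fv
  exact D0.bex hf ((al_d0 _ _ hg.lift (Tm.var _)).or ((al_d0 _ _ hg.lift (Tm.var _)).or (al_d0 _ _ hg.lift (Tm.var _))))
theorem Dn.bad (hf : Tm f) (hg : Tm g) (hh : Tm h) : Dn X.m (fun i v => Bad X i (f i v) (g i v) (h i v)) := by
  unfold Bad
  refine Dn.bex hf (Dn.bex hf.lift (Dn.and (Dn.of_D0 (D0.or ?_ ?_)) ?_))
  · exact D0.pp _ _ (Tm.var _) (Tm.var _) hh.lift.lift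
  · exact D0.pp _ _ (Tm.var _) (Tm.var _) hh.lift.lift
  · exact Dn.bex hg.lift.lift (Dn.we (Tm.var _) (Tm.var _))
theorem Sg.sv (hf : Tm f) (hg : Tm g) : Sg (X.m+1) (fun i v => Sv X i (f i v) (g i v)) := by
  unfold Sv
  refine Sg.ball hf (Sg.ball hf.lift (Sg.imp (Pg.of_D0 (D0.or ?_ ?_)) (Sg.satE _ (Tm.var _))))
  · exact D0.ps _ _ (Tm.var _) (Tm.var _) hg.lift.lift
  · exact D0.ps _ _ (Tm.var _) (Tm.var _) hg.lift.lift

theorem ev_cast (i : Mdl) (y d : ℕ) : Ev X i (y : i.C) (d : i.C) ↔ Ev X natM y d :=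
  (D0.ev (k := 2) X (Tm.var 0) (Tm.var 1)).cast i ![y, d]
theorem fv_cast (i : Mdl) (y d : ℕ) : Fv X i (y : i.C) (d : i.C) ↔ Fv X natM y d :=
  (D0.fv (k := 2) X (Tm.var 0) (Tm.var 1)).cast i ![y, d]
theorem Fv.mono {i : Mdl} {y y' d : i.C} (hh : Fv X i y d) (hy : y ≤ y') : Fv X i y' d := by
  obtain ⟨z, h1, h2⟩ := hh; exact ⟨z, h1.trans hy, h2⟩
theorem Sv.mono {i : Mdl} {y y' d : i.C} (hh : Sv X i y' d) (hy : y ≤ y') : Sv X i y d :=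
  fun z hz e he => hh z (hz.trans hy) e (he.trans hy)
end

theorem df_er (m : ℕ) : Df (k := 1) (fun i v => ER m i (v 0)) := (Sg.tu m (Tm.var _)).df.not
theorem df_fr (m : ℕ) : Df (k := 1) (fun i v => FR m i (v 0)) := (Sg.sg m (Tm.var _)).df

theorem ev_real (X : Cx) {y d : ℕ} (h : Ev X natM y d) :
    (∀ i, Md X.V1 i → ¬ tu X.m i (d : i.C)) ∨ (∀ i, Md X.V2 i → ¬ tu X.m i (d : i.C)) := by
  obtain ⟨z, _, h | h⟩ := h
  · exact Or.inl ((al_spec X.c1 X.e1 (df_er X.m) d).2 ⟨z, h⟩)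
  · exact Or.inr ((al_spec X.c2 X.e2 (df_er X.m) d).2 ⟨z, h⟩)

theorem fv_real (X : Cx) {y d : ℕ} (h : Fv X natM y d) :
    (∀ i, Md X.V1 i → sg X.m i (d : i.C)) ∨ (∀ i, Md X.V2 i → sg X.m i (d : i.C)) ∨ (∀ i, Md X.V3 i → sg X.m i (d : i.C)) := by
  obtain ⟨z, _, h | h | h⟩ := h
  · exact Or.inl ((al_spec X.c1 X.e1 (df_fr X.m) d).2 ⟨z, h⟩)
  · exact Or.inr (Or.inl ((al_spec X.c2 X.e2 (df_fr X.m) d).2 ⟨z, h⟩))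
  · exact Or.inr (Or.inr ((al_spec X.c3 X.e3 (df_fr X.m) d).2 ⟨z, h⟩))

/-- parameters of the construction -/
structure Pm (X : Cx) where
  χ : Mdl → Prop
  σ0 : Mdl → Prop
  St : ∀ i : Mdl, i.C → i.C → i.C → Prop
  hχ : SgS X.m χ
  hσ : SgS X.m σ0
  hSt : Sg (X.m+1) (k := 3) (fun i v => St i (v 0) (v 1) (v 2))

def tauF {X : Cx} (Y : Pm X) (i : Mdl) (d : i.C) : Prop := Y.χ i ∧ ∃ y, (Ev X i y d ∧ ¬ Fv X i y d) ∧ Sv X i y d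
def sigF {X : Cx} (Y : Pm X) (i : Mdl) (d : i.C) : Prop := Y.σ0 i ∨ (∃ y, Ev X i y d ∧ ¬ Fv X i y d) ∨
  ∃ x w, (Bad X i x w d ∧ ¬ Fv X i x d) ∧ Y.St i x w d

theorem SgS.lift {m : ℕ} {A : Mdl → Prop} (h : SgS m A) (k : ℕ) : Sg (ι := Mdl) (S := Mdl.C) (m+1) (k := k) (fun i _ => A i) :=
  Sg.comp h (s := fun j i v => 0) (fun j => Tm.zero)

theorem exists_diag {X : Cx} (Y : Pm X) : ∃ d : ℕ, ∀ i : Mdl, (sg X.m i (d : i.C) ↔ sigF Y i d) ∧ (tu X.m i (d : i.C) ↔ tauF Y i d) := by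
  refine diag X.m ?_ ?_
  · unfold sigF
    refine Sg.or (Y.hσ.lift 1) (Sg.or (Sg.ex (Sg.of_D0 (D0.and (D0.ev X (Tm.var _) (Tm.var _)) (D0.fv X (Tm.var _) (Tm.var _)).not))) ?_)
    refine Sg.ex (Sg.ex (Sg.and (Sg.and (Dn.bad X (Tm.var _) (Tm.var _) (Tm.var _)).sg (Sg.of_D0 (D0.fv X (Tm.var _) (Tm.var _)).not)) ?_))
    exact Sg.comp Y.hSt (s := fun j i v => ![v 1, v 2, v 0] j) (fun j => by
      fin_cases j
      · exact Tm.var 1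
      · exact Tm.var 2
      · exact Tm.var 0)
  · unfold tauF
    refine Sg.and (Y.hχ.lift 1) (Sg.ex (Sg.and (Sg.of_D0 (D0.and (D0.ev X (Tm.var _) (Tm.var _)) (D0.fv X (Tm.var _) (Tm.var _)).not)) ?_))
    exact Sg.sv X (Tm.var _) (Tm.var _)

structure Good (m : ℕ) (V : Thy) (σ τ : Mdl → Prop) : Prop where
  ts : ∀ i, Md V i → τ i → σ i
  pp : ∀ A, SgS m A → (∀ i, Md V i → σ i → ¬ τ i → ¬ A i) → ∀ i, Md V i → ¬ σ i → ¬ A i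
  ss : ∀ A, SgS m A → (∀ i, Md V i → σ i → ¬ τ i → A i) → ∀ i, Md V i → τ i → A i
  ns : ∃ i, Md V i ∧ ¬ σ i
  nt : ∃ i, Md V i ∧ τ i

def StOK {X : Cx} (Y : Pm X) (V : Thy) (d : ℕ) : Prop := ∀ i, Md V i → ∀ (x : ℕ) (u : i.C), ∃ w, u ≤ w ∧ Y.St i (x : i.C) w d

/-- the three possible outcomes -/
theorem tricho {X : Cx} (Y : Pm X) (d : ℕ) (hd : ∀ i : Mdl, (sg X.m i (d : i.C) ↔ sigF Y i d) ∧ (tu X.m i (d : i.C) ↔ tauF Y i d)) :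
    ((∀ V, (V = X.V1 ∨ V = X.V2) → StOK Y V d → Good X.m V (fun i => sg X.m i d) (fun i => tu X.m i d)) ∧
      (∃ i, Md X.V3 i ∧ ¬ sg X.m i (d : i.C))) ∨
    (∃ y0 : ℕ, Ev X natM y0 d ∧ ∀ i : Mdl, sg X.m i (d : i.C) ∧ (tu X.m i (d : i.C) ↔ Y.χ i ∧ Sv X i (y0 : i.C) d)) ∨
    (∃ y0 : ℕ, Fv X natM y0 d ∧ (∀ y : ℕ, y < y0 → ¬ Fv X natM y d ∧ ¬ Ev X natM y d) ∧
      ∀ i : Mdl, ¬ tu X.m i (d : i.C) ∧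
      (sg X.m i (d : i.C) ↔ Y.σ0 i ∨ ∃ x : ℕ, x < y0 ∧ ∃ w, Bad X i (x : i.C) w d ∧ Y.St i (x : i.C) w d)) := by
  classical
  by_cases hex : ∃ y : ℕ, Ev X natM y d ∨ Fv X natM y d
  · right
    have hsp := Nat.find_spec hex
    have hmin : ∀ y : ℕ, y < Nat.find hex → ¬ Fv X natM y d ∧ ¬ Ev X natM y d := fun y hy => by
      have := Nat.find_min hex hy
      push Not at this
      exact ⟨this.2, this.1⟩
    generalize Nat.find hex = y0 at hsp hmin
    by_cases hF : Fv X natM y0 d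
    · right
      refine ⟨y0, hF, hmin, fun i => ?_⟩
      have hsm : ∀ y : i.C, ¬ Fv X i y d → ∃ y' : ℕ, y' < y0 ∧ y = (y' : i.C) := by
        intro y hy
        have : ¬ (y0 : i.C) ≤ y := fun h => hy (((fv_cast X i y0 d).2 hF).mono X h)
        obtain ⟨y', h1, h2⟩ := le_cast (not_le.1 this).le
        refine ⟨y', ?_, h2⟩
        rcases h1.lt_or_eq with h | h
        · exact h
        · subst h; exact absurd h2.ge this
      have hne : ¬ ∃ y, Ev X i y d ∧ ¬ Fv X i y d := by
        rintro ⟨y, h1, h2⟩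
        obtain ⟨y', h3, rfl⟩ := hsm y h2
        exact (hmin y' h3).2 ((ev_cast X i y' d).1 h1)
      constructor
      · rw [(hd i).2]
        rintro ⟨_, y, h, _⟩
        exact hne ⟨y, h⟩
      · rw [(hd i).1]
        constructor
        · rintro (h | h | ⟨x, w, ⟨h1, h2⟩, h3⟩)
          · exact Or.inl h
          · exact absurd h hne
          · obtain ⟨x', h4, rfl⟩ := hsm x h2
            exact Or.inr ⟨x', h4, w, h1, h3⟩
        · rintro (h | ⟨x, h1, w, h2, h3⟩)
          · exact Or.inl h
          · exact Or.inr (Or.inr ⟨x, w, ⟨h2, fun h => (hmin x h1).1 ((fv_cast X i x d).1 h)⟩, h3⟩)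
    · left
      have hE : Ev X natM y0 d := hsp.resolve_right hF
      refine ⟨y0, hE, fun i => ⟨?_, ?_⟩⟩
      · rw [(hd i).1]
        exact Or.inr (Or.inl ⟨y0, (ev_cast X i y0 d).2 hE, fun h => hF ((fv_cast X i y0 d).1 h)⟩)
      · rw [(hd i).2]
        constructor
        · rintro ⟨h1, y, ⟨h2, _⟩, h3⟩
          refine ⟨h1, h3.mono X ?_⟩
          by_contra hlt
          obtain ⟨y', h4, rfl⟩ := le_cast (not_le.1 hlt).le
          rcases h4.lt_or_eq with h | h
          · exact (hmin y' h).2 ((ev_cast X i y' d).1 h2)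
          · subst h; exact hlt le_rfl
        · rintro ⟨h1, h2⟩
          exact ⟨h1, y0, ⟨(ev_cast X i y0 d).2 hE, fun h => hF ((fv_cast X i y0 d).1 h)⟩, h2⟩
  · left
    push Not at hex
    have hns : ∀ {V : Thy}, CompThy V → ExtPA V → (∀ z : ℕ, ¬ al V (FR X.m) natM d z) → ∃ i, Md V i ∧ ¬ sg X.m i (d : i.C) := by
      intro V hc he h
      have := (al_spec hc he (df_fr X.m) d).not.2 (by push Not; exact h)
      push Not at this
      exact this
    constructor
    · intro V hV hSt
      have hc : CompThy V := by rcases hV with rfl | rfl; exacts [X.c1, X.c2]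
      have he : ExtPA V := by rcases hV with rfl | rfl; exacts [X.e1, X.e2]
      refine ⟨?_, ?_, ?_, ?_, ?_⟩
      · intro i _ h
        rw [(hd i).2] at h
        rw [(hd i).1]
        obtain ⟨_, y, h, _⟩ := h
        exact Or.inr (Or.inl ⟨y, h⟩)
      · intro A hA h i hi hns hAi
        apply hns
        rw [(hd i).1]
        obtain ⟨e, hAe⟩ := univS X.m hA
        obtain ⟨z, hz⟩ := (pp_spec hc he X.m e d).1 (fun j hj hp hs => h j hj hp.1 hp.2 ((hAe j).2 hs))
        obtain ⟨u, hu⟩ := (hAe i).1 hAi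
        obtain ⟨w, hw, hw2⟩ := hSt i hi (max e z) u
        refine Or.inr (Or.inr ⟨((max e z : ℕ) : i.C), w, ⟨⟨e, ?_, z, ?_, ?_, u, hw, hu⟩, ?_⟩, hw2⟩)
        · exact_mod_cast le_max_left e z
        · exact_mod_cast le_max_right e z
        · rcases hV with rfl | rfl
          · exact Or.inl ((pp_cast _ _ i z e d).2 hz)
          · exact Or.inr ((pp_cast _ _ i z e d).2 hz)
        · intro h'
          exact (hex _).2 ((fv_cast X i _ d).1 h')
      · intro A hA h i hi ht
        rw [(hd i).2] at ht
        obtain ⟨_, y, ⟨hy1, _⟩, hy2⟩ := ht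
        have hbig : ∀ x : ℕ, (x : i.C) ≤ y := by
          intro x
          by_contra hlt
          obtain ⟨y', h4, rfl⟩ := le_cast (not_le.1 hlt).le
          exact (hex y').1 ((ev_cast X i y' d).1 hy1)
        obtain ⟨e, hAe⟩ := univS X.m hA
        obtain ⟨z, hz⟩ := (ps_spec hc he X.m e d).1 (fun j hj hp => (hAe j).1 (h j hj hp.1 hp.2))
        rw [hAe]
        refine hy2 z (hbig z) e (hbig e) ?_
        rcases hV with rfl | rfl
        · exact Or.inl ((ps_cast _ _ i z e d).2 hz)
        · exact Or.inr ((ps_cast _ _ i z e d).2 hz)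
      · refine hns hc he fun z hz => (hex z).2 ⟨z, le_rfl, ?_⟩
        rcases hV with rfl | rfl
        · exact Or.inl hz
        · exact Or.inr (Or.inl hz)
      · by_contra hcon
        push Not at hcon
        obtain ⟨z, hz⟩ := (al_spec hc he (df_er X.m) d).1 hcon
        refine (hex z).1 ⟨z, le_rfl, ?_⟩
        rcases hV with rfl | rfl
        · exact Or.inl hz
        · exact Or.inr hz
    · exact hns X.c3 X.e3 fun z hz => (hex z).2 ⟨z, le_rfl, Or.inr (Or.inr hz)⟩
end

section

/-- some model of `T` refutes `σ0` and satisfies the `Π_{m+1}`-theory of `U` -/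
def Sep (m : ℕ) (T U : Thy) (σ0 : Mdl → Prop) : Prop :=
  ∃ i, Md T i ∧ ¬ σ0 i ∧ ∀ A, SgS m A → (∀ j, Md U j → ¬ A j) → ¬ A i

theorem satE_SgS (m e : ℕ) : SgS m (fun i => SatE m (e : i.C)) := Sg.satE m (Tm.natCast _)

theorem pp_real {X : Cx} {V : Thy} (hV : V = X.V1 ∨ V = X.V2) {z e d : ℕ} (h : PP X.m V natM z e d) :
    ∀ i : Mdl, Md V i → (ph X.m i (d : i.C) → ¬ SatE X.m (e : i.C)) := by
  rcases hV with rfl | rfl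
  · exact (pp_spec X.c1 X.e1 X.m e d).2 ⟨z, h⟩
  · exact (pp_spec X.c2 X.e2 X.m e d).2 ⟨z, h⟩
theorem ps_real {X : Cx} {V : Thy} (hV : V = X.V1 ∨ V = X.V2) {z e d : ℕ} (h : PS X.m V natM z e d) :
    ∀ i : Mdl, Md V i → (ph X.m i (d : i.C) → SatE X.m (e : i.C)) := by
  rcases hV with rfl | rfl
  · exact (ps_spec X.c1 X.e1 X.m e d).2 ⟨z, h⟩
  · exact (ps_spec X.c2 X.e2 X.m e d).2 ⟨z, h⟩

theorem bad_real {X : Cx} {i : Mdl} {x d : ℕ} {w : i.C} (h : Bad X i (x : i.C) w d) :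
    ∃ e : ℕ, e ≤ x ∧ ∃ z : ℕ, z ≤ x ∧ ∃ V, (V = X.V1 ∨ V = X.V2) ∧ PP X.m V natM z e d ∧ ∃ u, u ≤ w ∧ We X.m u (e : i.C) := by
  obtain ⟨e, he, z, hz, h1, h2⟩ := h
  obtain ⟨e, he', rfl⟩ := le_cast he
  obtain ⟨z, hz', rfl⟩ := le_cast hz
  rcases h1 with h1 | h1
  · exact ⟨e, he', z, hz', _, Or.inl rfl, (pp_cast _ _ i z e d).1 h1, h2⟩
  · exact ⟨e, he', z, hz', _, Or.inr rfl, (pp_cast _ _ i z e d).1 h1, h2⟩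

theorem bad_intro {X : Cx} (i : Mdl) {x d e z : ℕ} {w u : i.C} (he : e ≤ x) (hz : z ≤ x) {V : Thy} (hV : V = X.V1 ∨ V = X.V2)
    (h : PP X.m V natM z e d) (hu : u ≤ w) (h2 : We X.m u (e : i.C)) : Bad X i (x : i.C) w d := by
  refine ⟨e, by exact_mod_cast he, z, by exact_mod_cast hz, ?_, u, hu, h2⟩
  rcases hV with rfl | rfl
  · exact Or.inl ((pp_cast _ _ i z e d).2 h)
  · exact Or.inr ((pp_cast _ _ i z e d).2 h)

theorem l1_aux2 {X : Cx} (d y0 : ℕ) {V V' : Thy} (hV : V = X.V1 ∨ V = X.V2) (hV' : V' = X.V1 ∨ V' = X.V2)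
    (hVV : ∀ W, W = X.V1 ∨ W = X.V2 → W = V ∨ W = V') {σ0 : Mdl → Prop}
    (hs : Sep X.m V' V σ0) (hσ : ∀ i : Mdl, sg X.m i (d : i.C)) (hτ : ∀ i : Mdl, tu X.m i (d : i.C) ↔ Sv X i (y0 : i.C) d)
    (hp : ∀ i, Md V i → ¬ tu X.m i (d : i.C)) : False := by
  obtain ⟨i, hi, _, hA⟩ := hs
  have h1 : SgS X.m (fun i => ∀ z, z ≤ (y0 : i.C) → ∀ e, e ≤ (y0 : i.C) → (PS X.m V' i z e d → SatE X.m e)) := by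
    refine Sg.ball (Tm.natCast _) (Sg.ball (Tm.natCast _) (Sg.imp (Pg.of_D0 ?_) (Sg.satE _ (Tm.var _))))
    exact D0.ps _ _ (Tm.var _) (Tm.var _) (Tm.natCast _)
  refine hA _ h1 ?_ ?_
  · intro j hj hh
    apply hp j hj
    rw [hτ]
    have key : ∀ W, (W = X.V1 ∨ W = X.V2) → ∀ z, z ≤ (y0 : j.C) → ∀ e, e ≤ (y0 : j.C) → PS X.m W j z e d → SatE X.m e := by
      intro W hW z hz e he h
      rcases hVV W hW with rfl | rfl
      · obtain ⟨z, hz, rfl⟩ := le_cast hz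
        obtain ⟨e, he, rfl⟩ := le_cast he
        exact ps_real hV ((ps_cast _ _ j z e d).1 h) j hj ⟨hσ j, hp j hj⟩
      · exact hh z hz e he h
    intro z hz e he h
    rcases h with h | h
    · exact key _ (Or.inl rfl) z hz e he h
    · exact key _ (Or.inr rfl) z hz e he h
  · intro z hz e he h
    by_cases ht : tu X.m i (d : i.C)
    · refine (hτ i).1 ht z hz e he ?_
      rcases hV' with rfl | rfl
      · exact Or.inl h
      · exact Or.inr h
    · obtain ⟨z, hz, rfl⟩ := le_cast hz
      obtain ⟨e, he, rfl⟩ := le_cast he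
      exact ps_real hV' ((ps_cast _ _ i z e d).1 h) i hi ⟨hσ i, ht⟩

theorem l1_aux3 {X : Cx} (d y0 : ℕ) {V V' : Thy} (hVV : ∀ W, W = X.V1 ∨ W = X.V2 → W = V ∨ W = V')
    {σ0 : Mdl → Prop} (hs : Sep X.m V V' σ0) (hτ : ∀ i : Mdl, ¬ tu X.m i (d : i.C))
    (hσ : ∀ i : Mdl, sg X.m i (d : i.C) ↔ σ0 i ∨ ∃ x : ℕ, x < y0 ∧ ∃ w, Bad X i (x : i.C) w d ∧ True)
    (hp : ∀ i, Md V i → sg X.m i (d : i.C)) : False := by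
  obtain ⟨i, hi, hi2, hA⟩ := hs
  rcases (hσ i).1 (hp i hi) with h | ⟨x, hx, w, hB, _⟩
  · exact hi2 h
  obtain ⟨e, he, z, hz, W, hW, hP, u, hu, hw⟩ := bad_real hB
  rcases hVV W hW with rfl | rfl
  · exact pp_real hW hP i hi ⟨hp i hi, hτ i⟩ ⟨u, hw⟩
  · refine hA _ (satE_SgS X.m e) ?_ ⟨u, hw⟩
    rintro j hj ⟨u', hu'⟩
    refine pp_real hW hP j hj ⟨(hσ j).2 (Or.inr ⟨x, hx, u', ?_, trivial⟩), hτ j⟩ ⟨u', hu'⟩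
    exact bad_intro j he hz hW hP le_rfl hu'

theorem L1 (m : ℕ) {T U : Thy} (cT : CompThy T) (cU : CompThy U) (eT : ExtPA T) (eU : ExtPA U)
    {σ0 : Mdl → Prop} (h0 : SgS m σ0) (h1 : Sep m T U σ0) (h2 : Sep m U T σ0) :
    ∃ σ τ : Mdl → Prop, SgS m σ ∧ SgS m τ ∧ Good m T σ τ ∧ Good m U σ τ ∧ ∀ i, σ0 i → σ i := by
  let X : Cx := ⟨m, T, U, T, cT, cU, cT, eT, eU, eT⟩
  let Y : Pm X := ⟨fun _ => True, σ0, fun _ _ _ _ => True, Sg.of_D0 D0.true, h0, Sg.of_D0 D0.true⟩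
  obtain ⟨d, hd⟩ := exists_diag Y
  have hok : ∀ V, StOK Y V d := fun V i _ x u => ⟨u, le_rfl, trivial⟩
  refine ⟨fun i => sg m i (d : i.C), fun i => tu m i (d : i.C), Sg.sg m (Tm.natCast _), Sg.tu m (Tm.natCast _), ?_⟩
  have hlast : ∀ i, σ0 i → sg m i (d : i.C) := fun i h => (hd i).1.2 (Or.inl h)
  rcases tricho Y d hd with ⟨h, _⟩ | ⟨y0, hE, h⟩ | ⟨y0, hF, _, h⟩
  · exact ⟨h T (Or.inl rfl) (hok _), h U (Or.inr rfl) (hok _), hlast⟩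
  · exfalso
    have hτ : ∀ i : Mdl, tu X.m i (d : i.C) ↔ Sv X i (y0 : i.C) d := fun i => ((h i).2).trans ⟨fun h => h.2, fun h => ⟨trivial, h⟩⟩
    rcases ev_real X hE with hp | hp
    · exact l1_aux2 d y0 (V := T) (V' := U) (Or.inl rfl) (Or.inr rfl) (fun W h => h) h2 (fun i => (h i).1) hτ hp
    · exact l1_aux2 d y0 (V := U) (V' := T) (Or.inr rfl) (Or.inl rfl) (fun W h => h.symm) h1 (fun i => (h i).1) hτ hp
  · exfalso
    have k1 := fun hp => l1_aux3 (X := X) d y0 (V := T) (V' := U) (fun W h => h) h1 (fun i => (h i).1) (fun i => (h i).2) hp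
    have k2 := fun hp => l1_aux3 (X := X) d y0 (V := U) (V' := T) (fun W h => h.symm) h2 (fun i => (h i).1) (fun i => (h i).2) hp
    rcases fv_real X hF with hp | hp | hp
    · exact k1 hp
    · exact k2 hp
    · exact k1 hp
end

section

section
variable {M : Type} [PAM M]
def ix (x d g1 g2 : M) : M := pr g1 (tup ![x, d, g1, g2])
def gp (y q d g1 g2 : M) : M := pr g2 (tup ![y, q, d, g1, g2])
theorem ix_eq (x d g1 g2 : M) : ix x d g1 g2 = pr g1 (pr g2 (pr g1 (pr d (pr x 0)))) := rfl
theorem gp_eq (y q d g1 g2 : M) : gp y q d g1 g2 = pr g2 (pr g2 (pr g1 (pr d (pr q (pr y 0))))) := rfl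
theorem ix_cast (x d g1 g2 : ℕ) : ((ix x d g1 g2 : ℕ) : M) = ix (x : M) d g1 g2 := by simp [ix_eq]
theorem gp_cast (y q d g1 g2 : ℕ) : ((gp y q d g1 g2 : ℕ) : M) = gp (y : M) q d g1 g2 := by simp [gp_eq]
end

section
variable {k : ℕ} {f g h l f1 f2 : ∀ i : Mdl, (Fin k → i.C) → i.C}
theorem Tm.ix (hf : Tm f) (hg : Tm g) (h1 : Tm f1) (h2 : Tm f2) : Tm (fun i v => ix (f i v) (g i v) (f1 i v) (f2 i v)) :=
  Tm.pr h1 (Tm.pr h2 (Tm.pr h1 (Tm.pr hg (Tm.pr hf Tm.zero))))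
theorem Tm.gp (hf : Tm f) (hh : Tm h) (hg : Tm g) (h1 : Tm f1) (h2 : Tm f2) : Tm (fun i v => gp (f i v) (h i v) (g i v) (f1 i v) (f2 i v)) :=
  Tm.pr h2 (Tm.pr h2 (Tm.pr h1 (Tm.pr hg (Tm.pr hh (Tm.pr hf Tm.zero)))))

variable (X : Cx)
def PfU (i : Mdl) (e z : i.C) : Prop := al X.V1 (fun i e => ¬ SatE X.m e) i e z
def PfT (i : Mdl) (e z : i.C) : Prop := al X.V3 (fun i e => SatE X.m e) i e z
def KK (i : Mdl) (q w : i.C) : Prop := ∃ z, z ≤ q ∧ ∃ e, e ≤ q ∧ (PfU X i e z ∧ ∃ u, u ≤ w ∧ We X.m u e)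
def fb (i : Mdl) (b d : i.C) : Prop := ∃ z, z ≤ b ∧ (Fv X i z d ∧ ∀ y, y ≤ z → (Ev X i y d → Fv X i y d))
def Fs (i : Mdl) (b d : i.C) : Prop := fb X i b d ∨ (X.m ≠ 0 ∧ ∃ b', fb X i b' d)
def JJ (i : Mdl) (x s y d g1 g2 : i.C) : Prop := ∃ q, q ≤ s ∧ ∃ z, z ≤ s ∧ ∃ t, t ≤ s ∧
  (PfU X i (ix x d g1 g2) z ∧ (z ≤ q ∧ (ix x d g1 g2 ≤ q ∧ PfT X i (gp y q d g1 g2) t)))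
def StB (i : Mdl) (x w d g1 g2 : i.C) : Prop := x ≤ w ∧ ∃ s, s ≤ w ∧ ∃ y, y ≤ s ∧ (JJ X i x s y d g1 g2 ∧
  ((∀ s', s' ≤ s → (s' < s → ∀ y', y' ≤ s' → ¬ JJ X i x s' y' d g1 g2)) ∧ ¬ KK X i y w))
def RR (i : Mdl) (x w d g1 g2 : i.C) : Prop := (Bad X i x w d ∧ ¬ Fv X i x d) ∧ StB X i x w d g1 g2
def BB (i : Mdl) (w b d g1 g2 : i.C) : Prop := w ≤ b ∧ ∀ x, x ≤ w → ∀ w', w' ≤ w → (RR X i x w' d g1 g2 ∧ Fs X i b d →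
  ∃ u, u ≤ b ∧ We X.m u (ix x d g1 g2))
def gap (i : Mdl) (y q d g1 g2 : i.C) : Prop := ∃ v b, (KK X i y v ∧ BB X i v b d g1 g2) ∧ ¬ KK X i q b

theorem D0.pfU (hf : Tm f) (hg : Tm g) : D0 (fun i v => PfU X i (f i v) (g i v)) := al_d0 _ _ hf hg
theorem D0.pfT (hf : Tm f) (hg : Tm g) : D0 (fun i v => PfT X i (f i v) (g i v)) := al_d0 _ _ hf hg
theorem Dn.kk (hf : Tm f) (hg : Tm g) : Dn X.m (fun i v => KK X i (f i v) (g i v)) := by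
  unfold KK
  refine Dn.bex hf (Dn.bex hf.lift (Dn.and (Dn.of_D0 (D0.pfU X (Tm.var _) (Tm.var _))) ?_))
  exact Dn.bex hg.lift.lift (Dn.we (Tm.var _) (Tm.var _))
theorem D0.fb (hf : Tm f) (hg : Tm g) : D0 (fun i v => fb X i (f i v) (g i v)) := by
  unfold Guaspari.fb
  refine D0.bex hf (D0.and (D0.fv X (Tm.var _) hg.lift) (D0.ball (Tm.var _) (D0.imp ?_ ?_)))
  · exact D0.ev X (Tm.var _) hg.lift.lift
  · exact D0.fv X (Tm.var _) hg.lift.lift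
theorem Pg.fs (hf : Tm f) (hg : Tm g) : Pg (X.m+1) (fun i v => Fs X i (f i v) (g i v)) := by
  unfold Fs
  refine Pg.or (Pg.of_D0 (D0.fb X hf hg)) ?_
  rcases Nat.eq_zero_or_pos X.m with hm | hm
  · refine (Pg.of_D0 D0.false).of_iff ?_
    intro i v
    simp [hm]
  · obtain ⟨m', hm'⟩ := Nat.exists_eq_succ_of_ne_zero hm.ne'
    have : Sg X.m (fun i v => ∃ b', Guaspari.fb X i b' (g i v)) := by
      rw [hm']
      exact Sg.ex (Sg.of_D0 (D0.fb X (Tm.var _) hg.lift))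
    refine (Sg.pg_succ this).of_iff ?_
    intro i v
    simp [hm.ne']
theorem D0.jj {f3 : ∀ i : Mdl, (Fin k → i.C) → i.C} (hf : Tm f) (hg : Tm g) (hh : Tm h) (h1 : Tm f1) (h2 : Tm f2) (h3 : Tm f3) :
    D0 (fun i v => JJ X i (f i v) (g i v) (h i v) (f1 i v) (f2 i v) (f3 i v)) := by
  unfold JJ
  have t1 := Tm.ix hf.lift.lift.lift h1.lift.lift.lift h2.lift.lift.lift h3.lift.lift.lift
  refine D0.bex hg (D0.bex hg.lift (D0.bex hg.lift.lift (D0.and ?_ (D0.and ?_ (D0.and ?_ ?_)))))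
  · exact D0.pfU X t1 (Tm.var _)
  · exact D0.le (Tm.var _) (Tm.var _)
  · exact D0.le t1 (Tm.var _)
  · exact D0.pfT X (Tm.gp hh.lift.lift.lift (Tm.var _) h1.lift.lift.lift h2.lift.lift.lift h3.lift.lift.lift) (Tm.var _)
theorem Dn.stB (hf : Tm f) (hg : Tm g) (hh : Tm h) (h1 : Tm f1) (h2 : Tm f2) :
    Dn X.m (fun i v => StB X i (f i v) (g i v) (h i v) (f1 i v) (f2 i v)) := by
  unfold StB
  refine Dn.and (Dn.of_D0 (D0.le hf hg)) (Dn.bex hg (Dn.bex (Tm.var _) (Dn.and (Dn.of_D0 ?_) (Dn.and (Dn.of_D0 ?_) (Dn.not ?_)))))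
  · exact D0.jj X hf.lift.lift (Tm.var _) (Tm.var _) hh.lift.lift h1.lift.lift h2.lift.lift
  · refine D0.ball (Tm.var _) (D0.imp (D0.lt (Tm.var _) (Tm.var _)) (D0.ball (Tm.var _) (D0.not ?_)))
    exact D0.jj X hf.lift.lift.lift.lift (Tm.var _) (Tm.var _) hh.lift.lift.lift.lift h1.lift.lift.lift.lift h2.lift.lift.lift.lift
  · exact Dn.kk X (Tm.var _) hg.lift.lift
theorem Dn.rr (hf : Tm f) (hg : Tm g) (hh : Tm h) (h1 : Tm f1) (h2 : Tm f2) :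
    Dn X.m (fun i v => RR X i (f i v) (g i v) (h i v) (f1 i v) (f2 i v)) := by
  unfold RR
  exact Dn.and (Dn.and (Dn.bad X hf hg hh) (Dn.of_D0 (D0.fv X hf hh).not)) (Dn.stB X hf hg hh h1 h2)
theorem Sg.bb (hf : Tm f) (hg : Tm g) (hh : Tm h) (h1 : Tm f1) (h2 : Tm f2) :
    Sg (X.m+1) (fun i v => BB X i (f i v) (g i v) (h i v) (f1 i v) (f2 i v)) := by
  unfold BB
  refine Sg.and (Sg.of_D0 (D0.le hf hg)) (Sg.ball hf (Sg.ball hf.lift (Sg.imp (Pg.and (Dn.pg ?_) ?_) (Dn.sg (Dn.bex hg.lift.lift ?_)))))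
  · exact Dn.rr X (Tm.var _) (Tm.var _) hh.lift.lift h1.lift.lift h2.lift.lift
  · exact Pg.fs X hg.lift.lift hh.lift.lift
  · exact Dn.we (Tm.var _) (Tm.ix (Tm.var _) hh.lift.lift.lift h1.lift.lift.lift h2.lift.lift.lift)
theorem Sg.gap (hf : Tm f) (hg : Tm g) (hh : Tm h) (h1 : Tm f1) (h2 : Tm f2) :
    Sg (X.m+1) (fun i v => gap X i (f i v) (g i v) (h i v) (f1 i v) (f2 i v)) := by
  unfold Guaspari.gap
  refine Sg.ex (Sg.ex (Sg.and (Sg.and ?_ ?_) ?_))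
  · exact (Dn.kk X hf.lift.lift (Tm.var _)).sg
  · exact Sg.bb X (Tm.var _) (Tm.var _) hh.lift.lift h1.lift.lift h2.lift.lift
  · exact (Dn.kk X hg.lift.lift (Tm.var _)).not.sg
end

section
variable (X : Cx)
theorem KK.mono {X : Cx} {i : Mdl} {q q' w w' : i.C} (h : KK X i q w) (hq : q ≤ q') (hw : w ≤ w') : KK X i q' w' := by
  obtain ⟨z, hz, e, he, hp, u, hu, hW⟩ := h
  exact ⟨z, hz.trans hq, e, he.trans hq, hp, u, hu.trans hw, hW⟩

theorem pfU_cast (i : Mdl) (e z : ℕ) : PfU X i (e : i.C) (z : i.C) ↔ PfU X natM e z := al_cast _ _ _ _ _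
theorem pfT_cast (i : Mdl) (e z : ℕ) : PfT X i (e : i.C) (z : i.C) ↔ PfT X natM e z := al_cast _ _ _ _ _
theorem pfU_spec (e : ℕ) : (∀ i, Md X.V1 i → ¬ SatE X.m (e : i.C)) ↔ ∃ z : ℕ, PfU X natM e z :=
  al_spec X.c1 X.e1 (R := fun i e => ¬ SatE X.m e) (Sg.satE X.m (Tm.var _)).df.not e
theorem pfT_spec (e : ℕ) : (∀ i, Md X.V3 i → SatE X.m (e : i.C)) ↔ ∃ z : ℕ, PfT X natM e z :=
  al_spec X.c3 X.e3 (R := fun i e => SatE X.m e) (Sg.satE X.m (Tm.var _)).df e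
theorem not_kk {i : Mdl} (hi : Md X.V1 i) (q : ℕ) (w : i.C) : ¬ KK X i (q : i.C) w := by
  rintro ⟨z, hz, e, he, hp, u, hu, hW⟩
  obtain ⟨z, hz, rfl⟩ := le_cast hz
  obtain ⟨e, he, rfl⟩ := le_cast he
  exact (pfU_spec X e).2 ⟨z, (pfU_cast X i e z).1 hp⟩ i hi ⟨u, hW⟩

theorem exists_codes : ∃ g1 g2 : ℕ,
    (∀ (i : Mdl) (x d : i.C), SatE X.m (ix x d (g1 : i.C) g2) ↔ (∃ w, RR X i x w d g1 g2) ∧ ∃ b, fb X i b d) ∧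
    (∀ (i : Mdl) (y q d : i.C), SatE X.m (gp y q d (g1 : i.C) g2) ↔ gap X i y q d g1 g2) := by
  have h1 : Sg (X.m+1) (k := 4) (fun i v => (∃ w, RR X i (v 0) w (v 1) (v 2) (v 3)) ∧ ∃ b, fb X i b (v 1)) := by
    refine Sg.and (Sg.ex (Dn.rr X (Tm.var _) (Tm.var _) (Tm.var _) (Tm.var _) (Tm.var _)).sg) (Sg.ex (Sg.of_D0 (D0.fb X (Tm.var _) (Tm.var _))))
  have h2 : Sg (X.m+1) (k := 5) (fun i v => gap X i (v 0) (v 1) (v 2) (v 3) (v 4)) :=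
    Sg.gap X (Tm.var _) (Tm.var _) (Tm.var _) (Tm.var _) (Tm.var _)
  obtain ⟨g1, hg1⟩ := univE X.m h1
  obtain ⟨g2, hg2⟩ := univE X.m h2
  exact ⟨g1, g2, fun i x d => (hg1 i ![x, d, g1, g2]).symm, fun i y q d => (hg2 i ![y, q, d, g1, g2]).symm⟩
end
end

section

theorem L2core {X : Cx} (h12 : X.V2 = X.V1) (Y : Pm X) (d : ℕ)
    (hd : ∀ i : Mdl, (sg X.m i (d : i.C) ↔ sigF Y i d) ∧ (tu X.m i (d : i.C) ↔ tauF Y i d))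
    (h0 : ∀ i, ¬ Y.σ0 i) (hχ : ∃ i, Md X.V1 i ∧ Y.χ i) (hok : StOK Y X.V1 d)
    (hC : ∀ y0 : ℕ, Fv X natM y0 d → (∀ y : ℕ, y < y0 → ¬ Fv X natM y d ∧ ¬ Ev X natM y d) →
      (∀ i : Mdl, (sg X.m i (d : i.C) ↔ ∃ x : ℕ, x < y0 ∧ ∃ w, Bad X i (x : i.C) w d ∧ Y.St i (x : i.C) w d)) →
      (∀ i, Md X.V1 i → ¬ sg X.m i (d : i.C)) → (∀ i, Md X.V3 i → sg X.m i (d : i.C)) → False) :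
    ∃ σ τ : Mdl → Prop, SgS X.m σ ∧ SgS X.m τ ∧ Good X.m X.V1 σ τ ∧ (∀ i, τ i → Y.χ i) ∧ ∃ i, Md X.V3 i ∧ ¬ σ i := by
  refine ⟨fun i => sg X.m i (d : i.C), fun i => tu X.m i (d : i.C), Sg.sg X.m (Tm.natCast _), Sg.tu X.m (Tm.natCast _), ?_⟩
  have hlast : ∀ i, tu X.m i (d : i.C) → Y.χ i := fun i h => ((hd i).2.1 h).1
  rcases tricho Y d hd with ⟨h, h3⟩ | ⟨y0, hE, h⟩ | ⟨y0, hF, hmin, h⟩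
  · exact ⟨h _ (Or.inl rfl) hok, hlast, h3⟩
  · exfalso
    have hE' : ∀ i, Md X.V1 i → ¬ tu X.m i (d : i.C) := by
      rcases ev_real X hE with h | h
      · exact h
      · rw [h12] at h; exact h
    obtain ⟨i, hi, hχi⟩ := hχ
    apply hE' i hi
    rw [(h i).2]
    refine ⟨hχi, ?_⟩
    intro z hz e he hp
    obtain ⟨z, hz', rfl⟩ := le_cast hz
    obtain ⟨e, he', rfl⟩ := le_cast he
    rw [h12] at hp
    exact ps_real (Or.inl rfl) ((ps_cast _ _ i z e d).1 (or_self_iff.1 hp)) i hi ⟨(h i).1, hE' i hi⟩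
  · exfalso
    have hs : ∀ i : Mdl, (sg X.m i (d : i.C) ↔ ∃ x : ℕ, x < y0 ∧ ∃ w, Bad X i (x : i.C) w d ∧ Y.St i (x : i.C) w d) := by
      intro i
      rw [(h i).2]
      simp [h0 i]
    have hU : ∀ i, Md X.V1 i → ¬ sg X.m i (d : i.C) := by
      intro i hi hsi
      obtain ⟨x, hx, w, hB, _⟩ := (hs i).1 hsi
      obtain ⟨e, he, z, hz, V, hV, hP, u, hu, hw⟩ := bad_real hB
      have : V = X.V1 := by rcases hV with h | h; exacts [h, h.trans h12]
      subst this
      exact pp_real hV hP i hi ⟨hsi, (h i).1⟩ ⟨u, hw⟩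
    obtain ⟨i, hi, _⟩ := hχ
    refine hC y0 hF hmin hs hU ?_
    rcases fv_real X hF with h | h | h
    · exact absurd (h i hi) (hU i hi)
    · rw [h12] at h; exact absurd (h i hi) (hU i hi)
    · exact h

theorem exists_bb {X : Cx} {g1 g2 : ℕ} (hg : ∀ (i : Mdl) (x d : i.C), SatE X.m (ix x d (g1 : i.C) g2) ↔ (∃ w, RR X i x w d g1 g2) ∧ ∃ b, fb X i b d)
    (i : Mdl) (d w : i.C) : ∃ b, BB X i w b d g1 g2 := by
  by_cases hf : ∃ b, fb X i b d
  · have hdf : Df (ι := Mdl) (S := Mdl.C) (k := 4) (fun i v => (∃ w', w' ≤ v 0 ∧ RR X i (v 2) w' (v 1) g1 g2) → We X.m (v 3) (ix (v 2) (v 1) (g1 : i.C) g2)) := by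
      refine Df.imp (Sg.df (Dn.sg (m := X.m) (Dn.bex (Tm.var _) ?_))) (Sg.df (Dn.sg (m := X.m) (Dn.we (Tm.var _) (Tm.ix (Tm.var _) (Tm.var _) (Tm.natCast _) (Tm.natCast _)))))
      exact Dn.rr X (Tm.var _) (Tm.var _) (Tm.var _) (Tm.natCast _) (Tm.natCast _)
    obtain ⟨φ, hφ⟩ := hdf
    obtain ⟨z, hz⟩ := collection (M := i.C) (k := 2) ![w, d]
      (fun p x u => (∃ w', w' ≤ p 0 ∧ RR X i x w' (p 1) g1 g2) → We X.m u (ix x (p 1) (g1 : i.C) g2)) ⟨φ, fun _ v => hφ i v⟩ w (by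
        intro x _
        by_cases hR : ∃ w', w' ≤ w ∧ RR X i x w' d g1 g2
        · obtain ⟨w', _, hR⟩ := hR
          obtain ⟨u, hu⟩ := (hg i x d).2 ⟨⟨w', hR⟩, hf⟩
          exact ⟨u, fun _ => hu⟩
        · exact ⟨0, fun h => absurd h hR⟩)
    refine ⟨max w z, le_max_left _ _, fun x hx w' hw' hR => ?_⟩
    obtain ⟨u, hu, hu2⟩ := hz x hx
    exact ⟨u, hu.trans (le_max_right _ _), hu2 ⟨w', hw', hR.1⟩⟩
  · refine ⟨w, le_rfl, fun x _ w' _ hR => absurd ?_ hf⟩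
    rcases hR.2 with h | h
    · exact ⟨_, h⟩
    · exact h.2

theorem exists_bound (P : ℕ → ℕ → Prop) (n : ℕ) : ∃ Y : ℕ, ∀ e, e < n → (∃ z, P e z) → ∃ z, z ≤ Y ∧ P e z := by
  induction n with
  | zero => exact ⟨0, fun e he => absurd he (Nat.not_lt_zero _)⟩
  | succ n ih =>
    obtain ⟨Y, hY⟩ := ih
    by_cases h : ∃ z, P n z
    · obtain ⟨z, hz⟩ := h
      refine ⟨max Y z, fun e he hp => ?_⟩
      rcases Nat.lt_succ_iff_lt_or_eq.1 he with h | rfl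
      · obtain ⟨z', h1, h2⟩ := hY e h hp
        exact ⟨z', h1.trans (le_max_left _ _), h2⟩
      · exact ⟨z, le_max_right _ _, hz⟩
    · refine ⟨Y, fun e he hp => ?_⟩
      rcases Nat.lt_succ_iff_lt_or_eq.1 he with h' | rfl
      · exact hY e h' hp
      · exact absurd hp h

theorem l2_caseA {X : Cx} (h12 : X.V2 = X.V1) {χ : Mdl → Prop} (hS : SgS X.m χ) (hχ : ∃ i, Md X.V1 i ∧ χ i)
    {g1 g2 : ℕ} (hg : ∀ (i : Mdl) (x d : i.C), SatE X.m (ix x d (g1 : i.C) g2) ↔ (∃ w, RR X i x w d g1 g2) ∧ ∃ b, fb X i b d)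
    (dB q0 : ℕ) (hA : ∀ y : ℕ, ¬ ∀ i, Md X.V3 i → gap X i (y : i.C) q0 dB g1 g2) :
    ∃ σ τ : Mdl → Prop, SgS X.m σ ∧ SgS X.m τ ∧ Good X.m X.V1 σ τ ∧ (∀ i, τ i → χ i) ∧ ∃ i, Md X.V3 i ∧ ¬ σ i := by
  let Y : Pm X := ⟨χ, fun _ => False, fun i x w d => ∃ b, BB X i w b dB g1 g2 ∧ ¬ KK X i q0 b, hS, Sg.of_D0 D0.false, by
    refine Sg.ex (Sg.and ?_ (Dn.sg (Dn.not ?_)))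
    · exact Sg.bb X (Tm.var _) (Tm.var _) (Tm.natCast _) (Tm.natCast _) (Tm.natCast _)
    · exact Dn.kk X (Tm.natCast _) (Tm.var _)⟩
  obtain ⟨d, hd⟩ := exists_diag Y
  have hok' : ∀ i, Md X.V1 i → ∀ (x : ℕ) (u : i.C), Y.St i (x : i.C) u d := by
    intro i hi x u
    obtain ⟨b, hb⟩ := exists_bb hg i (dB : i.C) u
    exact ⟨b, hb, not_kk X hi q0 b⟩
  refine L2core h12 Y d hd (fun _ h => h) hχ (fun i hi x u => ⟨u, le_rfl, hok' i hi x u⟩) ?_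
  intro y0 hF hmin hs hU hT
  obtain ⟨y, hy⟩ := exists_bound (fun e z => PfU X natM e z) y0
  refine hA (max y y0) fun i hi => ?_
  obtain ⟨x, hx, w, hB, b, hb1, hb2⟩ := (hs i).1 (hT i hi)
  obtain ⟨e, he, z, hz, V, hV, hP, u, hu, hw⟩ := bad_real hB
  have hUe : ∀ j, Md X.V1 j → ¬ SatE X.m (e : j.C) := by
    rintro j hj ⟨u', hu'⟩
    exact hU j hj ((hs j).2 ⟨x, hx, u', bad_intro j he hz hV hP le_rfl hu', hok' j hj x u'⟩)
  obtain ⟨z', hz', hP'⟩ := hy e (he.trans_lt hx) ((pfU_spec X e).1 hUe)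
  refine ⟨w, b, ⟨⟨(z' : i.C), ?_, (e : i.C), ?_, (pfU_cast X i e z').2 hP', u, hu, hw⟩, hb1⟩, hb2⟩
  · exact_mod_cast hz'.trans (le_max_left _ _)
  · exact_mod_cast (he.trans hx.le).trans (le_max_right _ _)

theorem jj_cast (X : Cx) (i : Mdl) (x s y d g1 g2 : ℕ) : JJ X i (x : i.C) (s : i.C) (y : i.C) (d : i.C) (g1 : i.C) (g2 : i.C) ↔
    JJ X natM x s y d g1 g2 :=
  (D0.jj (k := 6) X (Tm.var 0) (Tm.var 1) (Tm.var 2) (Tm.var 3) (Tm.var 4) (Tm.var 5)).cast i ![x, s, y, d, g1, g2]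

theorem l2_caseB {X : Cx} (h12 : X.V2 = X.V1) (Y : Pm X) (h0 : ∀ i, ¬ Y.σ0 i) (hχ : ∃ i, Md X.V1 i ∧ Y.χ i) (hT : ∃ i, Md X.V3 i)
    {g1 g2 : ℕ} (hg1 : ∀ (i : Mdl) (x d : i.C), SatE X.m (ix x d (g1 : i.C) g2) ↔ (∃ w, RR X i x w d g1 g2) ∧ ∃ b, fb X i b d)
    (hg2 : ∀ (i : Mdl) (y q d : i.C), SatE X.m (gp y q d (g1 : i.C) g2) ↔ gap X i y q d g1 g2)
    (hSt : ∀ i x w d, Y.St i x w d ↔ StB X i x w d g1 g2) (d : ℕ)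
    (hd : ∀ i : Mdl, (sg X.m i (d : i.C) ↔ sigF Y i d) ∧ (tu X.m i (d : i.C) ↔ tauF Y i d))
    (hB : ∀ q : ℕ, ∃ y : ℕ, ∀ i, Md X.V3 i → gap X i (y : i.C) q d g1 g2) :
    ∃ σ τ : Mdl → Prop, SgS X.m σ ∧ SgS X.m τ ∧ Good X.m X.V1 σ τ ∧ (∀ i, τ i → Y.χ i) ∧ ∃ i, Md X.V3 i ∧ ¬ σ i := by
  classical
  -- the auxiliary sentences are refuted by `U`
  have hUx : ∀ x : ℕ, ∀ i, Md X.V1 i → ¬ SatE X.m (ix (x : i.C) d g1 g2) := by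
    intro x i hi hs
    obtain ⟨⟨w, ⟨hb, hF⟩, hst⟩, b, z, hz, hFz, hE⟩ := (hg1 i x d).1 hs
    have hσ : sg X.m i (d : i.C) := (hd i).1.2 (Or.inr (Or.inr ⟨x, w, ⟨hb, hF⟩, (hSt i _ _ _).2 hst⟩))
    have hτ : ¬ tu X.m i (d : i.C) := by
      intro ht
      obtain ⟨_, y, ⟨h1, h2⟩, _⟩ := (hd i).2.1 ht
      rcases le_total y z with h | h
      · exact h2 (hE y h h1)
      · exact h2 (hFz.mono X h)
    obtain ⟨e, he, z, hz, V, hV, hP, u, hu, hw⟩ := bad_real hb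
    have : V = X.V1 := by rcases hV with h | h; exacts [h, h.trans h12]
    subst this
    exact pp_real hV hP i hi ⟨hσ, hτ⟩ ⟨u, hw⟩
  -- real certificates exist
  have hcert : ∀ x : ℕ, ∃ s y : ℕ, y ≤ s ∧ JJ X natM x s y d g1 g2 := by
    intro x
    obtain ⟨z, hz⟩ := (pfU_spec X (ix x d g1 g2)).1 (fun i hi h => hUx x i hi (by rw [ix_cast] at h; exact h))
    obtain ⟨y, hy⟩ := hB (max z (ix x d g1 g2))
    obtain ⟨t, ht⟩ := (pfT_spec X (gp y (max z (ix x d g1 g2)) d g1 g2)).1 (fun i hi => by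
      rw [gp_cast]
      exact (hg2 i _ _ _).2 (hy i hi))
    refine ⟨max (max z (ix x d g1 g2)) (max t y), y, (le_max_right _ _).trans (le_max_right _ _), ?_⟩
    refine ⟨(max z (ix x d g1 g2) : ℕ), le_max_left _ _, (z : ℕ), (le_max_left _ _).trans (le_max_left _ _), (t : ℕ), (le_max_left _ _).trans (le_max_right _ _), hz, ?_, ?_, ht⟩
    · exact le_max_left z _
    · exact le_max_right z _
  refine L2core h12 Y d hd h0 hχ ?_ ?_
  · intro i hi x u
    have hex := hcert x
    obtain ⟨y, hy, hJ⟩ := Nat.find_spec hex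
    have hmin := fun s' h => Nat.find_min hex (m := s') h
    generalize Nat.find hex = s at hy hJ hmin
    refine ⟨max u (max (x : i.C) (s : i.C)), le_max_left _ _, ?_⟩
    rw [hSt]
    refine ⟨(le_max_left _ _).trans (le_max_right _ _), (s : i.C), (le_max_right _ _).trans (le_max_right _ _), (y : i.C), ?_, ?_, ?_, ?_⟩
    · exact_mod_cast hy
    · exact (jj_cast X i x s y d g1 g2).2 hJ
    · intro s' _ hlt y' hy' hJ'
      obtain ⟨s', hs', rfl⟩ := le_cast hlt.le
      obtain ⟨y', hy2, rfl⟩ := le_cast hy'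
      exact hmin s' (by exact_mod_cast hlt) ⟨y', hy2, (jj_cast X i x s' y' d g1 g2).1 hJ'⟩
    · exact not_kk X hi y _
  · intro y0 hF hmin hs hU hTs
    obtain ⟨i, hi⟩ := hT
    obtain ⟨x, hx, w, hb, hst⟩ := (hs i).1 (hTs i hi)
    have hFx : ¬ Fv X i (x : i.C) d := fun h => (hmin x hx).1 ((fv_cast X i x d).1 h)
    rw [hSt] at hst
    have hR : RR X i (x : i.C) w d g1 g2 := ⟨⟨hb, hFx⟩, hst⟩
    obtain ⟨hxw, s, hsw, y, hys, hJ, hleast, hK⟩ := hst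
    obtain ⟨s0, y1, hy1, hJ0⟩ := hcert x
    have hss : s ≤ (s0 : i.C) := by
      by_contra hlt
      exact hleast s0 (not_le.1 hlt).le (not_le.1 hlt) y1 (by exact_mod_cast hy1) ((jj_cast X i x s0 y1 d g1 g2).2 hJ0)
    obtain ⟨s, _, rfl⟩ := le_cast hss
    obtain ⟨y, _, rfl⟩ := le_cast hys
    obtain ⟨q, hq, z, hz, t, ht, hP1, hzq, hxq, hP2⟩ := hJ
    obtain ⟨q, _, rfl⟩ := le_cast hq
    obtain ⟨z, _, rfl⟩ := le_cast hz
    obtain ⟨t, _, rfl⟩ := le_cast ht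
    rw [← gp_cast, pfT_cast] at hP2
    have hgap := (pfT_spec X _).2 ⟨t, hP2⟩ i hi
    rw [gp_cast, hg2] at hgap
    obtain ⟨v, b, ⟨hKv, hvb, hBB⟩, hKq⟩ := hgap
    have hwv : w ≤ v := by
      by_contra hlt
      exact hK (hKv.mono le_rfl (not_le.1 hlt).le)
    have hfy : fb X i (y0 : i.C) d := by
      refine ⟨y0, le_rfl, (fv_cast X i y0 d).2 hF, fun y hy hE => ?_⟩
      obtain ⟨y, hy', rfl⟩ := le_cast hy
      rcases hy'.lt_or_eq with h | rfl
      · exact absurd ((ev_cast X i y d).1 hE) (hmin y h).2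
      · exact (fv_cast X i _ d).2 hF
    have hFs : Fs X i b d := by
      by_cases hm : X.m = 0
      · left
        have hyb : (y0 : i.C) ≤ b := by
          by_contra hlt
          obtain ⟨w, _, rfl⟩ := le_cast ((hwv.trans hvb).trans (not_le.1 hlt).le)
          have hcast := fun j => ((Dn.rr (k := 5) X (Tm.var 0) (Tm.var 1) (Tm.var 2) (Tm.var 3) (Tm.var 4)).2.2 hm).cast j ![x, w, d, g1, g2]
          obtain ⟨j, hj, _⟩ := hχ
          have hRj : RR X j (x : j.C) (w : j.C) d g1 g2 := (hcast j).2 ((hcast i).1 hR)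
          exact hU j hj ((hs j).2 ⟨x, hx, w, hRj.1.1, (hSt _ _ _ _).2 hRj.2⟩)
        obtain ⟨z, hz, h⟩ := hfy
        exact ⟨z, hz.trans hyb, h⟩
      · exact Or.inr ⟨hm, _, hfy⟩
    obtain ⟨u, hu, hWe⟩ := hBB x (hxw.trans hwv) w hwv ⟨hR, hFs⟩
    exact hKq ⟨z, hzq, _, hxq, hP1, u, hu, hWe⟩

theorem L2 (m : ℕ) {T U : Thy} (cT : CompThy T) (cU : CompThy U) (eT : ExtPA T) (eU : ExtPA U)
    {χ : Mdl → Prop} (hS : SgS m χ) (hχ : ∃ i, Md U i ∧ χ i) (hT : ∃ i, Md T i) :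
    ∃ σ τ : Mdl → Prop, SgS m σ ∧ SgS m τ ∧ Good m U σ τ ∧ (∀ i, τ i → χ i) ∧ ∃ i, Md T i ∧ ¬ σ i := by
  let X : Cx := ⟨m, U, U, T, cU, cU, cT, eU, eU, eT⟩
  obtain ⟨g1, g2, hg1, hg2⟩ := exists_codes X
  let Y : Pm X := ⟨χ, fun _ => False, fun i x w d => StB X i x w d g1 g2, hS, Sg.of_D0 D0.false,
    (Dn.stB X (Tm.var _) (Tm.var _) (Tm.var _) (Tm.natCast _) (Tm.natCast _)).sg⟩
  obtain ⟨d, hd⟩ := exists_diag Y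
  by_cases hB : ∀ q : ℕ, ∃ y : ℕ, ∀ i, Md X.V3 i → gap X i (y : i.C) q d g1 g2
  · exact l2_caseB (X := X) rfl Y (fun _ h => h) hχ hT hg1 hg2 (fun _ _ _ _ => Iff.rfl) d hd hB
  · push Not at hB
    obtain ⟨q0, hq⟩ := hB
    refine l2_caseA (X := X) rfl hS hχ hg1 d q0 (fun y h => ?_)
    obtain ⟨i, h1, h2⟩ := hq y
    exact h2 (h i h1)
end


theorem sgs_of_sigma {m : ℕ} {s : Snt} (h : s ∈ SigmaS (m+1)) : SgS m (fun i => i.C ⊨ s) := by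
  have := Sg.of_fml (ι := Mdl) (S := Mdl.C) (show IsSigmaFml (m+1) s from h)
  refine this.of_iff fun i v => ?_
  rw [Subsingleton.elim v default]
  exact iff_of_eq (by unfold Sentence.Realize Formula.Realize; congr 1)

theorem sgs_of_pi {m : ℕ} {s : Snt} (h : s ∈ PiS (m+1)) : SgS m (fun i => ¬ i.C ⊨ s) := by
  have : Sg _ _ := Pg.of_fml (ι := Mdl) (S := Mdl.C) (show IsPiFml (m+1) s from h)
  refine this.of_iff fun i v => ?_
  rw [Subsingleton.elim v default]
  exact not_congr (iff_of_eq (by unfold Sentence.Realize Formula.Realize; congr 1))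

theorem SgS.sigma {m : ℕ} {A : Mdl → Prop} (h : SgS m A) : ∃ s ∈ SigmaS (m+1), ∀ i : Mdl, i.C ⊨ s ↔ A i := by
  obtain ⟨⟨s, hs, hs2⟩, _⟩ := Sg.fml h
  refine ⟨s, hs, fun i => Iff.trans (iff_of_eq ?_) (hs2 i default)⟩
  unfold Sentence.Realize Formula.Realize; congr 1

theorem SgS.pi {m : ℕ} {A : Mdl → Prop} (h : SgS m A) : ∃ s ∈ PiS (m+1), ∀ i : Mdl, i.C ⊨ s ↔ ¬ A i := by
  obtain ⟨_, ⟨s, hs, hs2⟩⟩ := Sg.fml h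
  refine ⟨s, hs, fun i => Iff.trans (iff_of_eq ?_) (hs2 i default)⟩
  unfold Sentence.Realize Formula.Realize; congr 1

theorem md_iff (V : Thy) (i : Mdl) : Md V i ↔ ∀ φ ∈ V, i.C ⊨ φ := Theory.model_iff _

theorem md_add {V : Thy} {φ : Snt} {i : Mdl} : Md (add V φ) i ↔ Md V i ∧ i.C ⊨ φ := by
  simp only [md_iff, add, Set.mem_insert_iff]
  constructor
  · intro h; exact ⟨fun ψ hψ => h ψ (Or.inr hψ), h φ (Or.inl rfl)⟩
  · rintro ⟨h, h'⟩ ψ (rfl | hψ)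
    · exact h'
    · exact h ψ hψ

theorem ext_add {V : Thy} {φ : Snt} (h : ExtPA V) : ExtPA (add V φ) := h.mono (Set.subset_insert _ _)

theorem con_iff {V : Thy} (h : ExtPA V) : Con V ↔ ∃ i, Md V i := by
  unfold Con
  rw [prv_iff h]
  push Not
  refine exists_congr fun i => ?_
  have : ¬ i.C ⊨ (⊥ : Snt) := id
  tauto

theorem nprv {V : Thy} (h : ExtPA V) {φ : Snt} : ¬ Prv V φ ↔ ∃ i, Md V i ∧ ¬ i.C ⊨ φ := by
  rw [prv_iff h]; push Not; rfl

theorem md_union {T U : Thy} {i : Mdl} : Md (T ∪ U) i ↔ Md T i ∧ Md U i := by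
  simp only [md_iff, Set.mem_union]
  constructor
  · intro h; exact ⟨fun ψ hψ => h ψ (Or.inl hψ), fun ψ hψ => h ψ (Or.inr hψ)⟩
  · rintro ⟨h, h'⟩ ψ (hψ | hψ)
    · exact h ψ hψ
    · exact h' ψ hψ

theorem sgs_list (m : ℕ) (l : List Snt) (h : ∀ π ∈ l, π ∈ PiS (m+1)) : SgS m (fun i => ∃ π ∈ l, ¬ i.C ⊨ π) := by
  induction l with
  | nil => exact (Sg.of_D0 D0.false).of_iff fun i v => by simp
  | cons a l ih =>
    refine (Sg.or (sgs_of_pi (h a (by simp))) (ih fun π hπ => h π (by simp [hπ]))).of_iff fun i v => ?_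
    simp

theorem incon {m : ℕ} {T U : Thy} (eT : ExtPA T) (eU : ExtPA U) (h : ¬ Con (T ∪ ThIn (PiS (m+1)) U)) :
    ∃ κ : Mdl → Prop, SgS m κ ∧ (∀ i, Md T i → κ i) ∧ ∀ i, Md U i → ¬ κ i := by
  classical
  unfold Con at h
  rw [not_not] at h
  obtain ⟨T0, h1, h2⟩ := Theory.models_iff_finset_models.1 h
  let l : List Snt := T0.toList.filter (fun π => π ∈ ThIn (PiS (m+1)) U)
  have hl : ∀ π, π ∈ l ↔ π ∈ T0 ∧ π ∈ ThIn (PiS (m+1)) U := by intro π; simp [l]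
  refine ⟨_, sgs_list m l fun π hπ => ((hl π).1 hπ).2.1, fun i hi => ?_, fun i hi => ?_⟩
  · by_contra hn
    push Not at hn
    have : i.C ⊨ (T0 : Thy) := (md_iff _ i).2 fun φ hφ => by
      rcases h1 hφ with h3 | h3
      · exact (md_iff _ i).1 hi φ h3
      · exact hn φ ((hl φ).2 ⟨hφ, h3⟩)
    exact (Theory.ModelsBoundedFormula.realize_sentence h2 i.C : i.C ⊨ (⊥ : Snt))
  · rintro ⟨π, hπ, hn⟩
    exact hn ((prv_iff eU π).1 ((hl π).1 hπ).2.2 i hi)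

theorem sep_of_con {m : ℕ} {T U : Thy} (eT : ExtPA T) (eU : ExtPA U) (h : Con (T ∪ ThIn (PiS (m+1)) U)) :
    Sep m T U (fun _ => False) := by
  obtain ⟨i, hi⟩ := (con_iff (eT.mono Set.subset_union_left)).1 h
  obtain ⟨hi1, hi2⟩ := md_union.1 hi
  refine ⟨i, hi1, id, fun A hA hU => ?_⟩
  obtain ⟨p, hp, hp2⟩ := hA.pi
  exact (hp2 i).1 ((md_iff _ i).1 hi2 p ⟨hp, (prv_iff eU p).2 fun j hj => (hp2 j).2 (hU j hj)⟩)

theorem Good.spcons {m : ℕ} {V : Thy} {σ τ : Mdl → Prop} (eV : ExtPA V) (g : Good m V σ τ) {φ : Snt}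
    (hφ : ∀ i : Mdl, i.C ⊨ φ ↔ σ i ∧ ¬ τ i) : SPCons (m+1) V φ := by
  intro s hs p hp h
  rw [prv_iff (ext_add eV)] at h
  rw [prv_iff eV]
  have hh : ∀ i, Md V i → σ i → ¬ τ i → i.C ⊨ s ∧ i.C ⊨ p := fun i hi h1 h2 => by
    have := h i (md_add.2 ⟨hi, (hφ i).2 ⟨h1, h2⟩⟩)
    simpa [Sentence.Realize, Formula.Realize] using this
  intro i hi
  have hpp := g.pp _ (sgs_of_pi hp) (fun i hi h1 h2 => not_not.2 (hh i hi h1 h2).2) i hi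
  have hss := g.ss _ (sgs_of_sigma hs) (fun i hi h1 h2 => (hh i hi h1 h2).1) i hi
  have : i.C ⊨ s ∨ i.C ⊨ p := by
    by_cases h1 : σ i
    · by_cases h2 : τ i
      · exact Or.inl (hss h2)
      · exact Or.inl (hh i hi h1 h2).1
    · exact Or.inr (not_not.1 (hpp h1))
  simpa [Sentence.Realize, Formula.Realize] using this

theorem final {m : ℕ} {T U : Thy} (eT : ExtPA T) (eU : ExtPA U) {σ τ : Mdl → Prop} (hσ : SgS m σ) (hτ : SgS m τ)
    (gT : Good m T σ τ) (gU : Good m U σ τ) : ∃ φ ∈ SigAndPiS (m+1), SimExSP (m+1) T U φ := by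
  obtain ⟨s, hs, hs2⟩ := hσ.sigma
  obtain ⟨p, hp, hp2⟩ := hτ.pi
  have hφ : ∀ i : Mdl, i.C ⊨ (s ⊓ p : Snt) ↔ σ i ∧ ¬ τ i := fun i => by
    rw [← hs2, ← hp2]; simp [Sentence.Realize, Formula.Realize]
  refine ⟨s ⊓ p, ⟨s, hs, p, hp, rfl⟩, gT.spcons eT hφ, gU.spcons eU hφ, ⟨s, hs, ?_, ?_, ?_, ?_⟩, ⟨p, hp, ?_, ?_, ?_, ?_⟩⟩
  · exact (prv_iff (ext_add eT) _).2 fun i hi => (hs2 i).2 ((hφ i).1 (md_add.1 hi).2).1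
  · exact (prv_iff (ext_add eU) _).2 fun i hi => (hs2 i).2 ((hφ i).1 (md_add.1 hi).2).1
  · obtain ⟨i, h1, h2⟩ := gT.ns
    exact (nprv eT).2 ⟨i, h1, fun h => h2 ((hs2 i).1 h)⟩
  · obtain ⟨i, h1, h2⟩ := gU.ns
    exact (nprv eU).2 ⟨i, h1, fun h => h2 ((hs2 i).1 h)⟩
  · exact (prv_iff (ext_add eT) _).2 fun i hi => (hp2 i).2 ((hφ i).1 (md_add.1 hi).2).2
  · exact (prv_iff (ext_add eU) _).2 fun i hi => (hp2 i).2 ((hφ i).1 (md_add.1 hi).2).2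
  · obtain ⟨i, h1, h2⟩ := gT.nt
    exact (nprv eT).2 ⟨i, h1, fun h => (hp2 i).1 h h2⟩
  · obtain ⟨i, h1, h2⟩ := gU.nt
    exact (nprv eU).2 ⟨i, h1, fun h => (hp2 i).1 h h2⟩

theorem Good.congr {m : ℕ} {V : Thy} {σ τ σ' τ' : Mdl → Prop} (g : Good m V σ τ)
    (h : ∀ i, Md V i → (σ' i ↔ σ i)) (h' : ∀ i, Md V i → (τ' i ↔ τ i)) : Good m V σ' τ' where
  ts i hi ht := (h i hi).2 (g.ts i hi ((h' i hi).1 ht))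
  pp A hA hh i hi hn := g.pp A hA (fun j hj h1 h2 => hh j hj ((h j hj).2 h1) (mt (h' j hj).1 h2)) i hi (mt (h i hi).2 hn)
  ss A hA hh i hi hn := g.ss A hA (fun j hj h1 h2 => hh j hj ((h j hj).2 h1) (mt (h' j hj).1 h2)) i hi ((h' i hi).1 hn)
  ns := let ⟨i, h1, h2⟩ := g.ns; ⟨i, h1, mt (h i h1).1 h2⟩
  nt := let ⟨i, h1, h2⟩ := g.nt; ⟨i, h1, (h' i h1).2 h2⟩

theorem glue {m : ℕ} {T U : Thy} (hT : GoodThy T) (hU : GoodThy U) (h : ¬ Con (T ∪ ThIn (PiS (m+1)) U))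
    (hb : ¬ ThIn (PiS (m+1)) T ⊆ Th U) :
    ∃ σ τ : Mdl → Prop, SgS m σ ∧ SgS m τ ∧ Good m T σ τ ∧ Good m U σ τ := by
  obtain ⟨cT, nT, eT⟩ := hT
  obtain ⟨cU, nU, eU⟩ := hU
  obtain ⟨κ, hκ, kT, kU⟩ := incon eT eU h
  obtain ⟨ρ, ⟨hρ, hρT⟩, hρU⟩ := Set.not_subset.1 hb
  obtain ⟨σU, τU, hσU, hτU, gU, hχ, i0, hi0, hn0⟩ := L2 m cT cU eT eU (sgs_of_pi hρ) ((nprv eU).1 hρU) ((con_iff eT).1 nT)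
  have hsep : Sep m T T σU := ⟨i0, hi0, hn0, fun A _ hA => hA i0 hi0⟩
  obtain ⟨σT, τT, hσT, hτT, gT, _, hle⟩ := L1 m cT cT eT eT hσU hsep hsep
  refine ⟨fun i => (κ i ∧ σT i) ∨ σU i, fun i => (κ i ∧ τT i) ∨ τU i, Sg.or (Sg.and hκ hσT) hσU, Sg.or (Sg.and hκ hτT) hτU,
    gT.congr (fun i hi => ?_) (fun i hi => ?_), gU.congr (fun i hi => ?_) (fun i hi => ?_)⟩
  · have := kT i hi
    have := hle i
    tauto
  · have := kT i hi
    have h3 : ¬ τU i := fun h4 => hχ i h4 ((prv_iff eT ρ).1 hρT i hi)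
    tauto
  · have := kU i hi
    tauto
  · have := kU i hi
    tauto

theorem one_two {m : ℕ} {T U : Thy} (hT : GoodThy T) (hU : GoodThy U) (h : Bpair (m+1) T U) :
    ∃ φ ∈ SigAndPiS (m+1), SimExSP (m+1) T U φ := by
  have : ∃ σ τ : Mdl → Prop, SgS m σ ∧ SgS m τ ∧ Good m T σ τ ∧ Good m U σ τ := by
    by_cases h1 : Con (T ∪ ThIn (PiS (m+1)) U)
    · by_cases h2 : Con (U ∪ ThIn (PiS (m+1)) T)
      · obtain ⟨σ, τ, a, b, c, d, _⟩ := L1 m hT.1 hU.1 hT.2.2 hU.2.2 (Sg.of_D0 D0.false) (sep_of_con hT.2.2 hU.2.2 h1) (sep_of_con hU.2.2 hT.2.2 h2)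
        exact ⟨σ, τ, a, b, c, d⟩
      · obtain ⟨σ, τ, a, b, c, d⟩ := glue hU hT h2 (h.2.resolve_right h2)
        exact ⟨σ, τ, a, b, d, c⟩
    · exact glue hT hU h1 (h.1.resolve_right h1)
  obtain ⟨σ, τ, a, b, c, d⟩ := this
  exact final hT.2.2 hU.2.2 a b c d

theorem three_one_aux {m : ℕ} {T U : Thy} (eT : ExtPA T) (eU : ExtPA U) {φ ψ : Snt} (hφ : SPCons (m+1) T φ)
    (hψ : ψ ∈ PiS (m+1)) (h1 : Prv (add T φ) ψ) (h2 : ¬ Prv U ψ) :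
    ¬ ThIn (PiS (m+1)) T ⊆ Th U ∨ Con (T ∪ ThIn (PiS (m+1)) U) := by
  by_contra hn
  push Not at hn
  obtain ⟨hsub, hc⟩ := hn
  obtain ⟨κ, hκ, kT, kU⟩ := incon eT eU hc
  obtain ⟨e, he⟩ := univS m hκ
  obtain ⟨e', he'⟩ := univS m (sgs_of_pi hψ)
  let L : Mdl → Prop := fun i => ∃ u : i.C, We m u (e' : i.C) ∧ ∀ x, x ≤ u → (x < u → ¬ We m x (e : i.C))
  let N : Mdl → Prop := fun i => ∃ u : i.C, We m u (e : i.C) ∧ ∀ x, x ≤ u → ¬ We m x (e' : i.C)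
  have hL : SgS m L := by
    refine Sg.ex ?_
    refine (Dn.and (Dn.we (Tm.var _) (Tm.natCast _)) (Dn.ball (Tm.var _) (Dn.imp (Dn.of_D0 (D0.lt (Tm.var _) (Tm.var _))) (Dn.we (Tm.var _) (Tm.natCast _)).not))).sg
  have hN : SgS m N := by
    refine Sg.ex ?_
    refine (Dn.and (Dn.we (Tm.var _) (Tm.natCast _)) (Dn.ball (Tm.var _) (Dn.we (Tm.var _) (Tm.natCast _)).not)).sg
  obtain ⟨s, hs, hs2⟩ := hN.sigma
  obtain ⟨p, hp, hp2⟩ := hL.pi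
  have key : Prv (add T φ) (s ⊓ p) := by
    rw [prv_iff (ext_add eT)]
    intro i hi
    have hno : ¬ SatE m (e' : i.C) := fun h => (he' i).2 h ((prv_iff (ext_add eT) ψ).1 h1 i hi)
    have a : i.C ⊨ s := by
      obtain ⟨u, hu⟩ := (he i).1 (kT i (md_add.1 hi).1)
      exact (hs2 i).2 ⟨u, hu, fun x _ hx => hno ⟨x, hx⟩⟩
    have b : i.C ⊨ p := (hp2 i).2 fun ⟨u, hu, _⟩ => hno ⟨u, hu⟩
    have : i.C ⊨ s ∧ i.C ⊨ p := ⟨a, b⟩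
    simpa [Sentence.Realize, Formula.Realize] using this
  have hTp : Prv T p := by
    have h3 := (prv_iff eT _).1 (hφ s hs p hp key)
    refine (prv_iff eT _).2 fun i hi => ?_
    have h4 : i.C ⊨ s ∨ i.C ⊨ p := by
      have := h3 i hi
      simpa [Sentence.Realize, Formula.Realize] using this
    refine h4.elim (fun h5 => (hp2 i).2 ?_) id
    obtain ⟨u, hu, hu2⟩ := (hs2 i).1 h5
    rintro ⟨v, hv, hv2⟩
    rcases le_or_gt v u with h6 | h6
    · exact hu2 v h6 hv
    · exact hv2 u h6.le h6 hu
  have hUp : Prv U p := hsub ⟨hp, hTp⟩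
  refine h2 ((prv_iff eU _).2 fun i hi => ?_)
  by_contra h7
  obtain ⟨u, hu⟩ := (he' i).1 h7
  exact (hp2 i).1 ((prv_iff eU _).1 hUp i hi) ⟨u, hu, fun x _ _ hx => kU i hi ((he i).2 ⟨x, hx⟩)⟩

/-- Theorem 5.15. -/
theorem stmt_10 (T U : Thy) (hT : GoodThy T) (hU : GoodThy U) (n : ℕ) (hn : 1 ≤ n) :
    List.TFAE
      [Bpair n T U,
       ∃ φ ∈ SigAndPiS n, SimExSP n T U φ,
       ∃ φ : Snt, SimExSP n T U φ] := by
  obtain ⟨m, rfl⟩ : ∃ m, n = m + 1 := ⟨n - 1, by omega⟩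
  tfae_have 1 → 2 := one_two hT hU
  tfae_have 2 → 3 := fun ⟨φ, _, h⟩ => ⟨φ, h⟩
  tfae_have 3 → 1 := by
    rintro ⟨φ, h1, h2, _, ψ, hψ, a, b, c, d⟩
    exact ⟨three_one_aux hT.2.2 hU.2.2 h1 hψ a d, three_one_aux hU.2.2 hT.2.2 h2 hψ b c⟩
  tfae_finish

end Guaspari
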